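/- For every dimension d ≥ 1 there exists p₀ such that for every p ≥ p₀ there exists N₀ (depending on p) such that for every integer N ≥ N₀ there exists γ₀ ∈ (0,1) (depending on N) such that for every γ ∈ (0, γ₀], every finite rectangle Λ ⊂ ℤ^d with |Λ| ≥ 2, and every δ with γ^{diam(Λ)} ≤ δ < 1, the minimum level spacing of the Anderson Hamiltonian satisfies P( min_{β ≠ β̃} |E_β − E_{β̃}| < δ ) ≤ |Λ|² · (log_γ δ)^{−(p/2 − 1)}, where (E_β)_{β=1,…,|Λ|} are the eigenvalues of H listed with multiplicity and the minimum is over pairs of distinct indices. -/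

import Mathlib

noncomputable section

open scoped BigOperators

/-- ℓ¹ distance on `ℤ^d` (natural-number valued). -/
def dist1 {d : ℕ} (x y : Fin d → ℤ) : ℕ := ∑ i, (x i - y i).natAbs

lemma dist1_comm {d : ℕ} (x y : Fin d → ℤ) : dist1 x y = dist1 y x :=
  Finset.sum_congr rfl fun i _ => by rw [← Int.natAbs_neg, neg_sub]

/-- ℓ¹ diameter of a finite subset of `ℤ^d`. -/
def diam1 {d : ℕ} (Λ : Finset (Fin d → ℤ)) : ℕ := (Λ ×ˢ Λ).sup fun p => dist1 p.1 p.2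

/-- `Λ` is a (possibly empty) rectangle: a product of integer intervals. -/
def IsRect {d : ℕ} (Λ : Finset (Fin d → ℤ)) : Prop := ∃ a b : Fin d → ℤ, Λ = Finset.Icc a b

/-- Entry of the Anderson Hamiltonian `H = H₀ - γ J` with potential `v`. -/
def hamEntry (d : ℕ) (γ : ℝ) (v : (Fin d → ℤ) → ℝ) (x y : Fin d → ℤ) : ℝ :=
  (if x = y then 2*d*γ + v x else 0) - γ * (if dist1 x y = 1 then 1 else 0)

/-- The Anderson Hamiltonian restricted to a finite set `X ⊂ ℤ^d`. -/
def hamOn (d : ℕ) (γ : ℝ) (v : (Fin d → ℤ) → ℝ) (X : Finset (Fin d → ℤ)) :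
    Matrix X X ℝ := Matrix.of fun x y => hamEntry d γ v x y

lemma hamOn_isHermitian (d : ℕ) (γ : ℝ) (v : (Fin d → ℤ) → ℝ) (X : Finset (Fin d → ℤ)) :
    (hamOn d γ v X).IsHermitian := by
  ext x y
  simp only [Matrix.conjTranspose_apply, hamOn, Matrix.of_apply, hamEntry, star_trivial]
  rw [dist1_comm]
  by_cases h : (y : Fin d → ℤ) = (x : Fin d → ℤ)
  · rw [if_pos h, if_pos h.symm, h]
  · rw [if_neg h, if_neg (show ¬((x : Fin d → ℤ) = (y : Fin d → ℤ)) from fun hh => h hh.symm)]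

open scoped Classical in
/-- Number of eigenvalues (with multiplicity) of a Hermitian matrix in `[a,b]`. -/
def countEigIn {n : Type*} [Fintype n] [DecidableEq n] {M : Matrix n n ℝ}
    (hM : M.IsHermitian) (a b : ℝ) : ℕ :=
  (Finset.univ.filter fun i => hM.eigenvalues i ∈ Set.Icc a b).card

/-- Expectation with respect to the uniform measure on a finite configuration space. -/
def expect {Ω : Type*} [Fintype Ω] (f : Ω → ℝ) : ℝ := (∑ ω, f ω) / Fintype.card Ω

open scoped Classical in
/-- Probability of an event with respect to the uniform measure on a finite space. -/
def prob {Ω : Type*} [Fintype Ω] (A : Ω → Prop) : ℝ :=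
  ((Finset.univ.filter A).card : ℝ) / Fintype.card Ω

/-- The random potential determined by a configuration `ω : Λ → Fin N`:
the value at `x ∈ Λ` is `ω x / (N-1) ∈ {0, 1/(N-1), …, 1}`. -/
def potential {d : ℕ} (N : ℕ) (Λ : Finset (Fin d → ℤ)) (ω : Λ → Fin N) :
    (Fin d → ℤ) → ℝ := fun x => if h : x ∈ Λ then (ω ⟨x, h⟩ : ℕ) / ((N : ℝ) - 1) else 0


namespace MLS

/-- Lattice sites. -/
abbrev Site (d : ℕ) := Fin d → ℤ

/-- sup-norm cube of radius `l` around `x`. -/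
def cube {d : ℕ} (x : Site d) (l : ℕ) : Finset (Site d) :=
  Finset.Icc (fun i => x i - (l : ℤ)) (fun i => x i + (l : ℤ))

/-- unit vector -/
def ev {d : ℕ} (i : Fin d) : Site d := Pi.single i 1

lemma mem_cube {d : ℕ} {x y : Site d} {l : ℕ} : y ∈ cube x l ↔ ∀ i, |y i - x i| ≤ (l : ℤ) := by
  simp only [cube, Finset.mem_Icc, Pi.le_def]
  constructor
  · rintro ⟨h1, h2⟩ i
    have := h1 i; have := h2 i
    rw [abs_le]; constructor <;> linarith
  · intro h
    constructor <;> intro i <;> have := abs_le.1 (h i) <;> linarith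

lemma cube_comm {d : ℕ} {x y : Site d} {l : ℕ} : y ∈ cube x l ↔ x ∈ cube y l := by
  simp only [mem_cube]
  constructor <;> intro h i <;> rw [abs_sub_comm] <;> exact h i

lemma self_mem_cube {d : ℕ} (x : Site d) (l : ℕ) : x ∈ cube x l := by
  simp [mem_cube]

lemma cube_trans {d : ℕ} {x y z : Site d} {l m : ℕ} (h1 : y ∈ cube x l) (h2 : z ∈ cube y m) :
    z ∈ cube x (l + m) := by
  rw [mem_cube] at *
  intro i
  have := h1 i; have := h2 i
  have h3 := abs_add_le (z i - y i) (y i - x i)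
  rw [sub_add_sub_cancel] at h3
  push_cast; linarith

lemma cube_mono {d : ℕ} {x : Site d} {l m : ℕ} (h : l ≤ m) : cube x l ⊆ cube x m := by
  intro y hy
  rw [mem_cube] at *
  intro i
  have : (l : ℤ) ≤ m := by exact_mod_cast h
  exact (hy i).trans this

lemma card_cube {d : ℕ} (x : Site d) (l : ℕ) : (cube x l).card = (2 * l + 1) ^ d := by
  rw [cube, Pi.card_Icc]
  have : ∀ i : Fin d, (Finset.Icc (x i - (l : ℤ)) (x i + l)).card = 2 * l + 1 := by
    intro i
    rw [Int.card_Icc]; omega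
  simp [this]

lemma ev_apply_abs {d : ℕ} (i j : Fin d) : |ev i j| ≤ 1 := by
  unfold ev
  by_cases h : j = i
  · subst h; simp
  · simp [h]

lemma add_ev_mem_cube {d : ℕ} (x : Site d) (i : Fin d) : x + ev i ∈ cube x 1 := by
  rw [mem_cube]; intro j
  simpa using ev_apply_abs i j

lemma sub_ev_mem_cube {d : ℕ} (x : Site d) (i : Fin d) : x - ev i ∈ cube x 1 := by
  rw [mem_cube]; intro j
  have : (x - ev i) j - x j = - ev i j := by simp
  rw [this, abs_neg]
  simpa using ev_apply_abs i j

/-- neighbour sum -/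
def nb {d : ℕ} (u : Site d → ℝ) (x : Site d) : ℝ := ∑ i, (u (x + ev i) + u (x - ev i))

/-- The operator `H - E` on functions. -/
def Lop {d : ℕ} (γ : ℝ) (v : Site d → ℝ) (E : ℝ) (u : Site d → ℝ) (x : Site d) : ℝ :=
  (2 * d * γ + v x - E) * u x - γ * nb u x

lemma natAbs_sum_one {d : ℕ} (f : Site d) (h : ∑ i, (f i).natAbs = 1) :
    ∃ i, f = ev i ∨ f = - ev i := by
  have h0 : ∃ i, f i ≠ 0 := by
    by_contra hc
    push Not at hc
    simp [hc] at h
  obtain ⟨i, hi⟩ := h0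
  refine ⟨i, ?_⟩
  have h1 := Finset.add_sum_erase Finset.univ (fun j => (f j).natAbs) (Finset.mem_univ i)
  rw [h] at h1
  have hpos : 1 ≤ (f i).natAbs := Nat.one_le_iff_ne_zero.2 (Int.natAbs_ne_zero.2 hi)
  have h2 : ∑ j ∈ Finset.univ.erase i, (f j).natAbs = 0 := by omega
  have h3 : (f i).natAbs = 1 := by omega
  have h4 : ∀ j, j ≠ i → f j = 0 := by
    intro j hj
    have := (Finset.sum_eq_zero_iff.1 h2) j (by simp [hj])
    simpa using this
  rcases Int.natAbs_eq (f i) with h5 | h5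
  · left; funext j
    by_cases hj : j = i
    · subst hj; simp [ev]; omega
    · simp [ev, hj, h4 j hj]
  · right; funext j
    by_cases hj : j = i
    · subst hj; simp [ev]; omega
    · simp [ev, hj, h4 j hj]

lemma ev_inj {d : ℕ} {i j : Fin d} (h : ev i = ev j) : i = j := by
  by_contra hne
  have := congrFun h i
  simp [ev, hne] at this

lemma ev_ne_neg {d : ℕ} (i j : Fin d) : ev i ≠ - ev j := by
  intro h
  have := congrFun h i
  by_cases hij : i = j
  · subst hij; simp [ev] at this
  · simp [ev, hij] at this

lemma dist1_eq_one_iff {d : ℕ} (x y : Site d) :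
    dist1 x y = 1 ↔ ∃ i, y = x + ev i ∨ y = x - ev i := by
  constructor
  · intro h
    rw [dist1_comm] at h
    obtain ⟨i, hi⟩ := natAbs_sum_one (y - x) (by simpa [dist1] using h)
    refine ⟨i, ?_⟩
    rcases hi with hi | hi
    · left; rw [← hi]; abel
    · right; rw [sub_eq_add_neg, ← hi]; abel
  · rintro ⟨i, h | h⟩ <;> subst h
    · simp only [dist1, Pi.add_apply, sub_add_cancel_left, Int.natAbs_neg]
      rw [Finset.sum_eq_single i]
      · simp [ev]
      · intro j _ hj; simp [ev, hj]
      · simp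
    · simp only [dist1, Pi.sub_apply, sub_sub_cancel]
      rw [Finset.sum_eq_single i]
      · simp [ev]
      · intro j _ hj; simp [ev, hj]
      · simp

lemma sum_ite_site {d : ℕ} (X : Finset (Site d)) (u : Site d → ℝ) (hu : ∀ x, x ∉ X → u x = 0)
    (z : Site d) : (∑ y ∈ X, if y = z then u y else 0) = u z := by
  rw [Finset.sum_ite_eq']
  split_ifs with h
  · rfl
  · exact (hu z h).symm

lemma nb_eq {d : ℕ} (X : Finset (Site d)) (u : Site d → ℝ) (hu : ∀ x, x ∉ X → u x = 0)
    (x : Site d) : (∑ y ∈ X, (if dist1 x y = 1 then (1:ℝ) else 0) * u y) = nb u x := by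
  have key : ∀ y, (if dist1 x y = 1 then (1:ℝ) else 0) * u y =
      ∑ i, ((if y = x + ev i then u y else 0) + (if y = x - ev i then u y else 0)) := by
    intro y
    by_cases h : dist1 x y = 1
    · rw [if_pos h, one_mul]
      obtain ⟨i, hi⟩ := (dist1_eq_one_iff x y).1 h
      rw [Finset.sum_eq_single i]
      · rcases hi with hi | hi
        · subst hi
          have : ¬ (x + ev i = x - ev i) := by
            rw [sub_eq_add_neg]; intro h; exact ev_ne_neg i i (add_left_cancel h)
          simp [this]
        · subst hi
          have : ¬ (x - ev i = x + ev i) := by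
            rw [sub_eq_add_neg]; intro h; exact ev_ne_neg i i (add_left_cancel h).symm
          simp [this]
      · intro j _ hj
        rcases hi with hi | hi
        · subst hi
          have h1 : ¬ (x + ev i = x - ev j) := by
            rw [sub_eq_add_neg]; intro h; exact ev_ne_neg i j (add_left_cancel h)
          have h2 : ¬ (x + ev i = x + ev j) := by
            intro h; exact hj (ev_inj (add_left_cancel h)).symm
          simp [h1, h2]
        · subst hi
          have h1 : ¬ (x - ev i = x + ev j) := by
            rw [sub_eq_add_neg]; intro h; exact ev_ne_neg j i (add_left_cancel h).symm
          have h2 : ¬ (x - ev i = x - ev j) := by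
            intro h; exact hj (ev_inj (sub_right_injective h)).symm
          simp [h1, h2]
      · simp
    · rw [if_neg h, zero_mul]
      symm
      apply Finset.sum_eq_zero
      intro i _
      have h1 : ¬ (y = x + ev i) := fun hh => h ((dist1_eq_one_iff x y).2 ⟨i, Or.inl hh⟩)
      have h2 : ¬ (y = x - ev i) := fun hh => h ((dist1_eq_one_iff x y).2 ⟨i, Or.inr hh⟩)
      simp [h1, h2]
  simp_rw [key]
  rw [Finset.sum_comm]
  simp_rw [Finset.sum_add_distrib, sum_ite_site X u hu]
  rw [nb, Finset.sum_add_distrib]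

/-- the matrix acts as `Lop` -/
lemma ham_apply {d : ℕ} (γ : ℝ) (v : Site d → ℝ) (X : Finset (Site d)) (u : Site d → ℝ)
    (hu : ∀ x, x ∉ X → u x = 0) (x : Site d) (hx : x ∈ X) :
    ∑ y ∈ X, hamEntry d γ v x y * u y = Lop γ v 0 u x := by
  have : ∀ y ∈ X, hamEntry d γ v x y * u y =
      (if y = x then (2*d*γ + v y) * u y else 0)
        - γ * ((if dist1 x y = 1 then (1:ℝ) else 0) * u y) := by
    intro y _
    unfold hamEntry
    by_cases h : x = y
    · subst h; rw [if_pos rfl, if_pos rfl]; ring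
    · have h' : ¬ (y = x) := fun hh => h hh.symm
      simp [h, h']
  rw [Finset.sum_congr rfl this, Finset.sum_sub_distrib, ← Finset.mul_sum, nb_eq X u hu,
    Finset.sum_ite_eq', if_pos hx, Lop]
  ring

lemma hamEntry_symm {d : ℕ} (γ : ℝ) (v : Site d → ℝ) (x y : Site d) :
    hamEntry d γ v x y = hamEntry d γ v y x := by
  unfold hamEntry
  rw [dist1_comm]
  by_cases h : x = y
  · subst h; rfl
  · have h' : ¬ (y = x) := fun hh => h hh.symm
    simp [h, h']

lemma Lop_shift {d : ℕ} (γ : ℝ) (v : Site d → ℝ) (E : ℝ) (u : Site d → ℝ) (x : Site d) :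
    Lop γ v E u x = Lop γ v 0 u x - E * u x := by
  unfold Lop; ring

lemma Lop_symm {d : ℕ} (γ : ℝ) (v : Site d → ℝ) (E : ℝ) (X : Finset (Site d)) (u w : Site d → ℝ)
    (hu : ∀ x, x ∉ X → u x = 0) (hw : ∀ x, x ∉ X → w x = 0) :
    ∑ x ∈ X, u x * Lop γ v E w x = ∑ x ∈ X, w x * Lop γ v E u x := by
  have h1 : ∀ u w : Site d → ℝ, (∀ x, x ∉ X → u x = 0) → (∀ x, x ∉ X → w x = 0) →
      ∑ x ∈ X, u x * Lop γ v E w x =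
      ∑ x ∈ X, ∑ y ∈ X, u x * hamEntry d γ v x y * w y - E * ∑ x ∈ X, u x * w x := by
    intro u w _ hw
    rw [Finset.mul_sum, ← Finset.sum_sub_distrib]
    apply Finset.sum_congr rfl
    intro x hx
    rw [Lop_shift, ← ham_apply γ v X w hw x hx, mul_sub, Finset.mul_sum]
    congr 1
    · apply Finset.sum_congr rfl; intros; ring
    · ring
  rw [h1 u w hu hw, h1 w u hw hu, Finset.sum_comm]
  congr 1
  · apply Finset.sum_congr rfl; intro y _
    apply Finset.sum_congr rfl; intro x _
    rw [hamEntry_symm]; ring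
  · congr 1; apply Finset.sum_congr rfl; intros; ring

/-- eigenvalues -/
def eig {d : ℕ} (γ : ℝ) (v : Site d → ℝ) (X : Finset (Site d)) (β : X) : ℝ :=
  (hamOn_isHermitian d γ v X).eigenvalues β

/-- eigenfunctions extended by zero -/
def ef {d : ℕ} (γ : ℝ) (v : Site d → ℝ) (X : Finset (Site d)) (β : X) : Site d → ℝ :=
  fun x => if h : x ∈ X then (hamOn_isHermitian d γ v X).eigenvectorBasis β ⟨x, h⟩ else 0

section
variable {d : ℕ} (γ : ℝ) (v : Site d → ℝ) (X : Finset (Site d))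

lemma ef_off (β : X) (x : Site d) (h : x ∉ X) : ef γ v X β x = 0 := by
  simp [ef, h]

lemma ef_on (β x : X) : ef γ v X β x = (hamOn_isHermitian d γ v X).eigenvectorBasis β x := by
  simp [ef]

lemma ef_eig (E : ℝ) (β : X) (x : Site d) (hx : x ∈ X) :
    Lop γ v E (ef γ v X β) x = (eig γ v X β - E) * ef γ v X β x := by
  rw [Lop_shift, ← ham_apply γ v X _ (ef_off γ v X β) x hx]
  have h := congrFun ((hamOn_isHermitian d γ v X).mulVec_eigenvectorBasis β) ⟨x, hx⟩
  rw [sub_mul]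
  congr 1
  rw [← Finset.sum_coe_sort X (fun y => hamEntry d γ v x y * ef γ v X β y)]
  simp only [ef_on]
  have e2 : ef γ v X β x = (hamOn_isHermitian d γ v X).eigenvectorBasis β ⟨x, hx⟩ :=
    ef_on γ v X β ⟨x, hx⟩
  rw [e2]
  simpa [Matrix.mulVec, dotProduct, hamOn, eig] using h

lemma ef_orth (β β' : X) :
    ∑ x ∈ X, ef γ v X β x * ef γ v X β' x = if β = β' then 1 else 0 := by
  rw [← Finset.sum_coe_sort X (fun y => ef γ v X β y * ef γ v X β' y)]
  simp only [ef_on]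
  have h := (orthonormal_iff_ite.1 (hamOn_isHermitian d γ v X).eigenvectorBasis.orthonormal) β' β
  simp only [PiLp.inner_apply, RCLike.inner_apply, conj_trivial] at h
  rw [h]
  simp [eq_comm]

lemma parseval (u : Site d → ℝ) :
    ∑ β : X, (∑ x ∈ X, ef γ v X β x * u x) ^ 2 = ∑ x ∈ X, u x ^ 2 := by
  have h := (hamOn_isHermitian d γ v X).eigenvectorBasis.sum_sq_norm_inner_right
    (WithLp.toLp 2 (fun x : X => u x))
  rw [EuclideanSpace.norm_sq_eq] at h
  rw [← Finset.sum_coe_sort X (fun y => u y ^ 2)]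
  simp only [Real.norm_eq_abs, sq_abs] at h
  rw [← h]
  apply Finset.sum_congr rfl
  intro β _
  rw [← Finset.sum_coe_sort X (fun y => ef γ v X β y * u y)]
  simp only [ef_on]
  simp [PiLp.inner_apply, mul_comm]

lemma ef_inner_Lop (E : ℝ) (β : X) (u : Site d → ℝ) (hu : ∀ x, x ∉ X → u x = 0) :
    ∑ x ∈ X, ef γ v X β x * Lop γ v E u x =
      (eig γ v X β - E) * ∑ x ∈ X, ef γ v X β x * u x := by
  rw [Lop_symm γ v E X _ u (ef_off γ v X β) hu, Finset.mul_sum]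
  apply Finset.sum_congr rfl
  intro x hx
  rw [ef_eig γ v X E β x hx]; ring

/-- spectral gap bound -/
lemma gap_bound (E η : ℝ) (hη : 0 ≤ η) (hg : ∀ β : X, η ≤ |eig γ v X β - E|)
    (u : Site d → ℝ) (hu : ∀ x, x ∉ X → u x = 0) :
    η ^ 2 * ∑ x ∈ X, u x ^ 2 ≤ ∑ x ∈ X, (Lop γ v E u x) ^ 2 := by
  rw [← parseval γ v X u, ← parseval γ v X (Lop γ v E u), Finset.mul_sum]
  apply Finset.sum_le_sum
  intro β _
  rw [ef_inner_Lop γ v X E β u hu, mul_pow]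
  apply mul_le_mul_of_nonneg_right _ (sq_nonneg _)
  rw [← sq_abs (eig γ v X β - E)]
  exact pow_le_pow_left₀ hη (hg β) 2

lemma Lop_congr {v' : Site d → ℝ} (E : ℝ) (u : Site d → ℝ) (x : Site d) (h : v x = v' x) :
    Lop γ v E u x = Lop γ v' E u x := by simp [Lop, h]

lemma eig_congr {v' : Site d → ℝ} (h : ∀ x ∈ X, v x = v' x) : eig γ v X = eig γ v' X := by
  have : hamOn d γ v X = hamOn d γ v' X := by
    ext x y
    simp only [hamOn, Matrix.of_apply, hamEntry, h x x.2]
  funext β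
  unfold eig
  congr 1

end

lemma Lop_add {d : ℕ} (γ : ℝ) (v : Site d → ℝ) (E : ℝ) {ι : Type*} (s : Finset ι) (c : ι → ℝ)
    (f : ι → Site d → ℝ) (x : Site d) :
    Lop γ v E (fun y => ∑ b ∈ s, c b * f b y) x = ∑ b ∈ s, c b * Lop γ v E (f b) x := by
  have : nb (fun y => ∑ b ∈ s, c b * f b y) x = ∑ b ∈ s, c b * nb (f b) x := by
    unfold nb
    simp_rw [Finset.mul_sum, mul_add, ← Finset.sum_add_distrib]
    rw [Finset.sum_comm]
  unfold Lop
  rw [this, Finset.mul_sum, Finset.mul_sum, ← Finset.sum_sub_distrib]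
  apply Finset.sum_congr rfl; intros; ring

lemma nb_le {d : ℕ} (u : Site d → ℝ) (x : Site d) (M : ℝ) (h : ∀ y ∈ cube x 1, |u y| ≤ M) :
    |nb u x| ≤ 2 * d * M := by
  unfold nb
  refine (Finset.abs_sum_le_sum_abs _ _).trans ?_
  have : ∀ i ∈ (Finset.univ : Finset (Fin d)), |u (x + ev i) + u (x - ev i)| ≤ 2 * M := by
    intro i _
    have h1 := h _ (add_ev_mem_cube x i)
    have h2 := h _ (sub_ev_mem_cube x i)
    have := abs_add_le (u (x + ev i)) (u (x - ev i))
    linarith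
  refine (Finset.sum_le_sum this).trans ?_
  simp; linarith

end MLS
namespace MLS

section ProbTools
open scoped Classical
variable {Ω : Type*} [Fintype Ω]

lemma prob_nonneg (A : Ω → Prop) : 0 ≤ prob A := by
  unfold prob; positivity

lemma prob_le_one (A : Ω → Prop) : prob A ≤ 1 := by
  unfold prob
  apply div_le_one_of_le₀ _ (by positivity)
  exact_mod_cast Finset.card_le_univ _

lemma prob_mono {A B : Ω → Prop} (h : ∀ ω, A ω → B ω) : prob A ≤ prob B := by
  unfold prob
  gcongr with ω
  exact h ω

lemma prob_or (A B : Ω → Prop) : prob (fun ω => A ω ∨ B ω) ≤ prob A + prob B := by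
  unfold prob
  rw [← add_div]
  gcongr
  refine le_trans ?_ (Nat.cast_le.2 (Finset.card_union_le _ _) |>.trans (Nat.cast_add _ _).le)
  apply Nat.cast_le.2
  apply Finset.card_le_card
  intro ω h
  simpa using h

lemma prob_exists {ι : Type*} (C : Finset ι) (B : ι → Ω → Prop) :
    prob (fun ω => ∃ c ∈ C, B c ω) ≤ ∑ c ∈ C, prob (B c) := by
  unfold prob
  rw [← Finset.sum_div]
  gcongr
  refine le_trans ?_ ((Nat.cast_le (α := ℝ)).2
    (Finset.card_biUnion_le (s := C) (t := fun c => Finset.univ.filter (B c))) |>.trans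
      (Nat.cast_sum _ _).le)
  apply Nat.cast_le.2
  apply Finset.card_le_card
  intro ω h
  simpa using h

lemma prob_exists_le {ι : Type*} (C : Finset ι) (B : ι → Ω → Prop) (q : ℝ)
    (h : ∀ c ∈ C, prob (B c) ≤ q) :
    prob (fun ω => ∃ c ∈ C, B c ω) ≤ C.card * q := by
  refine (prob_exists C B).trans ?_
  refine (Finset.sum_le_sum h).trans ?_
  simp

/-- counting with codes -/
lemma code_count {ι κ : Type*} [Fintype ι] [DecidableEq ι] (N J : ℕ) (hN : 0 < N)
    (A : (ι → Fin N) → Prop) (C : Finset κ) (B : κ → (ι → Fin N) → Prop) (R : κ → Finset ι)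
    (hcov : ∀ ω, A ω → ∃ c ∈ C, B c ω)
    (hR : ∀ c ∈ C, ∀ ω, B c ω → J ≤ (R c).card)
    (huniq : ∀ c ∈ C, ∀ ω ω', B c ω → B c ω' → (∀ x, x ∉ R c → ω x = ω' x) → ω = ω') :
    prob A ≤ C.card / (N : ℝ) ^ J := by
  refine (prob_mono hcov).trans ?_
  rw [div_eq_mul_inv]
  apply prob_exists_le
  intro c hc
  by_cases hne : ∃ ω, B c ω
  swap
  · push Not at hne
    have : prob (B c) = 0 := by
      unfold prob
      have : (Finset.univ.filter (B c)) = ∅ := by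
        ext ω; simp [hne ω]
      simp [this]
    rw [this]; positivity
  obtain ⟨ω0, h0⟩ := hne
  have hJ := hR c hc ω0 h0
  -- injectivity
  have hcard : (Finset.univ.filter (B c)).card ≤ N ^ (Fintype.card ι - (R c).card) := by
    let f : (ι → Fin N) → ({x // x ∉ R c} → Fin N) := fun ω x => ω x.1
    have hinj : Set.InjOn f (Finset.univ.filter (B c)) := by
      intro ω hω ω' hω' hf
      simp only [Finset.coe_filter, Finset.mem_univ, true_and, Set.mem_ofPred_eq] at hω hω'
      apply huniq c hc ω ω' hω hω'
      intro x hx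
      exact congrFun hf ⟨x, hx⟩
    have := Finset.card_le_card_of_injOn f (t := Finset.univ) (fun _ _ => Finset.mem_univ _) hinj
    refine this.trans (le_of_eq ?_)
    rw [Finset.card_univ, Fintype.card_fun, Fintype.card_fin]
    congr 1
    rw [Fintype.card_subtype_compl]
    simp
  have hle : (R c).card ≤ Fintype.card ι := Finset.card_le_univ _
  unfold prob
  rw [Fintype.card_fun, Fintype.card_fin, div_le_iff₀ (by positivity)]
  have h1 : ((N:ℝ) ^ J)⁻¹ * ((N ^ Fintype.card ι : ℕ) : ℝ) = (N : ℝ) ^ (Fintype.card ι - J) := by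
    have hNr : (N : ℝ) ≠ 0 := by positivity
    rw [pow_sub₀ _ hNr (hJ.trans hle)]; push_cast; ring
  rw [h1]
  have h2 : ((Finset.univ.filter (B c)).card : ℝ) ≤ (N : ℝ) ^ (Fintype.card ι - (R c).card) := by
    exact_mod_cast hcard
  refine h2.trans ?_
  apply pow_le_pow_right₀ (by exact_mod_cast hN)
  omega

/-- mixing of two configurations -/
def mix {ι α : Type*} (S : Finset ι) (p : (ι → α) × (ι → α)) : (ι → α) × (ι → α) :=
  (fun x => if x ∈ S then p.1 x else p.2 x, fun x => if x ∈ S then p.2 x else p.1 x)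

lemma mix_mix {ι α : Type*} (S : Finset ι) : Function.Involutive (mix (α := α) S) := by
  rintro ⟨a, b⟩
  simp only [mix, Prod.mk.injEq]
  constructor <;> funext x <;> by_cases h : x ∈ S <;> simp [h]

/-- independence -/
lemma prob_swap {ι α : Type*} [Fintype ι] [DecidableEq ι] [Fintype α] (S : Finset ι)
    (A : (ι → α) → Prop) (G : (ι → α) → (ι → α) → Prop)
    (hG : ∀ a b a' b', (∀ x ∈ S, a x = a' x) → (∀ x, x ∉ S → b x = b' x) → G a b → G a' b')
    (hA : ∀ ω, A ω → G ω ω) (f : (ι → α) → ℝ) (p : ℝ)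
    (hp : ∀ a, prob (G a) ≤ f a * p) :
    prob A ≤ expect f * p := by
  have hcard : (0:ℝ) ≤ Fintype.card (ι → α) := by positivity
  rcases hcard.eq_or_lt with h0 | hpos
  · unfold prob expect
    rw [← h0]; simp
  -- counting pairs
  have hinj : (Finset.univ.filter A ×ˢ (Finset.univ : Finset (ι → α))).card ≤
      (Finset.univ.filter fun p : (ι → α) × (ι → α) => G p.1 p.2).card := by
    apply Finset.card_le_card_of_injOn (mix S)
    · rintro ⟨a, b⟩ hab
      simp only [Finset.coe_product, Set.mem_prod, Finset.coe_filter, Finset.mem_univ, true_and,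
        Set.mem_ofPred_eq] at hab ⊢
      refine hG a a _ _ ?_ ?_ (hA a hab.1)
      · intro x hx; simp [mix, hx]
      · intro x hx; simp [mix, hx]
    · exact (mix_mix S).injective.injOn
  rw [Finset.card_product, Finset.card_univ] at hinj
  have h2 : (Finset.univ.filter fun p : (ι → α) × (ι → α) => G p.1 p.2).card =
      ∑ a, (Finset.univ.filter (G a)).card := by
    rw [← Finset.card_sigma]
    apply Finset.card_bij (fun p _ => ⟨p.1, p.2⟩)
    · rintro ⟨a, b⟩ h; simpa using h
    · rintro ⟨a, b⟩ _ ⟨a', b'⟩ _ h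
      simpa using h
    · rintro ⟨a, b⟩ h; exact ⟨(a, b), by simpa using h, rfl⟩
  rw [h2] at hinj
  have h3 : ∀ a, ((Finset.univ.filter (G a)).card : ℝ) ≤ f a * p * Fintype.card (ι → α) := by
    intro a
    have := hp a
    unfold prob at this
    rwa [div_le_iff₀ hpos] at this
  have h4 : ((Finset.univ.filter A).card : ℝ) * Fintype.card (ι → α) ≤
      ∑ a, f a * p * Fintype.card (ι → α) := by
    refine le_trans ?_ (Finset.sum_le_sum fun a _ => h3 a)
    exact_mod_cast hinj
  unfold prob expect
  rw [div_le_iff₀ hpos, div_mul_eq_mul_div, div_mul_cancel₀ _ hpos.ne']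
  rw [← Finset.sum_mul] at h4
  have h5 := le_of_mul_le_mul_right h4 hpos
  rwa [← Finset.sum_mul] at h5

lemma prob_indep {ι α : Type*} [Fintype ι] [DecidableEq ι] [Fintype α] (S : Finset ι)
    (A B : (ι → α) → Prop)
    (hA : ∀ a a', (∀ x ∈ S, a x = a' x) → A a → A a')
    (hB : ∀ b b', (∀ x, x ∉ S → b x = b' x) → B b → B b') :
    prob (fun ω => A ω ∧ B ω) ≤ prob A * prob B := by
  have := prob_swap S (fun ω => A ω ∧ B ω) (fun a b => A a ∧ B b)
    (fun a b a' b' h1 h2 h => ⟨hA a a' h1 h.1, hB b b' h2 h.2⟩) (fun ω h => h)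
    (fun a => if A a then 1 else 0) (prob B) (by
      intro a
      by_cases h : A a
      · simp [h]
      · have : prob (fun b => A a ∧ B b) = 0 := by
          unfold prob
          simp [h]
        rw [this]; simp [h])
  refine this.trans (le_of_eq ?_)
  congr 1
  unfold expect prob
  simp

lemma prob_swap_const {ι α σ : Type*} [Fintype ι] [DecidableEq ι] [Fintype α] (S : Finset ι)
    (T : (ι → α) → Finset σ) (F : σ → (ι → α) → Prop) (n p : ℝ) (hn : 0 ≤ n) (hp0 : 0 ≤ p)
    (hT : ∀ a a', (∀ x ∈ S, a x = a' x) → T a = T a')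
    (hF : ∀ e b b', (∀ x, x ∉ S → b x = b' x) → F e b → F e b')
    (hn' : ∀ a, ((T a).card : ℝ) ≤ n) (hp : ∀ e, prob (F e) ≤ p) :
    prob (fun ω => ∃ e ∈ T ω, F e ω) ≤ n * p := by
  have := prob_swap S (fun ω => ∃ e ∈ T ω, F e ω) (fun a b => ∃ e ∈ T a, F e b)
    (by
      rintro a b a' b' h1 h2 ⟨e, he, hf⟩
      exact ⟨e, by rwa [← hT a a' h1], hF e b b' h2 hf⟩) (fun ω h => h)
    (fun _ => n) p (by
      intro a
      refine (prob_exists_le (T a) F p fun e _ => hp e).trans ?_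
      exact mul_le_mul_of_nonneg_right (hn' a) hp0)
  refine this.trans ?_
  apply mul_le_mul_of_nonneg_right _ hp0
  unfold expect
  simp only [Finset.sum_const, Finset.card_univ, nsmul_eq_mul]
  rcases eq_or_ne (Fintype.card (ι → α) : ℝ) 0 with h | h
  · rw [h]; simpa using hn
  · rw [mul_div_cancel_left₀ _ h]

end ProbTools

end MLS
namespace MLS

/-- length scales -/
def LL (s : ℕ) : ℕ → ℕ
  | 0 => 2 ^ s
  | k + 1 => 2 ^ (12 + k) * LL s k

/-- decay exponents -/
def mm (s : ℕ) : ℕ → ℕ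
  | 0 => 2 ^ (s - 1)
  | k + 1 => (2 ^ (12 + k) - 1024) * mm s k

lemma LL_succ (s k : ℕ) : LL s (k + 1) = 2 ^ (12 + k) * LL s k := rfl
lemma mm_succ (s k : ℕ) : mm s (k + 1) = (2 ^ (12 + k) - 1024) * mm s k := rfl

lemma LL_pos (s k : ℕ) : 0 < LL s k := by
  induction k with
  | zero => simp [LL]
  | succ k ih => rw [LL_succ]; positivity

lemma g_ge (k : ℕ) : 4096 ≤ 2 ^ (12 + k) := by
  calc 4096 = 2 ^ 12 := by norm_num
    _ ≤ _ := Nat.pow_le_pow_right (by norm_num) (by omega)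

lemma mm_le (s k : ℕ) (hs : 1 ≤ s) : 2 * mm s k ≤ LL s k := by
  induction k with
  | zero =>
    simp only [mm, LL]
    obtain ⟨t, rfl⟩ := Nat.exists_eq_add_of_le hs
    simp [pow_add]
  | succ k ih =>
    rw [LL_succ, mm_succ]
    calc 2 * ((2 ^ (12 + k) - 1024) * mm s k) = (2 ^ (12 + k) - 1024) * (2 * mm s k) := by ring
      _ ≤ 2 ^ (12 + k) * LL s k := Nat.mul_le_mul (Nat.sub_le _ _) ih

lemma mm_ge_aux (s k : ℕ) (hs : 1 ≤ s) : LL s k * (2 ^ k + 1) ≤ 4 * 2 ^ k * mm s k := by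
  induction k with
  | zero =>
    simp only [mm, LL]
    obtain ⟨t, rfl⟩ := Nat.exists_eq_add_of_le hs
    simp [pow_add]; omega
  | succ k ih =>
    rw [LL_succ, mm_succ]
    have e : 2 ^ (12 + k) - 1024 = 1024 * (4 * 2 ^ k - 1) := by
      rw [pow_add]; omega
    rw [e, pow_succ, pow_add]
    have hk : 1 ≤ 2 ^ k := Nat.one_le_two_pow
    obtain ⟨c, hc⟩ : ∃ c, 2 ^ k = c + 1 := ⟨2 ^ k - 1, by omega⟩
    rw [hc] at ih ⊢
    have e2 : 4 * (c + 1) - 1 = 4 * c + 3 := by omega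
    rw [e2]
    nlinarith [Nat.mul_le_mul_left (2 * 1024 * (4 * c + 3)) ih, Nat.zero_le (LL s k * c)]

lemma mm_ge (s k : ℕ) (hs : 1 ≤ s) : LL s k ≤ 4 * mm s k := by
  have h := mm_ge_aux s k hs
  have h2 : LL s k * 2 ^ k ≤ (4 * mm s k) * 2 ^ k := by
    calc LL s k * 2 ^ k ≤ LL s k * (2 ^ k + 1) := Nat.mul_le_mul_left _ (by omega)
      _ ≤ _ := h
      _ = _ := by ring
  exact Nat.le_of_mul_le_mul_right h2 (by positivity)

/-- standing assumptions on the coupling -/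
structure HG (d : ℕ) (γ κ : ℝ) : Prop where
  hd : 1 ≤ d
  pos : 0 < γ
  κpos : 0 < κ
  κle : κ ≤ 1
  h1 : (514 : ℝ) ^ d * γ ≤ 1
  h2 : (2 * (d : ℝ)) ^ 2 * γ ≤ κ ^ 2

/-- far apart sites -/
def far {d : ℕ} (s k : ℕ) (x y : Site d) : Prop := y ∉ cube x (4 * LL s k)

/-- bad sites -/
def bad {d : ℕ} (γ κ : ℝ) (s : ℕ) : ℕ → Finset (Site d) → Site d → ℝ → (Site d → ℝ) → Prop
  | 0, X, x, E, v => ∃ y ∈ X ∩ cube x (LL s 0), |2 * d * γ + v y - E| ≤ κ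
  | k + 1, X, x, E, v =>
    (∃ x1 ∈ X ∩ cube x (LL s (k + 1)), ∃ x2 ∈ X ∩ cube x (LL s (k + 1)),
      far s k x1 x2 ∧ bad γ κ s k X x1 E v ∧ bad γ κ s k X x2 E v) ∨
    ∃ y ∈ X ∩ cube x (LL s (k + 1)),
      (∃ x1 ∈ X ∩ cube y (128 * LL s k), ∃ x2 ∈ X ∩ cube y (128 * LL s k),
        far s k x1 x2 ∧ bad γ κ s k (X ∩ cube y (128 * LL s k)) x1 E v ∧
          bad γ κ s k (X ∩ cube y (128 * LL s k)) x2 E v) ∨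
      ∃ β : ↥(X ∩ cube y (128 * LL s k)),
        |eig γ v (X ∩ cube y (128 * LL s k)) β - E| ≤ γ ^ (8 * LL s k)

/-- dependence of badness on the potential -/
lemma bad_congr {d : ℕ} (γ κ : ℝ) (s : ℕ) (k : ℕ) : ∀ (X : Finset (Site d)) (x : Site d) (E : ℝ)
    (v v' : Site d → ℝ), (∀ y ∈ X ∩ cube x (2 * LL s k), v y = v' y) →
    bad γ κ s k X x E v → bad γ κ s k X x E v' := by
  induction k with
  | zero =>
    rintro X x E v v' h ⟨y, hy, hb⟩
    refine ⟨y, hy, ?_⟩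
    rw [Finset.mem_inter] at hy
    rw [← h y (Finset.mem_inter.2 ⟨hy.1, cube_mono (by omega) hy.2⟩)]
    exact hb
  | succ k ih =>
    intro X x E v v' h hb
    have hg := g_ge k
    have hL : 4096 * LL s k ≤ LL s (k + 1) := by
      rw [LL_succ]; exact Nat.mul_le_mul_right _ hg
    rcases hb with ⟨x1, h1, x2, h2, hf, hb1, hb2⟩ | ⟨y, hy, hb⟩
    · have key : ∀ x' ∈ X ∩ cube x (LL s (k + 1)), ∀ y ∈ X ∩ cube x' (2 * LL s k), v y = v' y := by
        intro x' hx' y hy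
        rw [Finset.mem_inter] at hx' hy
        apply h
        rw [Finset.mem_inter]
        refine ⟨hy.1, cube_mono (by omega) (cube_trans hx'.2 hy.2)⟩
      exact Or.inl ⟨x1, h1, x2, h2, hf, ih X x1 E v v' (key x1 h1) hb1,
        ih X x2 E v v' (key x2 h2) hb2⟩
    · right
      refine ⟨y, hy, ?_⟩
      have key : ∀ z ∈ X ∩ cube y (128 * LL s k), v z = v' z := by
        intro z hz
        rw [Finset.mem_inter] at hy hz
        apply h
        rw [Finset.mem_inter]
        exact ⟨hz.1, cube_mono (by omega) (cube_trans hy.2 hz.2)⟩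
      rcases hb with ⟨x1, h1, x2, h2, hf, hb1, hb2⟩ | ⟨β, hβ⟩
      · left
        exact ⟨x1, h1, x2, h2, hf,
          ih _ x1 E v v' (fun z hz => key z (Finset.mem_inter.1 hz).1) hb1,
          ih _ x2 E v v' (fun z hz => key z (Finset.mem_inter.1 hz).1) hb2⟩
      · right
        refine ⟨β, ?_⟩
        rw [← eig_congr γ v _ key]
        exact hβ

/-- iteration along nested sets -/
lemma iter_bound {α : Type*} (u : α → ℝ) (ε D M : ℝ) (hε : 0 ≤ ε) (hε2 : ε ≤ 1 / 2) (hD : 0 ≤ D)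
    (hM : 0 ≤ M) (n : ℕ) : ∀ S : ℕ → Set α,
    (∀ j < n, ∀ A, 0 ≤ A → (∀ y ∈ S (j + 1), |u y| ≤ A) → ∀ y ∈ S j, |u y| ≤ ε * A + D) →
    (∀ y ∈ S n, |u y| ≤ M) → ∀ y ∈ S 0, |u y| ≤ ε ^ n * M + 2 * D := by
  induction n with
  | zero =>
    intro S _ h y hy
    have := h y hy
    simp; linarith
  | succ n ih =>
    intro S hs h y hy
    have h1 := ih (fun j => S (j + 1)) (fun j hj A hA hh => hs (j + 1) (by omega) A hA hh) h
    have h2 := hs 0 (by omega) (ε ^ n * M + 2 * D) (by positivity) h1 y hy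
    refine h2.trans ?_
    rw [pow_succ]
    nlinarith [mul_le_mul_of_nonneg_right hε2 hD]


lemma HG.d1 {d : ℕ} {γ κ : ℝ} (hG : HG d γ κ) : (1 : ℝ) ≤ d := by exact_mod_cast hG.hd

lemma HG.small {d : ℕ} {γ κ : ℝ} (hG : HG d γ κ) : 514 * γ ≤ 1 := by
  have h := hG.h1
  have : (514 : ℝ) ≤ 514 ^ d := le_self_pow₀ (by norm_num) (by have := hG.hd; omega)
  nlinarith [hG.pos]

lemma HG.lt1 {d : ℕ} {γ κ : ℝ} (hG : HG d γ κ) : γ < 1 := by have := hG.small; have := hG.pos; linarith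

lemma HG.dγ {d : ℕ} {γ κ : ℝ} (hG : HG d γ κ) : 2 * d * γ ≤ κ / 2 := by
  have h := hG.h2
  have h1 := hG.d1
  have h3 := hG.κle
  have h4 := hG.κpos
  have h5 := hG.pos
  have : (2 * (d:ℝ)) * (2 * d * γ) ≤ κ * κ := by nlinarith
  have : 2 * (2 * d * γ) ≤ (2 * (d:ℝ)) * (2 * d * γ) := by
    apply mul_le_mul_of_nonneg_right (by linarith) (by positivity)
  nlinarith

lemma HG.powle {d : ℕ} {γ κ : ℝ} (hG : HG d γ κ) {a b : ℕ} (h : b ≤ a) : γ ^ a ≤ γ ^ b :=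
  pow_le_pow_of_le_one hG.pos.le hG.lt1.le h

lemma HG.pow_half {d : ℕ} {γ κ : ℝ} (hG : HG d γ κ) {a : ℕ} (h : 1 ≤ a) : γ ^ a ≤ 1 / 514 := by
  refine (hG.powle h).trans ?_
  have := hG.small; rw [pow_one]; linarith

/-- volume absorbed -/
lemma HG.vol {d : ℕ} {γ κ : ℝ} (hG : HG d γ κ) (l : ℕ) (hl : 1 ≤ l) : (((257 * l : ℕ) : ℝ)) ^ d * γ ^ l ≤ 1 := by
  have h1 : (((257 * l : ℕ) : ℝ)) ≤ 514 ^ l := by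
    have : 257 * l ≤ 514 ^ l := by
      calc 257 * l ≤ 257 ^ l * 2 ^ l := by
            apply Nat.mul_le_mul
            · exact Nat.le_self_pow (by omega) _
            · exact Nat.lt_two_pow_self.le
        _ = 514 ^ l := by rw [← mul_pow]; norm_num
    exact_mod_cast this
  calc (((257 * l : ℕ) : ℝ)) ^ d * γ ^ l ≤ (514 ^ l) ^ d * γ ^ l := by
        have := hG.pos; gcongr
    _ = (514 ^ d * γ) ^ l := by rw [mul_pow, ← pow_mul, ← pow_mul, mul_comm l d]
    _ ≤ 1 := pow_le_one₀ (by have := hG.pos; positivity) hG.h1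

end MLS
namespace MLS

/-- resolvent-type bound in a box with a spectral gap -/
lemma box_bound {d : ℕ} {γ : ℝ} (hγ : 0 ≤ γ) (v : Site d → ℝ) (E : ℝ) (X : Finset (Site d))
    (y0 : Site d) (r : ℕ) (u : Site d → ℝ) (hu : ∀ x, x ∉ X → u x = 0) (B δ η : ℝ) (hB : 0 ≤ B)
    (hη : 0 < η) (hshell : ∀ y ∈ cube y0 (r + 1), y ∉ cube y0 r → |u y| ≤ B)
    (hL : ∀ y ∈ X ∩ cube y0 r, |Lop γ v E u y| ≤ δ)
    (hgap : ∀ β : ↥(X ∩ cube y0 r), η ≤ |eig γ v (X ∩ cube y0 r) β - E|) :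
    ∀ y ∈ X ∩ cube y0 r, |u y| ≤ η⁻¹ * ((X ∩ cube y0 r).card * (δ + 2 * d * γ * B)) := by
  classical
  intro y hy
  set Z := X ∩ cube y0 r with hZ
  set w : Site d → ℝ := fun x => if x ∈ Z then u x else 0 with hw
  have hwoff : ∀ x, x ∉ Z → w x = 0 := fun x hx => by simp [hw, hx]
  have hwon : ∀ x ∈ Z, w x = u x := fun x hx => by simp [hw, hx]
  have hLw : ∀ x ∈ Z, |Lop γ v E w x| ≤ δ + 2 * d * γ * B := by
    intro x hx
    have h1 : |nb (fun z => u z - w z) x| ≤ 2 * d * B := by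
      apply nb_le
      intro z hz
      by_cases hzZ : z ∈ Z
      · simp [hwon z hzZ, hB]
      · rw [hwoff z hzZ, sub_zero]
        by_cases hzX : z ∈ X
        · apply hshell z
          · exact cube_trans (Finset.mem_inter.1 hx).2 hz
          · intro h; exact hzZ (Finset.mem_inter.2 ⟨hzX, h⟩)
        · rw [hu z hzX]; simpa using hB
    have h2 : Lop γ v E w x = Lop γ v E u x + γ * nb (fun z => u z - w z) x := by
      have : nb (fun z => u z - w z) x = nb u x - nb w x := by
        unfold nb
        rw [← Finset.sum_sub_distrib]
        apply Finset.sum_congr rfl; intros; ring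
      unfold Lop
      rw [this, hwon x hx]; ring
    rw [h2]
    refine (abs_add_le _ _).trans ?_
    rw [abs_mul, abs_of_nonneg hγ]
    have := hL x hx
    nlinarith [mul_le_mul_of_nonneg_left h1 hγ]
  have hC : 0 ≤ δ + 2 * d * γ * B := (abs_nonneg _).trans (hLw y hy)
  set C := δ + 2 * d * γ * B
  have h3 := gap_bound γ v Z E η hη.le hgap w hwoff
  have h4 : ∑ x ∈ Z, (Lop γ v E w x) ^ 2 ≤ Z.card * C ^ 2 := by
    have : ∀ x ∈ Z, (Lop γ v E w x) ^ 2 ≤ C ^ 2 := by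
      intro x hx
      rw [← sq_abs]
      exact pow_le_pow_left₀ (abs_nonneg _) (hLw x hx) 2
    refine (Finset.sum_le_sum this).trans ?_
    simp
  have h5 : u y ^ 2 ≤ ∑ x ∈ Z, w x ^ 2 := by
    rw [← hwon y hy]
    exact Finset.single_le_sum (f := fun x => w x ^ 2) (fun _ _ => sq_nonneg _) hy
  have hc1 : (1 : ℝ) ≤ Z.card := by
    exact_mod_cast Finset.card_pos.2 ⟨y, hy⟩
  have h6 : (η * |u y|) ^ 2 ≤ (Z.card * C) ^ 2 := by
    rw [mul_pow, sq_abs, mul_pow]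
    calc η ^ 2 * u y ^ 2 ≤ η ^ 2 * ∑ x ∈ Z, w x ^ 2 := by gcongr
      _ ≤ Z.card * C ^ 2 := h3.trans h4
      _ ≤ (Z.card : ℝ) ^ 2 * C ^ 2 := by
        apply mul_le_mul_of_nonneg_right _ (sq_nonneg _)
        nlinarith
  have h7 : η * |u y| ≤ Z.card * C := by
    apply le_of_sq_le_sq h6; positivity
  rw [inv_mul_eq_div, le_div_iff₀ hη]
  linarith

/-- a-priori decay statement -/
def AP {d : ℕ} (γ κ : ℝ) (s k : ℕ) : Prop :=
  ∀ (X : Finset (Site d)) (x : Site d) (E : ℝ) (v u : Site d → ℝ) (δ M : ℝ),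
    0 ≤ δ → 0 ≤ M → ¬ bad γ κ s k X x E v → (∀ y, y ∉ X → u y = 0) →
    (∀ y ∈ cube x (LL s k), |u y| ≤ M) → (∀ y ∈ X ∩ cube x (LL s k), |Lop γ v E u y| ≤ δ) →
    |u x| ≤ γ ^ mm s k * M + (γ ^ LL s k)⁻¹ * δ

lemma AP_zero {d : ℕ} {γ κ : ℝ} (hG : HG d γ κ) (s : ℕ) (hs : 1 ≤ s) : AP (d := d) γ κ s 0 := by
  intro X x E v u δ M hδ hM hb hu hM' hL
  have hκ := hG.κpos
  have hγ := hG.pos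
  set ε := 2 * d * γ / κ with hε
  have hε0 : 0 ≤ ε := by positivity
  have hε2 : ε ≤ 1 / 2 := by
    rw [hε, div_le_iff₀ hκ]; have := hG.dγ; linarith
  have hεsq : ε ^ 2 ≤ γ := by
    rw [hε, div_pow, div_le_iff₀ (by positivity)]
    have := hG.h2
    nlinarith
  have h1 := iter_bound u ε (δ / κ) M hε0 hε2 (by positivity) hM (LL s 0)
    (fun j => (cube x j : Set (Site d))) (by
      intro j hj A hA hS y hy
      by_cases hyX : y ∈ X
      swap
      · rw [hu y hyX, abs_zero]; positivity
      have hyc : y ∈ X ∩ cube x (LL s 0) := Finset.mem_inter.2 ⟨hyX, cube_mono hj.le hy⟩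
      have hgood : κ < |2 * d * γ + v y - E| := by
        by_contra hc
        exact hb ⟨y, hyc, not_lt.1 hc⟩
      have hnb : |nb u y| ≤ 2 * d * A := by
        apply nb_le
        intro z hz
        exact hS z (cube_trans hy hz)
      have h2 : (2 * d * γ + v y - E) * u y = Lop γ v E u y + γ * nb u y := by
        unfold Lop; ring
      have h3 : |2 * d * γ + v y - E| * |u y| ≤ δ + γ * (2 * d * A) := by
        rw [← abs_mul, h2]
        refine (abs_add_le _ _).trans ?_
        rw [abs_mul, abs_of_pos hγ]
        have := hL y hyc
        nlinarith
      have h4 : κ * |u y| ≤ δ + γ * (2 * d * A) :=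
        (mul_le_mul_of_nonneg_right hgood.le (abs_nonneg _)).trans h3
      have h5 : ε * A + δ / κ = (δ + γ * (2 * d * A)) / κ := by
        rw [hε]; field_simp; ring
      rw [h5, le_div_iff₀ hκ]; linarith)
    (fun y hy => hM' y hy) x (by simpa using self_mem_cube x 0)
  refine h1.trans ?_
  have e1 : LL s 0 = 2 * mm s 0 := by
    simp only [LL, mm]
    obtain ⟨t, rfl⟩ := Nat.exists_eq_add_of_le hs
    simp [pow_add]
  have h2 : ε ^ (LL s 0) ≤ γ ^ mm s 0 := by
    rw [e1, pow_mul]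
    exact pow_le_pow_left₀ (by positivity) hεsq _
  have h3 : 2 * (δ / κ) ≤ (γ ^ LL s 0)⁻¹ * δ := by
    have h4 : γ ^ LL s 0 ≤ κ / 2 := by
      calc γ ^ LL s 0 ≤ γ ^ 1 := hG.powle (LL_pos s 0)
        _ = γ := pow_one _
        _ ≤ 2 * d * γ := by have := hG.d1; nlinarith
        _ ≤ _ := hG.dγ
    have h5 : 2 / κ ≤ (γ ^ LL s 0)⁻¹ := by
      rw [← inv_div]
      exact inv_anti₀ (by positivity) h4
    calc 2 * (δ / κ) = 2 / κ * δ := by ring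
      _ ≤ _ := by gcongr
  have := mul_le_mul_of_nonneg_right h2 hM
  linarith

lemma mul_right_cube {d : ℕ} {x y z : Site d} {a b c l : ℕ} (h1 : y ∈ cube x (a * l))
    (h2 : z ∈ cube y (b * l)) (h : a + b ≤ c) : z ∈ cube x (c * l) :=
  cube_mono (by rw [← add_mul]; exact Nat.mul_le_mul_right _ h) (cube_trans h1 h2)

set_option maxRecDepth 8000 in
lemma AP_succ {d : ℕ} {γ κ : ℝ} (hG : HG d γ κ) (s k : ℕ) (hs : 1 ≤ s)
    (ih : AP (d := d) γ κ s k) : AP (d := d) γ κ s (k + 1) := by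
  classical
  intro X x E v u δ M hδ hM hb hu hM' hL
  have hγ := hG.pos
  have hd1 := hG.d1
  obtain ⟨l, hl⟩ : ∃ l, l = LL s k := ⟨_, rfl⟩
  obtain ⟨g, hg⟩ : ∃ g, g = 2 ^ (12 + k) := ⟨_, rfl⟩
  have hg4 : 4096 ≤ g := hg ▸ g_ge k
  have hl1 : 1 ≤ l := hl ▸ LL_pos s k
  have hR : LL s (k + 1) = g * l := by rw [LL_succ, hg, hl]
  have hmm : mm s (k + 1) = (g - 1024) * mm s k := by rw [mm_succ, hg]
  have hm1 : l ≤ 4 * mm s k := hl ▸ mm_ge s k hs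
  set ε := γ ^ mm s k with hε
  set K := (γ ^ l)⁻¹ with hK
  have hε0 : 0 ≤ ε := by positivity
  have hε2 : ε ≤ 1 / 2 := (hG.pow_half (by omega)).trans (by norm_num)
  have hε1 : ε ≤ 1 := by linarith
  have hK0 : 0 < K := by positivity
  have hK514 : 514 ≤ K := by
    rw [hK, ← inv_inv (514 : ℝ)]
    apply inv_anti₀ (by positivity)
    have := hG.pow_half hl1; linarith
  unfold AP at ih
  rw [← hl] at ih
  rw [hR] at hM' hL
  -- the good step
  have hgood : ∀ y, y ∈ cube x ((g - 1) * l) → ¬ (y ∈ X ∧ bad γ κ s k X y E v) → ∀ A, 0 ≤ A →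
      (∀ z ∈ cube y l, |u z| ≤ A) → |u y| ≤ ε * A + K * δ := by
    intro y hy hnb A hA hz
    by_cases hyX : y ∈ X
    swap
    · rw [hu y hyX, abs_zero]; positivity
    apply ih X y E v u δ A hδ hA (fun h => hnb ⟨hyX, h⟩) hu hz
    intro z hz
    rw [Finset.mem_inter] at hz
    apply hL
    rw [Finset.mem_inter]
    refine ⟨hz.1, mul_right_cube (b := 1) hy (by simpa using hz.2) (by omega)⟩
  have hgl : ∀ a, a ≤ g → cube x (a * l) ⊆ cube x (g * l) := fun a ha =>
    cube_mono (Nat.mul_le_mul_right _ ha)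
  set K' := (γ ^ (11 * l))⁻¹ with hK'
  have hK'K : K' = K ^ 11 := by rw [hK', hK, inv_pow, ← pow_mul, mul_comm l 11]
  have hKK' : K ≤ K' := by rw [hK'K]; exact le_self_pow₀ (by linarith) (by norm_num)
  have hKg : 4 * K' ≤ (γ ^ (g * l))⁻¹ := by
    have : (γ ^ (g * l))⁻¹ = K ^ g := by rw [hK, inv_pow, ← pow_mul, mul_comm l g]
    rw [this, hK'K]
    calc 4 * K ^ 11 ≤ K * K ^ 11 := by gcongr; linarith
      _ = K ^ 12 := by ring
      _ ≤ K ^ g := pow_le_pow_right₀ (by linarith) (by omega)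
  have hexp : ∀ n, g - 1024 ≤ n → ε ^ n ≤ γ ^ mm s (k + 1) := by
    intro n hn
    rw [hmm, mul_comm, pow_mul]
    exact pow_le_pow_of_le_one hε0 hε1 hn
  rw [hR]
  by_cases hnob : ∃ y0 ∈ X ∩ cube x (g * l), bad γ κ s k X y0 E v
  swap
  · have h1 := iter_bound u ε (K * δ) M hε0 hε2 (by positivity) hM g
      (fun j => (cube x (j * l) : Set (Site d))) (by
        intro j hj A hA hS y hy
        apply hgood y (cube_mono (Nat.mul_le_mul_right _ (by omega)) hy) _ A hA
        · intro z hz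
          exact hS z (mul_right_cube (b := 1) hy (by simpa using hz) le_rfl)
        · rintro ⟨hyX, hyb⟩
          exact hnob ⟨y, Finset.mem_inter.2 ⟨hyX, hgl j hj.le hy⟩, hyb⟩)
      (fun y hy => hM' y hy) x (self_mem_cube x _)
    have h2 := mul_le_mul_of_nonneg_right (hexp g (by omega)) hM
    have h3 : 2 * (K * δ) ≤ (γ ^ (g * l))⁻¹ * δ := by
      rw [← mul_assoc]
      apply mul_le_mul_of_nonneg_right _ hδ
      linarith
    linarith
  obtain ⟨y0, hy0, hy0b⟩ := hnob
  -- all bad sites are near y0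
  have hnear : ∀ y ∈ X ∩ cube x (g * l), bad γ κ s k X y E v → y ∈ cube y0 (4 * l) := by
    intro y hy hyb
    by_contra hc
    apply hb
    left
    rw [hR]
    exact ⟨y0, hy0, y, hy, by rw [far, ← hl]; exact hc, hy0b, hyb⟩
  have hex : ∃ q, y0 ∈ cube x (q * l) := ⟨g, (Finset.mem_inter.1 hy0).2⟩
  obtain ⟨q, hq⟩ : ∃ q, q = Nat.find hex := ⟨_, rfl⟩
  have hqmem : y0 ∈ cube x (q * l) := hq ▸ Nat.find_spec hex
  have hqmin : ∀ j, y0 ∈ cube x (j * l) → q ≤ j := fun j hj => hq ▸ Nat.find_min' hex hj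
  have hqg : q ≤ g := hqmin g (Finset.mem_inter.1 hy0).2
  -- spectral gap
  have hgap : ∀ β : ↥(X ∩ cube y0 (128 * l)),
      γ ^ (8 * l) ≤ |eig γ v (X ∩ cube y0 (128 * l)) β - E| := by
    intro β
    by_contra hc
    apply hb
    right
    refine ⟨y0, by rw [hR]; exact hy0, Or.inr ?_⟩
    rw [← hl]
    exact ⟨β, (not_le.1 hc).le⟩
  -- phase 2
  have hB2 : ∀ y ∈ cube x ((q - 4) * l), |u y| ≤ ε ^ (g - (q + 384)) * M + 2 * (K' * δ) := by
    by_cases hqq : g < q + 384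
    · intro y hy
      have h1 := hM' y (hgl _ (by omega) hy)
      have : g - (q + 384) = 0 := by omega
      rw [this, pow_zero, one_mul]
      have : 0 ≤ K' * δ := by positivity
      linarith
    have h1 := iter_bound u ε (K' * δ) M hε0 hε2 (by positivity) hM (g - (q + 384))
      (fun j => (cube x ((q + 384 + j) * l) : Set (Site d))) (by
        intro j hj A hA hS y hy
        have hyg : y ∈ cube x ((g - 1) * l) := cube_mono (Nat.mul_le_mul_right _ (by omega)) hy
        by_cases hyb : y ∈ X ∧ bad γ κ s k X y E v
        swap
        · have := hgood y hyg hyb A hA (by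
            intro z hz
            exact hS z (mul_right_cube (b := 1) hy (by simpa using hz) (by omega)))
          have h2 : K * δ ≤ K' * δ := by gcongr
          linarith
        -- bad site
        have hshell : ∀ z ∈ cube y0 (128 * l + 1), z ∉ cube y0 (128 * l) →
            |u z| ≤ ε ^ 124 * A + 2 * (K * δ) := by
          intro z hz hz'
          refine iter_bound u ε (K * δ) A hε0 hε2 (by positivity) hA 124
            (fun i => {y : Site d | y ∉ cube y0 ((128 - i) * l) ∧ y ∈ cube x ((q + 129 + i) * l)})
            ?_ ?_ z ?_
          · rintro i hi A' hA' hS' y' ⟨hy1, hy2⟩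
            apply hgood y' (cube_mono (Nat.mul_le_mul_right _ (by omega)) hy2) _ A' hA'
            · intro z hz
              apply hS' z
              refine ⟨?_, mul_right_cube (b := 1) hy2 (by simpa using hz) (by omega)⟩
              intro hc
              apply hy1
              exact mul_right_cube (b := 1) hc (by simpa using cube_comm.1 hz) (by omega)
            · rintro ⟨h3, h4⟩
              apply hy1
              have := hnear y' (Finset.mem_inter.2 ⟨h3, hgl _ (by omega) hy2⟩) h4
              exact cube_mono (Nat.mul_le_mul_right _ (by omega)) this
          · rintro y' ⟨_, hy2⟩
            exact hS y' (cube_mono (Nat.mul_le_mul_right _ (by omega)) hy2)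
          · refine ⟨by simpa using hz', ?_⟩
            refine mul_right_cube (b := 129) hqmem (cube_mono ?_ hz) (by omega)
            omega
        have hyZ : y ∈ X ∩ cube y0 (128 * l) := by
          refine Finset.mem_inter.2 ⟨hyb.1, ?_⟩
          have := hnear y (Finset.mem_inter.2 ⟨hyb.1, hgl _ (by omega) hyg⟩) hyb.2
          exact cube_mono (by omega) this
        have hbb := box_bound hγ.le v E X y0 (128 * l) u hu (ε ^ 124 * A + 2 * (K * δ)) δ
          (γ ^ (8 * l)) (by positivity) (by positivity) hshell (by
            intro z hz
            rw [Finset.mem_inter] at hz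
            apply hL
            rw [Finset.mem_inter]
            exact ⟨hz.1, mul_right_cube hqmem hz.2 (by omega)⟩) hgap y hyZ
        refine hbb.trans ?_
        have hcard : ((X ∩ cube y0 (128 * l)).card : ℝ) ≤ K := by
          have h1 : (X ∩ cube y0 (128 * l)).card ≤ (257 * l) ^ d := by
            refine (Finset.card_le_card Finset.inter_subset_right).trans ?_
            rw [card_cube]
            exact Nat.pow_le_pow_left (by omega) _
          have h2 := hG.vol l hl1
          have h3 : ((X ∩ cube y0 (128 * l)).card : ℝ) ≤ (((257 * l : ℕ) : ℝ)) ^ d := by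
            exact_mod_cast h1
          refine h3.trans ?_
          rw [hK, ← one_div, le_div_iff₀ (by positivity)]
          exact h2
        have h8 : (γ ^ (8 * l))⁻¹ = K ^ 8 := by rw [hK, inv_pow, ← pow_mul, mul_comm l 8]
        rw [h8]
        have hdγ : 2 * d * γ ≤ 1 / 2 := hG.dγ.trans (by have := hG.κle; linarith)
        have hdγ0 : 0 ≤ 2 * d * γ := by positivity
        have hKε : K ^ 9 * ε ^ 123 ≤ 1 := by
          have h1 : ε ^ 123 ≤ γ ^ (9 * l) := by
            rw [hε, ← pow_mul]
            exact hG.powle (by omega)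
          have h2 : K ^ 9 = (γ ^ (9 * l))⁻¹ := by rw [hK, inv_pow, ← pow_mul, mul_comm l 9]
          rw [h2]
          calc (γ ^ (9 * l))⁻¹ * ε ^ 123 ≤ (γ ^ (9 * l))⁻¹ * γ ^ (9 * l) := by gcongr
            _ = 1 := inv_mul_cancel₀ (by positivity)
        calc K ^ 8 * (((X ∩ cube y0 (128 * l)).card : ℝ) *
              (δ + 2 * d * γ * (ε ^ 124 * A + 2 * (K * δ))))
            ≤ K ^ 8 * (K * (δ + 1 * (ε ^ 124 * A + 2 * (K * δ)))) := by
              gcongr; linarith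
          _ = ε * (K ^ 9 * ε ^ 123) * A + (K ^ 9 + 2 * K ^ 10) * δ := by ring
          _ ≤ ε * 1 * A + K ^ 11 * δ := by
              gcongr
              have : K ^ 9 * 1 ≤ K ^ 9 * K := by gcongr; linarith
              have : K ^ 10 * 3 ≤ K ^ 10 * K := by gcongr; linarith
              nlinarith
          _ = ε * A + K' * δ := by rw [hK'K]; ring)
      (fun y hy => by
        have : q + 384 + (g - (q + 384)) = g := by omega
        simp only [this] at hy
        exact hM' y hy)
    intro y hy
    exact h1 y (by
      refine cube_mono (Nat.mul_le_mul_right _ ?_) hy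
      omega)
  -- phase 1
  have hB0 : 0 ≤ ε ^ (g - (q + 384)) * M + 2 * (K' * δ) := by positivity
  have h1 := iter_bound u ε (K * δ) _ hε0 hε2 (by positivity) hB0 (q - 4)
      (fun j => (cube x (j * l) : Set (Site d))) (by
        intro j hj A hA hS y hy
        apply hgood y (cube_mono (Nat.mul_le_mul_right _ (by omega)) hy) _ A hA
        · intro z hz
          exact hS z (mul_right_cube (b := 1) hy (by simpa using hz) le_rfl)
        · rintro ⟨hyX, hyb⟩
          have := hnear y (Finset.mem_inter.2 ⟨hyX, hgl j (by omega) hy⟩) hyb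
          have h2 : y0 ∈ cube x ((j + 4) * l) := mul_right_cube hy (cube_comm.1 this) le_rfl
          have := hqmin _ h2
          omega)
      hB2 x (self_mem_cube x _)
  refine h1.trans ?_
  have h2 : ε ^ (q - 4) * (ε ^ (g - (q + 384)) * M + 2 * (K' * δ)) ≤
      γ ^ mm s (k + 1) * M + 2 * (K' * δ) := by
    rw [mul_add, ← mul_assoc, ← pow_add]
    have h3 := mul_le_mul_of_nonneg_right (hexp (q - 4 + (g - (q + 384))) (by omega)) hM
    have h4 : ε ^ (q - 4) * (2 * (K' * δ)) ≤ 1 * (2 * (K' * δ)) := by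
      apply mul_le_mul_of_nonneg_right (pow_le_one₀ hε0 hε1); positivity
    linarith
  have h3 : 2 * (K' * δ) + 2 * (K * δ) ≤ (γ ^ (g * l))⁻¹ * δ := by
    have : K * δ ≤ K' * δ := by gcongr
    have h4 := mul_le_mul_of_nonneg_right hKg hδ
    linarith
  linarith

theorem AP_all {d : ℕ} {γ κ : ℝ} (hG : HG d γ κ) (s : ℕ) (hs : 1 ≤ s) (k : ℕ) :
    AP (d := d) γ κ s k := by
  induction k with
  | zero => exact AP_zero hG s hs
  | succ k ih => exact AP_succ hG s k hs ih

end MLS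
namespace MLS

/-- signed direction -/
def dirv {d : ℕ} (i : Fin d) (σ : Bool) : Site d := if σ then ev i else - ev i

/-- sign -/
def sg (σ : Bool) : ℤ := if σ then 1 else -1

/-- displacement -/
def disp {d : ℕ} (i : Fin d) (σ : Bool) (z y : Site d) : ℤ := sg σ * (y i - z i)

/-- step associated with a letter -/
def stp {d : ℕ} (i : Fin d) (σ : Bool) (a : Fin d × Bool) : Site d :=
  if a.1 = i then (if a.2 then dirv i σ else dirv i σ + dirv i σ)
  else dirv i σ + (if a.2 then ev a.1 else - ev a.1)

/-- position after `n` steps -/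
def pos {d : ℕ} (i : Fin d) (σ : Bool) (z : Site d) (w : ℕ → Fin d × Bool) : ℕ → Site d
  | 0 => z
  | n + 1 => pos i σ z w n + stp i σ (w n)

lemma sg_dirv {d : ℕ} (i : Fin d) (σ : Bool) : sg σ * dirv i σ i = 1 := by
  cases σ <;> simp [sg, dirv, ev]

lemma sg_stp {d : ℕ} (i : Fin d) (σ : Bool) (a : Fin d × Bool) : 1 ≤ sg σ * stp i σ a i := by
  obtain ⟨l, t⟩ := a
  have h := sg_dirv i σ
  unfold stp
  by_cases hl : l = i
  · cases t
    · simp only [hl, if_true, Bool.false_eq_true, if_false, Pi.add_apply]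
      rw [mul_add]; omega
    · simp [hl, h]
  · have : (if t = true then ev l else - ev l : Site d) i = 0 := by
      have hl' : ¬ (i = l) := fun h => hl h.symm
      cases t <;> simp [ev, hl']
    simp only [hl, if_false, Pi.add_apply]
    rw [this, add_zero, h]

lemma disp_pos {d : ℕ} (i : Fin d) (σ : Bool) (z : Site d) (w : ℕ → Fin d × Bool) (n : ℕ) :
    disp i σ z (pos i σ z w n) + 1 ≤ disp i σ z (pos i σ z w (n + 1)) := by
  have h := sg_stp i σ (w n)
  simp only [disp, pos, Pi.add_apply]
  have : sg σ * (pos i σ z w n i + stp i σ (w n) i - z i) =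
    sg σ * (pos i σ z w n i - z i) + sg σ * stp i σ (w n) i := by ring
  omega

lemma le_disp_pos {d : ℕ} (i : Fin d) (σ : Bool) (z : Site d) (w : ℕ → Fin d × Bool) (n : ℕ) :
    (n : ℤ) ≤ disp i σ z (pos i σ z w n) := by
  induction n with
  | zero => simp [disp, pos]
  | succ n ih => have := disp_pos i σ z w n; push_cast; omega

lemma pos_inj {d : ℕ} (i : Fin d) (σ : Bool) (z : Site d) (w : ℕ → Fin d × Bool) :
    Function.Injective (pos i σ z w) := by
  have : StrictMono fun n => disp i σ z (pos i σ z w n) :=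
    strictMono_nat_of_lt_succ fun n => by have := disp_pos i σ z w n; omega
  intro a b h
  exact this.injective (by simp only [h])

lemma pos_congr {d : ℕ} (i : Fin d) (σ : Bool) (z : Site d) (w w' : ℕ → Fin d × Bool) (n : ℕ)
    (h : ∀ m < n, w m = w' m) : pos i σ z w n = pos i σ z w' n := by
  induction n with
  | zero => rfl
  | succ n ih =>
    simp only [pos]
    rw [ih fun m hm => h m (by omega), h n (by omega)]

/-- extension of a finite word -/
def extw {d : ℕ} (i : Fin d) {H : ℕ} (w : Fin H → Fin d × Bool) : ℕ → Fin d × Bool :=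
  fun n => if h : n < H then w ⟨n, h⟩ else (i, true)

/-- record sites of a code -/
def codeSite {d : ℕ} (i : Fin d) (J H : ℕ)
    (c : Site d × Bool × (Fin H → Fin d × Bool) × Finset (Fin (H + 1))) : Fin J → Site d :=
  if h : c.2.2.2.card = J then
    fun j => pos i c.2.1 c.1 (extw i c.2.2.1) ((c.2.2.2.orderEmbOfFin h j : Fin (H + 1)) : ℕ)
  else fun _ => c.1

/-- the set of codes -/
def codes {d : ℕ} (i : Fin d) (Z : Finset (Site d)) (J H : ℕ) : Finset (Fin J → Site d) :=
  open scoped Classical in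
  (Z ×ˢ (Finset.univ : Finset (Bool × (Fin H → Fin d × Bool) × Finset (Fin (H + 1))))).image
    (codeSite i J H)

lemma card_codes {d : ℕ} (i : Fin d) (Z : Finset (Site d)) (J H : ℕ) :
    (codes i Z J H).card ≤ Z.card * (2 * ((2 * d) ^ H * 2 ^ (H + 1))) := by
  unfold codes
  refine Finset.card_image_le.trans ?_
  rw [Finset.card_product, Finset.card_univ]
  simp [Fintype.card_prod, mul_comm d 2]

lemma letter_exists {d : ℕ} {γ : ℝ} (hγ : 0 < γ) (hγd : (2 * d - 1) * γ ≤ 1) (i : Fin d) (σ : Bool)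
    (b : Site d → ℝ) (hb0 : ∀ x, 0 ≤ b x) (x : Site d)
    (hch : γ * b x ≤ 2 * b (x + dirv i σ) + γ * (b (x + dirv i σ + dirv i σ) +
        ∑ l ∈ Finset.univ.erase i, (b (x + dirv i σ + ev l) + b (x + dirv i σ - ev l)))) :
    ∃ a, γ / 3 * b x ≤ b (x + stp i σ a) := by
  by_contra hc
  push Not at hc
  have h1 := hc (i, true)
  have h2 := hc (i, false)
  simp only [stp, if_true, Bool.false_eq_true, if_false] at h1 h2
  rw [← add_assoc] at h2
  have h3 : ∀ l ∈ Finset.univ.erase i, b (x + dirv i σ + ev l) + b (x + dirv i σ - ev l) ≤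
      2 * (γ / 3 * b x) := by
    intro l hl
    have hl' : l ≠ i := (Finset.mem_erase.1 hl).1
    have h4 := hc (l, true)
    have h5 := hc (l, false)
    simp only [stp, hl', if_true, Bool.false_eq_true, if_false] at h4 h5
    rw [← add_assoc] at h4 h5
    rw [← sub_eq_add_neg] at h5
    linarith
  have h6 := Finset.sum_le_sum h3
  rw [Finset.sum_const, Finset.card_erase_of_mem (Finset.mem_univ i), Finset.card_univ,
    Fintype.card_fin, nsmul_eq_mul] at h6
  have hd : 1 ≤ d := by have := i.2; omega
  rw [Nat.cast_sub hd] at h6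
  push_cast at h6
  set t := γ / 3 * b x
  have ht : 0 ≤ t := by have := hb0 x; positivity
  have h7 : γ * (b (x + dirv i σ + dirv i σ) +
        ∑ l ∈ Finset.univ.erase i, (b (x + dirv i σ + ev l) + b (x + dirv i σ - ev l))) ≤
        γ * ((2 * d - 1) * t) := by
    apply mul_le_mul_of_nonneg_left _ hγ.le
    nlinarith
  have h8 : γ * ((2 * d - 1) * t) ≤ 1 * t := by
    calc _ = ((2 * d - 1) * γ) * t := by ring
      _ ≤ _ := by gcongr
  have h9 : γ * b x = 3 * t := by simp only [t]; ring
  linarith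

lemma records {d : ℕ} {γ : ℝ} (hγ : 0 < γ) (hγd : (2 * d - 1) * γ ≤ 1) (hγ3 : γ < 1 / 3) (i : Fin d)
    (σ : Bool) (b : Site d → ℝ) (hb0 : ∀ x, 0 ≤ b x) (Z : Finset (Site d))
    (hbZ : ∀ x, x ∉ Z → b x = 0) (J H : ℕ) (T0 : ℝ) (hT0 : 0 < T0)
    (hch : ∀ x, x + dirv i σ ∈ Z → γ * b x ≤ 2 * b (x + dirv i σ) +
      γ * (b (x + dirv i σ + dirv i σ) +
        ∑ l ∈ Finset.univ.erase i, (b (x + dirv i σ + ev l) + b (x + dirv i σ - ev l))))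
    (z : Site d) (hz : z ∈ Z) (hbz : T0 ≤ b z)
    (hroom : ∀ y ∈ Z, disp i σ z y < H → y + dirv i σ ∈ Z)
    (hdecay : ∀ y ∈ Z, (H : ℤ) ≤ disp i σ z y → ∀ j < J, b y < T0 * γ ^ (2 * j)) :
    ∃ y ∈ codes i Z J H, Function.Injective y ∧ ∀ j : Fin J, y j ∈ Z ∧
      γ / 3 * (T0 * γ ^ (2 * (j : ℕ))) ≤ b (y j) ∧ b (y j) < T0 * γ ^ (2 * (j : ℕ)) := by
  classical
  set T : ℕ → ℝ := fun j => T0 * γ ^ (2 * j) with hT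
  have hTpos : ∀ j, 0 < T j := fun j => by simp only [hT]; positivity
  have hTanti : ∀ {j j'}, j ≤ j' → T j' ≤ T j := by
    intro j j' h
    simp only [hT]
    apply mul_le_mul_of_nonneg_left _ hT0.le
    exact pow_le_pow_of_le_one hγ.le (by linarith) (by omega)
  have hTsucc : ∀ j, T (j + 1) < γ / 3 * T j := by
    intro j
    have : T (j + 1) = γ * (γ * T j) := by simp only [hT]; ring
    rw [this]
    have := hTpos j
    have : 0 < γ * T j := by positivity
    nlinarith
  have hstep : ∀ x, ∃ a, x + dirv i σ ∈ Z → γ / 3 * b x ≤ b (x + stp i σ a) := by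
    intro x
    by_cases h : x + dirv i σ ∈ Z
    · obtain ⟨a, ha⟩ := letter_exists hγ hγd i σ b hb0 x (hch x h)
      exact ⟨a, fun _ => ha⟩
    · exact ⟨(i, true), fun h' => absurd h' h⟩
  choose f hf using hstep
  let X : ℕ → Site d := fun n => Nat.rec z (fun _ x => x + stp i σ (f x)) n
  have hX0 : X 0 = z := rfl
  have hXs : ∀ n, X (n + 1) = X n + stp i σ (f (X n)) := fun n => rfl
  let w : ℕ → Fin d × Bool := fun n => f (X n)
  have hXw : ∀ n, pos i σ z w n = X n := by
    intro n
    induction n with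
    | zero => rfl
    | succ n ih => rw [pos, ih]
  have hlt : ∀ x, ∀ j < J, (H : ℤ) ≤ disp i σ z x → b x < T j := by
    intro x j hj hx
    by_cases h : x ∈ Z
    · exact hdecay x h hx j hj
    · rw [hbZ x h]; exact hTpos j
  have hex : ∀ j : Fin J, ∃ n, b (X n) < T j := fun j =>
    ⟨H, hlt _ j j.2 (by rw [← hXw]; exact le_disp_pos i σ z w H)⟩
  let n : Fin J → ℕ := fun j => Nat.find (hex j)
  have hn1 : ∀ j : Fin J, b (X (n j)) < T j := fun j => Nat.find_spec (hex j)
  have hn2 : ∀ (j : Fin J) m, m < n j → T j ≤ b (X m) := fun j m hm =>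
    not_lt.1 (Nat.find_min (hex j) hm)
  have hn3 : ∀ (j : Fin J) m, b (X m) < T j → n j ≤ m := fun j m hm => Nat.find_min' (hex j) hm
  have hnH : ∀ j : Fin J, n j ≤ H := fun j =>
    hn3 j H (hlt _ j j.2 (by rw [← hXw]; exact le_disp_pos i σ z w H))
  have hnlow : ∀ j : Fin J, γ / 3 * T j ≤ b (X (n j)) := by
    intro j
    have hn0 : n j ≠ 0 := by
      intro h0
      have := hn1 j
      rw [h0, hX0] at this
      have h2 : T j ≤ T 0 := hTanti (Nat.zero_le _)
      have h3 : T 0 = T0 := by simp [hT]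
      linarith
    obtain ⟨m, hm⟩ := Nat.exists_eq_succ_of_ne_zero hn0
    have h1 := hn2 j m (by omega)
    have hmZ : X m ∈ Z := by
      by_contra h
      have := hbZ _ h
      have := hTpos j
      linarith
    have hmd : disp i σ z (X m) < H := by
      by_contra h
      have := hlt (X m) j j.2 (not_lt.1 h)
      linarith
    have h2 := hf (X m) (hroom _ hmZ hmd)
    rw [hm, Nat.succ_eq_add_one, hXs]
    refine le_trans ?_ h2
    gcongr
  have hmono : StrictMono n := by
    intro j j' hjj
    have h1 : n j ≤ n j' := hn3 j _ ((hn1 j').trans_le (hTanti hjj.le))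
    rcases h1.eq_or_lt with h | h
    · exfalso
      have h2 := hnlow j
      rw [h] at h2
      have h3 := hn1 j'
      have h4 : T j' ≤ T (j + 1) := hTanti hjj
      have h5 := hTsucc j
      linarith
    · exact h
  let f' : Fin J → Fin (H + 1) := fun j => ⟨n j, Nat.lt_succ_of_le (hnH j)⟩
  have hf'mono : StrictMono f' := fun a b h => hmono h
  let S : Finset (Fin (H + 1)) := Finset.univ.image f'
  have hScard : S.card = J := by
    rw [Finset.card_image_of_injective _ hf'mono.injective]; simp
  have hS := Finset.orderEmbOfFin_unique hScard (f := f')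
    (fun x => Finset.mem_image_of_mem _ (Finset.mem_univ _)) hf'mono
  let wH : Fin H → Fin d × Bool := fun m => w m
  refine ⟨fun j => X (n j), ?_, ?_, ?_⟩
  · unfold codes
    rw [Finset.mem_image]
    refine ⟨(z, σ, wH, S), by simp [hz], ?_⟩
    unfold codeSite
    rw [dif_pos hScard]
    funext j
    simp only
    rw [← hS, ← hXw]
    apply pos_congr
    intro m hm
    have : m < H := lt_of_lt_of_le hm (hnH j)
    simp [extw, this, wH]
  · intro a b hab
    simp only [← hXw] at hab
    exact hmono.injective (pos_inj i σ z w hab)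
  · intro j
    refine ⟨?_, hnlow j, hn1 j⟩
    by_contra h
    have h1 := hbZ _ h
    have h2 := hnlow j
    have := hTpos j
    have : 0 < γ / 3 * T j := by positivity
    linarith

end MLS
namespace MLS

lemma cs_abs {ι : Type*} (s : Finset ι) (f g : ι → ℝ) :
    |∑ x ∈ s, f x * g x| ≤ √(∑ x ∈ s, f x ^ 2) * √(∑ x ∈ s, g x ^ 2) := by
  rw [← Real.sqrt_mul (Finset.sum_nonneg fun _ _ => sq_nonneg _)]
  apply Real.abs_le_sqrt
  exact Finset.sum_mul_sq_le_sq_mul_sq s f g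

/-- wave packet -/
def pk {d : ℕ} (γ : ℝ) (v : Site d → ℝ) (X : Finset (Site d)) (I : Finset X) (c : X → ℝ)
    (x : Site d) : ℝ := ∑ β ∈ I, c β * ef γ v X β x

/-- coefficient norm -/
def nn {ι : Type*} (I : Finset ι) (c : ι → ℝ) : ℝ := √(∑ β ∈ I, c β ^ 2)

/-- local amplitude -/
def bb {d : ℕ} (γ : ℝ) (v : Site d → ℝ) (X : Finset (Site d)) (I : Finset X) (x : Site d) : ℝ :=
  nn I (fun β => ef γ v X β x)

lemma nn_nonneg {ι : Type*} (I : Finset ι) (c : ι → ℝ) : 0 ≤ nn I c := Real.sqrt_nonneg _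

lemma nn_sq {ι : Type*} (I : Finset ι) (c : ι → ℝ) : nn I c ^ 2 = ∑ β ∈ I, c β ^ 2 :=
  Real.sq_sqrt (Finset.sum_nonneg fun _ _ => sq_nonneg _)

lemma nn_mul_le {ι : Type*} (I : Finset ι) (c a : ι → ℝ) (θ : ℝ) (hθ : 0 ≤ θ)
    (ha : ∀ β ∈ I, |a β| ≤ θ) : nn I (fun β => a β * c β) ≤ θ * nn I c := by
  unfold nn
  apply Real.sqrt_le_iff.2
  refine ⟨by positivity, ?_⟩
  rw [mul_pow, Real.sq_sqrt (Finset.sum_nonneg fun _ _ => sq_nonneg _), Finset.mul_sum]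
  apply Finset.sum_le_sum
  intro β hβ
  rw [mul_pow]
  apply mul_le_mul_of_nonneg_right _ (sq_nonneg _)
  rw [← sq_abs]
  exact pow_le_pow_left₀ (abs_nonneg _) (ha β hβ) 2

section
variable {d : ℕ} (γ : ℝ) (v : Site d → ℝ) (X : Finset (Site d)) (I : Finset X)

lemma pk_off (c : X → ℝ) (x : Site d) (h : x ∉ X) : pk γ v X I c x = 0 := by
  unfold pk
  apply Finset.sum_eq_zero
  intro β _
  rw [ef_off γ v X β x h, mul_zero]

lemma bb_off (x : Site d) (h : x ∉ X) : bb γ v X I x = 0 := by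
  unfold bb nn
  simp [ef_off γ v X _ x h]

lemma pk_abs (c : X → ℝ) (x : Site d) : |pk γ v X I c x| ≤ nn I c * bb γ v X I x :=
  cs_abs I c _

lemma pk_inner (c c' : X → ℝ) :
    ∑ x ∈ X, pk γ v X I c x * pk γ v X I c' x = ∑ β ∈ I, c β * c' β := by
  unfold pk
  simp_rw [Finset.sum_mul_sum]
  rw [Finset.sum_comm]
  apply Finset.sum_congr rfl
  intro β hβ
  rw [Finset.sum_comm]
  have : ∀ β' ∈ I, ∑ x ∈ X, c β * ef γ v X β x * (c' β' * ef γ v X β' x) =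
      if β = β' then c β * c' β' else 0 := by
    intro β' _
    have h := ef_orth γ v X β β'
    calc _ = c β * c' β' * ∑ x ∈ X, ef γ v X β x * ef γ v X β' x := by
          rw [Finset.mul_sum]; apply Finset.sum_congr rfl; intros; ring
      _ = _ := by rw [h]; split_ifs <;> simp
  rw [Finset.sum_congr rfl this, Finset.sum_ite_eq, if_pos hβ]

lemma pk_sq (c : X → ℝ) : ∑ x ∈ X, pk γ v X I c x ^ 2 = nn I c ^ 2 := by
  rw [nn_sq]
  simp_rw [pow_two]
  exact pk_inner γ v X I c c

lemma pk_l2 (c : X → ℝ) : √(∑ x ∈ X, pk γ v X I c x ^ 2) = nn I c := by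
  rw [pk_sq, Real.sqrt_sq (nn_nonneg _ _)]

lemma pk_Lop (E : ℝ) (c : X → ℝ) (x : Site d) (hx : x ∈ X) :
    Lop γ v E (pk γ v X I c) x = pk γ v X I (fun β => (eig γ v X β - E) * c β) x := by
  have := Lop_add γ v E I c (fun β => ef γ v X β) x
  unfold pk
  rw [this]
  apply Finset.sum_congr rfl
  intro β _
  rw [ef_eig γ v X E β x hx]; ring

lemma pk_self (x : Site d) : pk γ v X I (fun β => ef γ v X β x) x = bb γ v X I x ^ 2 := by
  unfold bb
  rw [nn_sq]
  unfold pk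
  simp_rw [pow_two]

/-- comparison identity -/
lemma bilin (v' : Site d → ℝ) (I' : Finset X) (E E' θ : ℝ) (hθ : 0 ≤ θ)
    (hI : ∀ β ∈ I, |eig γ v X β - E| ≤ θ) (hI' : ∀ β ∈ I', |eig γ v' X β - E'| ≤ θ)
    (c c' : X → ℝ) :
    |∑ x ∈ X, (v x - v' x) * (pk γ v X I c x * pk γ v' X I' c' x)
      - (E - E') * ∑ x ∈ X, pk γ v X I c x * pk γ v' X I' c' x| ≤ 2 * θ * (nn I c * nn I' c') := by
  set u := pk γ v X I c with hu
  set u' := pk γ v' X I' c' with hu'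
  have hs := Lop_symm γ v' E' X u u' (pk_off γ v X I c) (pk_off γ v' X I' c')
  have h1 : ∀ x, Lop γ v' E' u x = Lop γ v E u x + (v' x - v x + E - E') * u x := by
    intro x; unfold Lop; ring
  simp_rw [h1] at hs
  have h2 : ∑ x ∈ X, (v x - v' x) * (u x * u' x) - (E - E') * ∑ x ∈ X, u x * u' x =
      ∑ x ∈ X, u' x * Lop γ v E u x - ∑ x ∈ X, u x * Lop γ v' E' u' x := by
    rw [hs, Finset.mul_sum, ← Finset.sum_sub_distrib, ← Finset.sum_sub_distrib]
    apply Finset.sum_congr rfl; intros; ring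
  rw [h2]
  have h3 : |∑ x ∈ X, u' x * Lop γ v E u x| ≤ nn I' c' * (θ * nn I c) := by
    refine (cs_abs _ _ _).trans ?_
    rw [hu', pk_l2]
    apply mul_le_mul_of_nonneg_left _ (nn_nonneg _ _)
    have : ∑ x ∈ X, Lop γ v E u x ^ 2 =
        ∑ x ∈ X, pk γ v X I (fun β => (eig γ v X β - E) * c β) x ^ 2 :=
      Finset.sum_congr rfl fun x hx => by rw [hu, pk_Lop γ v X I E c x hx]
    rw [this, pk_l2]
    exact nn_mul_le I c _ θ hθ hI
  have h4 : |∑ x ∈ X, u x * Lop γ v' E' u' x| ≤ nn I c * (θ * nn I' c') := by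
    refine (cs_abs _ _ _).trans ?_
    rw [hu, pk_l2]
    apply mul_le_mul_of_nonneg_left _ (nn_nonneg _ _)
    have : ∑ x ∈ X, Lop γ v' E' u' x ^ 2 =
        ∑ x ∈ X, pk γ v' X I' (fun β => (eig γ v' X β - E') * c' β) x ^ 2 :=
      Finset.sum_congr rfl fun x hx => by rw [hu', pk_Lop γ v' X I' E' c' x hx]
    rw [this, pk_l2]
    exact nn_mul_le I' c' _ θ hθ hI'
  refine (abs_sub _ _).trans ?_
  linarith

end

lemma tail_sum (J j0 : ℕ) (T0 γ : ℝ) (hγ : 0 ≤ γ) (hγ4 : γ ^ 4 ≤ 1 / 2) :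
    ∑ j : Fin J, (if j0 < (j : ℕ) then (T0 * γ ^ (2 * (j : ℕ))) ^ 2 else 0) ≤
      2 * γ ^ 4 * (T0 * γ ^ (2 * j0)) ^ 2 := by
  rw [Fin.sum_univ_eq_sum_range (fun j => if j0 < j then (T0 * γ ^ (2 * j)) ^ 2 else 0) J]
  have key : ∀ J : ℕ, ∑ j ∈ Finset.range J, (if j0 < j then (T0 * γ ^ (2 * j)) ^ 2 else 0) +
      (if j0 < J then 2 * (T0 * γ ^ (2 * J)) ^ 2 else 2 * γ ^ 4 * (T0 * γ ^ (2 * j0)) ^ 2) ≤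
      2 * γ ^ 4 * (T0 * γ ^ (2 * j0)) ^ 2 := by
    intro J
    induction J with
    | zero => simp
    | succ J ih =>
      rw [Finset.sum_range_succ]
      have e : (T0 * γ ^ (2 * (J + 1))) ^ 2 = γ ^ 4 * (T0 * γ ^ (2 * J)) ^ 2 := by ring
      have hnn : 0 ≤ (T0 * γ ^ (2 * J)) ^ 2 := sq_nonneg _
      rcases lt_trichotomy j0 J with h | h | h
      · rw [if_pos h] at ih ⊢
        rw [if_pos (by omega), e]
        nlinarith
      · subst h
        simp only [lt_irrefl, if_false] at ih ⊢
        rw [if_pos (by omega), e]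
        linarith
      · rw [if_neg (by omega)] at ih ⊢
        rw [if_neg (by omega)]
        linarith
  have := key J
  have h2 : 0 ≤ (if j0 < J then 2 * (T0 * γ ^ (2 * J)) ^ 2
      else 2 * γ ^ 4 * (T0 * γ ^ (2 * j0)) ^ 2) := by
    split_ifs <;> positivity
  linarith

set_option maxHeartbeats 1000000 in
/-- first difference lemma -/
lemma first_diff {d : ℕ} {γ : ℝ} (hγ : 0 < γ) (hγ4 : γ ^ 4 ≤ 1 / 2) (v v' : Site d → ℝ)
    (X : Finset (Site d))
    (I I' : Finset X) (E E' θ ν T0 : ℝ) (hθ : 0 ≤ θ) (hν : 0 ≤ ν) (hT0 : 0 < T0)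
    (hI : ∀ β ∈ I, |eig γ v X β - E| ≤ θ) (hI' : ∀ β ∈ I', |eig γ v' X β - E'| ≤ θ)
    (J : ℕ) (y : Fin J → Site d) (hyinj : Function.Injective y) (hyX : ∀ j, y j ∈ X)
    (hb : ∀ j : Fin J, γ / 3 * (T0 * γ ^ (2 * (j : ℕ))) ≤ bb γ v X I (y j) ∧
      bb γ v X I (y j) ≤ T0 * γ ^ (2 * (j : ℕ)))
    (hb' : ∀ j : Fin J, γ / 3 * (T0 * γ ^ (2 * (j : ℕ))) ≤ bb γ v' X I' (y j) ∧
      bb γ v' X I' (y j) ≤ T0 * γ ^ (2 * (j : ℕ)))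
    (hoff : ∀ x ∈ X, (∀ j, y j ≠ x) → v x = v' x)
    (hd1 : ∀ x ∈ X, |v x - v' x| ≤ 1) (hdν : ∀ x ∈ X, v x ≠ v' x → ν ≤ |v x - v' x|)
    (hne : ∃ x ∈ X, v x ≠ v' x) :
    ∃ T x, x ∈ X ∧ T0 * γ ^ (2 * J) ≤ T ∧ 0 < T ∧
      (ν * (γ ^ 2 / 9 * T ^ 2) ≤ |E - E'| + 2 * θ + 2 * γ ^ 4 * T ^ 2) ∧
      ∀ c c' : X → ℝ, pk γ v X I c x = 0 →
        |E - E'| * |∑ x ∈ X, pk γ v X I c x * pk γ v' X I' c' x| ≤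
          (2 * γ ^ 4 * T ^ 2 + 2 * θ) * (nn I c * nn I' c') := by
  classical
  have hγ1 : γ ≤ 1 := by
    by_contra h
    push Not at h
    have : 1 < γ ^ 4 := one_lt_pow₀ h (by norm_num)
    linarith
  -- first differing record
  obtain ⟨x0, hx0, hx0ne⟩ := hne
  have hex : ∃ n, ∃ h : n < J, v (y ⟨n, h⟩) ≠ v' (y ⟨n, h⟩) := by
    by_contra hc
    push Not at hc
    apply hx0ne
    apply hoff x0 hx0
    intro j hj
    apply hx0ne
    rw [← hj]
    exact hc j j.2
  obtain ⟨hj0, hj0ne⟩ := Nat.find_spec hex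
  have hmin : ∀ j : Fin J, (j : ℕ) < Nat.find hex → v (y j) = v' (y j) := by
    intro j hj
    have := Nat.find_min hex hj
    by_contra hc
    exact this ⟨j.2, hc⟩
  set j0 := Nat.find hex with hj0def
  set T := T0 * γ ^ (2 * j0) with hT
  set x := y ⟨j0, hj0⟩ with hx
  have hTpos : 0 < T := by positivity
  -- main expansion
  have hexp : ∀ c c' : X → ℝ,
      |∑ z ∈ X, (v z - v' z) * (pk γ v X I c z * pk γ v' X I' c' z) -
        (v x - v' x) * (pk γ v X I c x * pk γ v' X I' c' x)| ≤
      2 * γ ^ 4 * T ^ 2 * (nn I c * nn I' c') := by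
    intro c c'
    set f : Site d → ℝ := fun z => (v z - v' z) * (pk γ v X I c z * pk γ v' X I' c' z) with hf
    have h1 : ∑ z ∈ X, f z = ∑ j : Fin J, f (y j) := by
      rw [← Finset.sum_image (s := Finset.univ) (g := y) (f := f) (fun a _ b _ h => hyinj h)]
      symm
      apply Finset.sum_subset
      · intro z hz
        obtain ⟨j, _, rfl⟩ := Finset.mem_image.1 hz
        exact hyX j
      · intro z hz hz'
        have : v z = v' z := hoff z hz fun j hj => hz' (Finset.mem_image.2 ⟨j, Finset.mem_univ _, hj⟩)
        simp [hf, this]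
    have h2 : ∑ j : Fin J, f (y j) - f x = ∑ j ∈ Finset.univ.erase ⟨j0, hj0⟩, f (y j) := by
      rw [← Finset.add_sum_erase Finset.univ (fun j => f (y j)) (Finset.mem_univ ⟨j0, hj0⟩)]
      simp [hx]
    have h3 : ∑ z ∈ X, f z - f x = ∑ j ∈ Finset.univ.erase ⟨j0, hj0⟩, f (y j) := by
      rw [h1, h2]
    change |∑ z ∈ X, f z - f x| ≤ _
    rw [h3]
    have hnn : 0 ≤ nn I c * nn I' c' := mul_nonneg (nn_nonneg _ _) (nn_nonneg _ _)
    have h4 : ∀ j ∈ Finset.univ.erase (⟨j0, hj0⟩ : Fin J), |f (y j)| ≤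
        (if j0 < (j : ℕ) then (T0 * γ ^ (2 * (j : ℕ))) ^ 2 else 0) * (nn I c * nn I' c') := by
      intro j hj
      have hjne : (j : ℕ) ≠ j0 := fun h => (Finset.mem_erase.1 hj).1 (Fin.ext h)
      split_ifs with hlt
      · simp only [hf]
        rw [abs_mul, abs_mul]
        have ha := pk_abs γ v X I c (y j)
        have hb1 := pk_abs γ v' X I' c' (y j)
        have hc1 := (hb j).2
        have hc2 := (hb' j).2
        have hTj : 0 ≤ T0 * γ ^ (2 * (j : ℕ)) := by positivity
        have ha2 : |pk γ v X I c (y j)| ≤ nn I c * (T0 * γ ^ (2 * (j : ℕ))) :=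
          ha.trans (mul_le_mul_of_nonneg_left hc1 (nn_nonneg _ _))
        have hb2 : |pk γ v' X I' c' (y j)| ≤ nn I' c' * (T0 * γ ^ (2 * (j : ℕ))) :=
          hb1.trans (mul_le_mul_of_nonneg_left hc2 (nn_nonneg _ _))
        have hm := mul_le_mul ha2 hb2 (abs_nonneg _) (mul_nonneg (nn_nonneg _ _) hTj)
        have hm2 := mul_le_mul (hd1 (y j) (hyX j)) hm (by positivity) zero_le_one
        refine hm2.trans (le_of_eq ?_)
        ring
      · have : v (y j) = v' (y j) := hmin j (by omega)
        simp [hf, this]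
    refine (Finset.abs_sum_le_sum_abs _ _).trans ((Finset.sum_le_sum h4).trans ?_)
    rw [← Finset.sum_mul]
    apply mul_le_mul_of_nonneg_right _ hnn
    refine le_trans ?_ (tail_sum J j0 T0 γ hγ.le hγ4)
    apply Finset.sum_le_sum_of_subset_of_nonneg (Finset.erase_subset _ _)
    intro j _ _
    split_ifs <;> positivity
  refine ⟨T, x, hyX _, ?_, hTpos, ?_, ?_⟩
  · rw [hT]
    apply mul_le_mul_of_nonneg_left _ hT0.le
    exact pow_le_pow_of_le_one hγ.le hγ1 (by omega)
  · set c : X → ℝ := fun β => ef γ v X β x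
    set c' : X → ℝ := fun β => ef γ v' X β x
    have h1 := hexp c c'
    have h2 := bilin γ v X I v' I' E E' θ hθ hI hI' c c'
    have hbx : nn I c = bb γ v X I x := rfl
    have hbx' : nn I' c' = bb γ v' X I' x := rfl
    have hux : pk γ v X I c x = bb γ v X I x ^ 2 := pk_self γ v X I x
    have hux' : pk γ v' X I' c' x = bb γ v' X I' x ^ 2 := pk_self γ v' X I' x
    have h3 := cs_abs X (pk γ v X I c) (pk γ v' X I' c')
    rw [pk_l2, pk_l2, hbx, hbx'] at h3
    rw [hux, hux', hbx, hbx'] at h1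
    rw [hbx, hbx'] at h2
    have hb1 := (hb ⟨j0, hj0⟩).1
    have hb1' := (hb' ⟨j0, hj0⟩).1
    rw [← hx] at hb1 hb1'
    simp only at hb1 hb1'
    rw [← hT] at hb1 hb1'
    set B := bb γ v X I x
    set B' := bb γ v' X I' x
    have hg3 : 0 < γ / 3 * T := by positivity
    have hB : 0 < B := by linarith
    have hB' : 0 < B' := by linarith
    have hBB : γ ^ 2 / 9 * T ^ 2 ≤ B * B' := by
      have := mul_le_mul hb1 hb1' hg3.le hB.le
      calc _ = γ / 3 * T * (γ / 3 * T) := by ring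
        _ ≤ _ := this
    have hνx := hdν x (hyX _) hj0ne
    set S := ∑ z ∈ X, (v z - v' z) * (pk γ v X I c z * pk γ v' X I' c' z)
    set P := ∑ z ∈ X, pk γ v X I c z * pk γ v' X I' c' z
    have h4 : |(v x - v' x) * (B ^ 2 * B' ^ 2)| ≤
        |E - E'| * (B * B') + 2 * θ * (B * B') + 2 * γ ^ 4 * T ^ 2 * (B * B') := by
      have e : (v x - v' x) * (B ^ 2 * B' ^ 2) = (E - E') * P + (S - (E - E') * P)
        - (S - (v x - v' x) * (B ^ 2 * B' ^ 2)) := by ring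
      rw [e]
      have a1 := abs_sub ((E - E') * P + (S - (E - E') * P)) (S - (v x - v' x) * (B ^ 2 * B' ^ 2))
      have a2 := abs_add_le ((E - E') * P) (S - (E - E') * P)
      rw [abs_mul] at a2
      have a3 := mul_le_mul_of_nonneg_left h3 (abs_nonneg (E - E'))
      linarith
    rw [abs_mul, abs_of_nonneg (by positivity : 0 ≤ B ^ 2 * B' ^ 2)] at h4
    have h5 : (|v x - v' x| * (B * B')) * (B * B') ≤
        (|E - E'| + 2 * θ + 2 * γ ^ 4 * T ^ 2) * (B * B') := by
      calc _ = |v x - v' x| * (B ^ 2 * B' ^ 2) := by ring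
        _ ≤ _ := h4
        _ = _ := by ring
    have h6 := le_of_mul_le_mul_right h5 (by positivity)
    refine le_trans ?_ h6
    exact mul_le_mul hνx hBB (by positivity) (abs_nonneg _)
  · intro c c' hc0
    have h1 := hexp c c'
    have h2 := bilin γ v X I v' I' E E' θ hθ hI hI' c c'
    rw [hc0, zero_mul, mul_zero, sub_zero] at h1
    rw [← abs_mul]
    set S := ∑ z ∈ X, (v z - v' z) * (pk γ v X I c z * pk γ v' X I' c' z)
    set P := ∑ z ∈ X, pk γ v X I c z * pk γ v' X I' c' z
    have e : (E - E') * P = S - (S - (E - E') * P) := by ring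
    rw [e]
    refine (abs_sub _ _).trans ?_
    linarith

end MLS
namespace MLS

lemma HG.le2 {d : ℕ} {γ κ : ℝ} (hG : HG d γ κ) : 2 * d * γ ≤ 1 := by
  have := hG.dγ; have := hG.κle; linarith

lemma HG.γd {d : ℕ} {γ κ : ℝ} (hG : HG d γ κ) : (2 * d - 1) * γ ≤ 1 := by
  have := hG.le2; have := hG.pos; nlinarith

lemma HG.γ4 {d : ℕ} {γ κ : ℝ} (hG : HG d γ κ) : γ ^ 4 ≤ 1 / 2 := by
  have := hG.pow_half (a := 4) (by norm_num); linarith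

lemma HG.γ3 {d : ℕ} {γ κ : ℝ} (hG : HG d γ κ) : γ < 1 / 3 := by
  have := hG.small; have := hG.pos; linarith

/-- the maximal site of an eigenfunction -/
lemma ef_argmax {d : ℕ} (γ : ℝ) (v : Site d → ℝ) (X : Finset (Site d)) (β : X) :
    ∃ z ∈ X, 0 < |ef γ v X β z| ∧ (∀ y, |ef γ v X β y| ≤ |ef γ v X β z|) ∧
      1 ≤ (X.card : ℝ) * |ef γ v X β z| ^ 2 := by
  obtain ⟨z, hz, hmax⟩ := Finset.exists_max_image X (fun y => |ef γ v X β y|) ⟨β, β.2⟩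
  have h1 := ef_orth γ v X β β
  rw [if_pos rfl] at h1
  have h2 : (1 : ℝ) ≤ (X.card : ℝ) * |ef γ v X β z| ^ 2 := by
    rw [← h1]
    calc _ ≤ ∑ x ∈ X, |ef γ v X β z| ^ 2 := by
          apply Finset.sum_le_sum
          intro x hx
          rw [← pow_two, ← sq_abs]
          exact pow_le_pow_left₀ (abs_nonneg _) (hmax x hx) 2
      _ = _ := by simp
  refine ⟨z, hz, ?_, ?_, h2⟩
  · rcases (abs_nonneg (ef γ v X β z)).lt_or_eq with h | h
    · exact h
    · rw [← h] at h2; norm_num at h2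
  · intro y
    by_cases hy : y ∈ X
    · exact hmax y hy
    · rw [ef_off γ v X β y hy]; simp

/-- location of eigenvalues -/
lemma eig_loc {d : ℕ} {γ κ : ℝ} (hG : HG d γ κ) (v : Site d → ℝ) (X : Finset (Site d))
    (hv : ∀ x ∈ X, 0 ≤ v x ∧ v x ≤ 1) (β : X) (y : Site d) (hy : y ∈ X) :
    |2 * d * γ + v y - eig γ v X β| ≤ 2 := by
  obtain ⟨z, hz, hpos, hmax, -⟩ := ef_argmax γ v X β
  have h := ef_eig γ v X (eig γ v X β) β z hz
  unfold Lop at h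
  rw [sub_self, zero_mul, sub_eq_zero] at h
  have hn := nb_le (ef γ v X β) z _ (fun y _ => hmax y)
  have h2 : |2 * d * γ + v z - eig γ v X β| * |ef γ v X β z| ≤ 1 * |ef γ v X β z| := by
    rw [← abs_mul, h, abs_mul, abs_of_pos hG.pos]
    calc γ * |nb (ef γ v X β) z| ≤ γ * (2 * d * |ef γ v X β z|) :=
          mul_le_mul_of_nonneg_left hn hG.pos.le
      _ = (2 * d * γ) * |ef γ v X β z| := by ring
      _ ≤ _ := mul_le_mul_of_nonneg_right hG.le2 (abs_nonneg _)
  have h3 := abs_le.1 (le_of_mul_le_mul_right h2 hpos)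
  have := hv z hz
  have := hv y hy
  rw [abs_le]; constructor <;> linarith [h3.1, h3.2]

lemma nb_split {d : ℕ} (u : Site d → ℝ) (x : Site d) (i : Fin d) (σ : Bool) :
    nb u (x + dirv i σ) = u x + (u (x + dirv i σ + dirv i σ) +
      ∑ l ∈ Finset.univ.erase i, (u (x + dirv i σ + ev l) + u (x + dirv i σ - ev l))) := by
  unfold nb
  rw [← Finset.add_sum_erase _ _ (Finset.mem_univ i)]
  have : u (x + dirv i σ + ev i) + u (x + dirv i σ - ev i) = u x + u (x + dirv i σ + dirv i σ) := by
    unfold dirv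
    cases σ
    · simp [sub_eq_add_neg, add_assoc]
    · simp [add_comm]
  rw [this, add_assoc]

set_option maxHeartbeats 1000000 in
/-- chain inequality for amplitudes -/
lemma chain_bb {d : ℕ} {γ : ℝ} (hγ : 0 < γ) (v : Site d → ℝ) (X : Finset (Site d)) (I : Finset X)
    (i : Fin d) (σ : Bool) (x : Site d) (hx : x + dirv i σ ∈ X)
    (hloc : ∀ β ∈ I, |2 * d * γ + v (x + dirv i σ) - eig γ v X β| ≤ 2) :
    γ * bb γ v X I x ≤ 2 * bb γ v X I (x + dirv i σ) +
      γ * (bb γ v X I (x + dirv i σ + dirv i σ) +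
        ∑ l ∈ Finset.univ.erase i,
          (bb γ v X I (x + dirv i σ + ev l) + bb γ v X I (x + dirv i σ - ev l))) := by
  have hb0 : ∀ y, 0 ≤ bb γ v X I y := fun y => nn_nonneg _ _
  set y := x + dirv i σ with hy
  rcases (hb0 x).eq_or_lt with h0 | h0
  · rw [← h0, mul_zero]
    have : 0 ≤ ∑ l ∈ Finset.univ.erase i, (bb γ v X I (y + ev l) + bb γ v X I (y - ev l)) :=
      Finset.sum_nonneg fun l _ => add_nonneg (hb0 _) (hb0 _)
    have h1 := hb0 y
    have h2 := hb0 (y + dirv i σ)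
    exact add_nonneg (mul_nonneg (by norm_num) h1) (mul_nonneg hγ.le (add_nonneg h2 this))
  set c : X → ℝ := fun β => ef γ v X β x with hc
  have hnn : nn I c = bb γ v X I x := rfl
  have hP := pk_Lop γ v X I (2 * d * γ + v y) c y hx
  have hL : Lop γ v (2 * d * γ + v y) (pk γ v X I c) y = - (γ * nb (pk γ v X I c) y) := by
    unfold Lop; ring
  rw [hL] at hP
  have hA : |γ * nb (pk γ v X I c) y| ≤ (2 * bb γ v X I x) * bb γ v X I y := by
    rw [← abs_neg, hP]
    refine (pk_abs γ v X I _ y).trans ?_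
    apply mul_le_mul_of_nonneg_right _ (hb0 y)
    rw [← hnn]
    apply nn_mul_le _ _ _ _ (by norm_num)
    intro β hβ
    rw [abs_sub_comm]
    exact hloc β hβ
  have hsp := nb_split (pk γ v X I c) x i σ
  rw [← hy, pk_self] at hsp
  have hB : |pk γ v X I c (y + dirv i σ) +
      ∑ l ∈ Finset.univ.erase i, (pk γ v X I c (y + ev l) + pk γ v X I c (y - ev l))| ≤
      bb γ v X I x * (bb γ v X I (y + dirv i σ) +
        ∑ l ∈ Finset.univ.erase i, (bb γ v X I (y + ev l) + bb γ v X I (y - ev l))) := by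
    refine (abs_add_le _ _).trans ?_
    rw [mul_add, Finset.mul_sum]
    apply add_le_add
    · exact pk_abs γ v X I c _
    · refine (Finset.abs_sum_le_sum_abs _ _).trans (Finset.sum_le_sum fun l _ => ?_)
      refine (abs_add_le _ _).trans ?_
      rw [mul_add]
      exact add_le_add (pk_abs γ v X I c _) (pk_abs γ v X I c _)
  set W := pk γ v X I c (y + dirv i σ) +
      ∑ l ∈ Finset.univ.erase i, (pk γ v X I c (y + ev l) + pk γ v X I c (y - ev l)) with hW
  set S := bb γ v X I (y + dirv i σ) +
        ∑ l ∈ Finset.univ.erase i, (bb γ v X I (y + ev l) + bb γ v X I (y - ev l)) with hS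
  have hA' := (abs_le.1 hA).2
  have hB' := (abs_le.1 hB).1
  rw [hsp] at hA'
  have hB'' := mul_le_mul_of_nonneg_left hB' hγ.le
  apply le_of_mul_le_mul_left _ h0
  nlinarith

lemma LL_dvd (s k : ℕ) (hs : 3 ≤ s) : 8 ∣ LL s k := by
  induction k with
  | zero =>
    simp only [LL]
    exact Dvd.dvd.trans (by norm_num : 8 ∣ 2 ^ 3) (pow_dvd_pow 2 hs)
  | succ k ih => rw [LL_succ]; exact Dvd.dvd.mul_left ih _

/-- exponential decay away from the bad sites -/
lemma decay {d : ℕ} {γ κ : ℝ} (hG : HG d γ κ) (s k t : ℕ) (hs : 3 ≤ s) (ht : LL s k = 8 * t)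
    (X : Finset (Site d)) (E : ℝ) (v u : Site d → ℝ) (y0 : Site d) (M : ℝ) (hM : 0 ≤ M)
    (hbad : ∀ x ∈ X, bad γ κ s k X x E v → x ∈ cube y0 (4 * LL s k))
    (hu : ∀ x, x ∉ X → u x = 0) (huM : ∀ x, |u x| ≤ M)
    (hL : ∀ x ∈ X, |Lop γ v E u x| ≤ γ ^ (8 * LL s k) * |u x|) (j : ℕ) :
    ∀ x, x ∉ cube y0 ((3 + j) * LL s k) → |u x| ≤ γ ^ (t * j) * M := by
  have ht1 : 1 ≤ t := by have := LL_pos s k; omega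
  have hγ := hG.pos
  induction j with
  | zero => intro x _; simpa using huM x
  | succ j ih =>
    intro x hx
    by_cases hxX : x ∈ X
    swap
    · rw [hu x hxX, abs_zero]; positivity
    have hgood : ¬ bad γ κ s k X x E v := by
      intro hb
      exact hx (cube_mono (Nat.mul_le_mul_right _ (by omega)) (hbad x hxX hb))
    have hcube : ∀ y ∈ cube x (LL s k), |u y| ≤ γ ^ (t * j) * M := by
      intro y hy
      apply ih
      intro hc
      apply hx
      have := cube_trans hc (cube_comm.1 hy)
      have e : (3 + j) * LL s k + LL s k = (3 + (j + 1)) * LL s k := by ring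
      rwa [e] at this
    set M' := γ ^ (t * j) * M with hM'
    have hM'0 : 0 ≤ M' := by positivity
    have h := AP_all hG s (by omega) k X x E v u (γ ^ (8 * LL s k) * M') M' (by positivity) hM'0
      hgood hu hcube (by
        intro y hy
        rw [Finset.mem_inter] at hy
        refine (hL y hy.1).trans ?_
        exact mul_le_mul_of_nonneg_left (hcube y hy.2) (by positivity))
    refine h.trans ?_
    have e1 : (γ ^ LL s k)⁻¹ * (γ ^ (8 * LL s k) * M') = γ ^ (7 * LL s k) * M' := by
      have : γ ^ (8 * LL s k) = γ ^ LL s k * γ ^ (7 * LL s k) := by rw [← pow_add]; congr 1; ring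
      rw [this]
      have : γ ^ LL s k ≠ 0 := by positivity
      field_simp
    rw [e1]
    have hm := mm_ge s k (by omega)
    have a1 : γ ^ mm s k ≤ γ ^ (2 * t) := hG.powle (by omega)
    have a2 : γ ^ (7 * LL s k) ≤ γ ^ (2 * t) := hG.powle (by omega)
    have a3 : γ ^ (2 * t) = γ ^ t * γ ^ t := by rw [← pow_add]; congr 1; ring
    have a4 := hG.pow_half ht1
    have a5 : γ ^ (t * (j + 1)) * M = γ ^ t * M' := by rw [hM']; ring
    rw [a5]
    have a6 : 0 ≤ γ ^ t := by positivity
    have : γ ^ mm s k + γ ^ (7 * LL s k) ≤ γ ^ t := by nlinarith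
    nlinarith

/-- maximal sites of almost eigenfunctions are bad -/
lemma max_bad {d : ℕ} {γ κ : ℝ} (hG : HG d γ κ) (s k : ℕ) (hs : 3 ≤ s)
    (X : Finset (Site d)) (E : ℝ) (v u : Site d → ℝ) (z : Site d) (hz : 0 < |u z|)
    (hu : ∀ x, x ∉ X → u x = 0) (huM : ∀ x, |u x| ≤ |u z|)
    (hL : ∀ x ∈ X, |Lop γ v E u x| ≤ γ ^ (8 * LL s k) * |u x|) : bad γ κ s k X z E v := by
  by_contra hb
  have hγ := hG.pos
  have hl := LL_pos s k
  have hm := mm_ge s k (by omega)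
  have h := AP_all hG s (by omega) k X z E v u (γ ^ (8 * LL s k) * |u z|) |u z| (by positivity)
    hz.le hb hu (fun y _ => huM y) (by
      intro y hy
      rw [Finset.mem_inter] at hy
      refine (hL y hy.1).trans ?_
      exact mul_le_mul_of_nonneg_left (huM y) (by positivity))
  have e1 : (γ ^ LL s k)⁻¹ * (γ ^ (8 * LL s k) * |u z|) = γ ^ (7 * LL s k) * |u z| := by
    have : γ ^ (8 * LL s k) = γ ^ LL s k * γ ^ (7 * LL s k) := by rw [← pow_add]; congr 1; ring
    rw [this]
    have : γ ^ LL s k ≠ 0 := by positivity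
    field_simp
  rw [e1] at h
  have a1 := hG.pow_half (a := mm s k) (by omega)
  have a2 := hG.pow_half (a := 7 * LL s k) (by omega)
  nlinarith

section pot
variable {d : ℕ} {N : ℕ} (hN : 2 ≤ N) (Λ : Finset (Site d))

lemma pot_range (hN : 2 ≤ N) (ω : Λ → Fin N) (x : Site d) :
    0 ≤ potential N Λ ω x ∧ potential N Λ ω x ≤ 1 := by
  have h1 : (2 : ℝ) ≤ N := by exact_mod_cast hN
  unfold potential
  split_ifs with h
  · constructor
    · apply div_nonneg (by positivity); linarith
    · rw [div_le_one (by linarith)]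
      have : ((ω ⟨x, h⟩ : ℕ) : ℝ) + 1 ≤ N := by exact_mod_cast (ω ⟨x, h⟩).2
      linarith
  · simp

lemma pot_diff (hN : 2 ≤ N) (ω ω' : Λ → Fin N) (x : Site d) :
    |potential N Λ ω x - potential N Λ ω' x| ≤ 1 := by
  have := pot_range Λ hN ω x
  have := pot_range Λ hN ω' x
  rw [abs_le]; constructor <;> linarith

lemma pot_sep' (hN : 2 ≤ N) (a b : Fin N) (h : a ≠ b) :
    1 / (N : ℝ) ≤ |((a : ℕ) : ℝ) / ((N : ℝ) - 1) - ((b : ℕ) : ℝ) / ((N : ℝ) - 1)| := by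
  have h1 : (2 : ℝ) ≤ N := by exact_mod_cast hN
  have h2 : (1 : ℝ) ≤ |((a : ℕ) : ℝ) - ((b : ℕ) : ℝ)| := by
    have h3 : (a : ℕ) ≠ (b : ℕ) := fun h' => h (Fin.ext h')
    have h4 : (1 : ℤ) ≤ |((a : ℕ) : ℤ) - ((b : ℕ) : ℤ)| := Int.one_le_abs (by omega)
    exact_mod_cast h4
  rw [← sub_div, abs_div, abs_of_pos (by linarith : (0 : ℝ) < (N : ℝ) - 1)]
  rw [div_le_div_iff₀ (by linarith) (by linarith)]
  nlinarith

lemma pot_sep (hN : 2 ≤ N) (ω ω' : Λ → Fin N) (x : Site d)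
    (h : potential N Λ ω x ≠ potential N Λ ω' x) :
    1 / (N : ℝ) ≤ |potential N Λ ω x - potential N Λ ω' x| := by
  unfold potential at h ⊢
  split_ifs at h ⊢ with hx
  · apply pot_sep' hN
    intro hc; rw [hc] at h; exact h rfl
  · exact absurd rfl h

lemma pot_inj (hN : 2 ≤ N) (ω ω' : Λ → Fin N) (x : Λ) (h : ω x ≠ ω' x) :
    potential N Λ ω x ≠ potential N Λ ω' x := by
  intro hc
  unfold potential at hc
  rw [dif_pos x.2, dif_pos x.2] at hc
  have := pot_sep' hN _ _ h
  rw [hc, sub_self, abs_zero] at this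
  have h1 : (2 : ℝ) ≤ N := by exact_mod_cast hN
  have : 0 < 1 / (N : ℝ) := by positivity
  linarith

lemma pot_congr (ω ω' : Λ → Fin N) (x : Site d) (h : ∀ hx : x ∈ Λ, ω ⟨x, hx⟩ = ω' ⟨x, hx⟩) :
    potential N Λ ω x = potential N Λ ω' x := by
  unfold potential
  split_ifs with hx
  · rw [h hx]
  · rfl

end pot

/-- sites of a code as a subset of `Λ` -/
def RR {d J : ℕ} (Λ : Finset (Site d)) (c : Fin J → Site d) : Finset Λ :=
  Finset.univ.filter fun x : Λ => ∃ j, c j = x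

lemma mem_RR {d J : ℕ} (Λ : Finset (Site d)) (c : Fin J → Site d) (x : Λ) :
    x ∈ RR Λ c ↔ ∃ j, c j = x := by
  unfold RR; simp

lemma card_RR {d J : ℕ} (Λ : Finset (Site d)) (c : Fin J → Site d) (hc : Function.Injective c)
    (hcΛ : ∀ j, c j ∈ Λ) : J ≤ (RR Λ c).card := by
  have : (Finset.univ.image (fun j => (⟨c j, hcΛ j⟩ : Λ))).card = J := by
    rw [Finset.card_image_of_injective, Finset.card_univ, Fintype.card_fin]
    intro a b h
    exact hc (by simpa using h)
  refine this.symm.le.trans ?_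
  apply Finset.card_le_card
  intro x hx
  rw [Finset.mem_image] at hx
  obtain ⟨j, -, rfl⟩ := hx
  rw [mem_RR]
  exact ⟨j, rfl⟩

/-- room in one of the two directions -/
lemma room {d : ℕ} (a b : Site d) (i : Fin d) (H : ℕ) (h : (2 * H : ℤ) ≤ b i - a i) (z : Site d) :
    ∃ σ : Bool, ∀ y ∈ Finset.Icc a b, disp i σ z y < H → y + dirv i σ ∈ Finset.Icc a b := by
  have ap : ∀ j, j ≠ i → ev i j = 0 := fun j hj => by simp [ev, hj]
  have ap2 : ev i i = 1 := by simp [ev]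
  by_cases hc : z i + H ≤ b i
  · refine ⟨true, ?_⟩
    intro y hy hd
    rw [Finset.mem_Icc] at hy ⊢
    simp only [disp, sg, if_true, one_mul] at hd
    simp only [dirv, if_true]
    constructor
    · intro j
      by_cases hj : j = i
      · subst hj; simp only [Pi.add_apply, ap2]; have := (Pi.le_def.1 hy.1) j; omega
      · simp only [Pi.add_apply, ap j hj]; have := (Pi.le_def.1 hy.1) j; omega
    · intro j
      by_cases hj : j = i
      · subst hj; simp only [Pi.add_apply, ap2]; omega
      · simp only [Pi.add_apply, ap j hj]; have := (Pi.le_def.1 hy.2) j; omega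
  · refine ⟨false, ?_⟩
    intro y hy hd
    rw [Finset.mem_Icc] at hy ⊢
    simp only [disp, sg, Bool.false_eq_true, if_false] at hd
    simp only [dirv, Bool.false_eq_true, if_false]
    constructor
    · intro j
      by_cases hj : j = i
      · subst hj; simp only [Pi.add_apply, Pi.neg_apply, ap2]; omega
      · simp only [Pi.add_apply, Pi.neg_apply, ap j hj]; have := (Pi.le_def.1 hy.1) j; omega
    · intro j
      by_cases hj : j = i
      · subst hj; simp only [Pi.add_apply, Pi.neg_apply, ap2]; have := (Pi.le_def.1 hy.2) j; omega
      · simp only [Pi.add_apply, Pi.neg_apply, ap j hj]; have := (Pi.le_def.1 hy.2) j; omega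

lemma disp_not_cube {d : ℕ} {i : Fin d} {σ : Bool} {z y : Site d} {H l : ℕ} (h : (H : ℤ) ≤ disp i σ z y)
    (hl : l < H) : y ∉ cube z l := by
  intro hc
  rw [mem_cube] at hc
  have h1 := abs_le.1 (hc i)
  unfold disp sg at h
  cases σ <;> simp at h <;> omega

lemma bb_single {d : ℕ} (γ : ℝ) (v : Site d → ℝ) (X : Finset (Site d)) (β : X) (x : Site d) :
    bb γ v X {β} x = |ef γ v X β x| := by
  unfold bb nn
  rw [Finset.sum_singleton, Real.sqrt_sq_eq_abs]

set_option maxHeartbeats 300000 in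
/-- Wegner type estimate at fixed energy -/
theorem wegner {d : ℕ} {γ κ : ℝ} (hG : HG d γ κ) (s k : ℕ) (hs : 3 ≤ s) (N : ℕ) (hN : 2 ≤ N)
    (hNγ : 100 * N * γ ≤ 1) (Λ : Finset (Site d)) (a b : Site d) (hZ : Finset.Icc a b ⊆ Λ)
    (i : Fin d) (hside : (64 * LL s k : ℤ) ≤ b i - a i)
    (hcard : ((Finset.Icc a b).card : ℝ) * (γ ^ LL s k) ^ 2 ≤ 1) (E : ℝ) :
    prob (fun ω : Λ → Fin N =>
      (∃ β, |eig γ (potential N Λ ω) (Finset.Icc a b) β - E| ≤ γ ^ (8 * LL s k)) ∧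
      ∀ x1 ∈ Finset.Icc a b, ∀ x2 ∈ Finset.Icc a b, far s k x1 x2 →
        bad γ κ s k (Finset.Icc a b) x1 E (potential N Λ ω) →
        bad γ κ s k (Finset.Icc a b) x2 E (potential N Λ ω) → False) ≤
      (codes i (Finset.Icc a b) (LL s k) (32 * LL s k)).card / (N : ℝ) ^ LL s k := by
  classical
  set Z := Finset.Icc a b with hZdef
  set l := LL s k with hl
  have hlpos := LL_pos s k
  have hγ := hG.pos
  obtain ⟨t, ht⟩ := LL_dvd s k hs
  have h8 : 8 ≤ l := by omega
  apply code_count N l (by omega) _ (codes i Z l (32 * l))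
    (fun c ω => Function.Injective c ∧ (∀ j, c j ∈ Z) ∧
      ∃ β, |eig γ (potential N Λ ω) Z β - E| ≤ γ ^ (8 * l) ∧ ∀ j : Fin l,
        γ / 3 * (γ ^ l * γ ^ (2 * (j : ℕ))) ≤ bb γ (potential N Λ ω) Z {β} (c j) ∧
        bb γ (potential N Λ ω) Z {β} (c j) ≤ γ ^ l * γ ^ (2 * (j : ℕ)))
    (fun c => RR Λ c)
  · rintro ω ⟨⟨β, hβ⟩, hfar⟩
    set v := potential N Λ ω with hv
    obtain ⟨z, hz, hpos, hmax, hnorm⟩ := ef_argmax γ v Z β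
    set u := ef γ v Z β with hu
    have hLu : ∀ x ∈ Z, |Lop γ v E u x| ≤ γ ^ (8 * LL s k) * |u x| := by
      intro x hx
      rw [ef_eig γ v Z E β x hx, abs_mul]
      exact mul_le_mul_of_nonneg_right hβ (abs_nonneg _)
    have hzbad := max_bad hG s k hs Z E v u z hpos (ef_off γ v Z β) hmax hLu
    have hcubebad : ∀ x ∈ Z, bad γ κ s k Z x E v → x ∈ cube z (4 * LL s k) := by
      intro x hx hb
      by_contra hc
      exact hfar z hz x hx hc hzbad hb
    have hsum1 : |u z| ≤ 1 := by
      have h1 := ef_orth γ v Z β β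
      rw [if_pos rfl] at h1
      have h2 : u z * u z ≤ 1 := by
        rw [← h1]
        exact Finset.single_le_sum (f := fun x => u x * u x)
          (fun x _ => mul_self_nonneg _) hz
      rw [← abs_mul_abs_self] at h2
      nlinarith [abs_nonneg (u z)]
    have hdec := decay hG s k t hs ht Z E v u z |u z| hpos.le hcubebad (ef_off γ v Z β) hmax hLu 28
    obtain ⟨σ, hroom⟩ := room a b i (32 * l) (by push_cast; linarith) z
    have hT0 : γ ^ l ≤ bb γ v Z {β} z := by
      rw [bb_single]
      have h0 : 0 ≤ γ ^ l := by positivity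
      by_contra hc
      push Not at hc
      have : |u z| ^ 2 < (γ ^ l) ^ 2 := pow_lt_pow_left₀ hc (abs_nonneg _) (by norm_num)
      have hcp : (0 : ℝ) < Z.card := by
        exact_mod_cast Finset.card_pos.2 ⟨z, hz⟩
      nlinarith [mul_lt_mul_of_pos_left this hcp]
    obtain ⟨y, hy, hinj, hrec⟩ := records hγ hG.γd hG.γ3 i σ (bb γ v Z {β})
      (fun x => nn_nonneg _ _) Z (bb_off γ v Z _) l (32 * l) (γ ^ l) (by positivity)
      (by
        intro x hx
        apply chain_bb hγ v Z {β} i σ x hx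
        intro β' _
        exact eig_loc hG v Z (fun x _ => pot_range Λ hN ω x) β' _ hx)
      z hz hT0 hroom (by
        intro y hy hd j hj
        rw [bb_single]
        have h1 := hdec y (disp_not_cube hd (by omega))
        refine lt_of_le_of_lt h1 ?_
        have h2 : γ ^ (t * 28) * |u z| ≤ γ ^ (t * 28) * 1 :=
          mul_le_mul_of_nonneg_left hsum1 (by positivity)
        refine lt_of_le_of_lt h2 ?_
        rw [mul_one, ← pow_add]
        exact pow_lt_pow_right_of_lt_one₀ hγ hG.lt1 (by omega))
    exact ⟨y, hy, hinj, fun j => (hrec j).1, β, hβ, fun j => ⟨(hrec j).2.1, (hrec j).2.2.le⟩⟩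
  · rintro c hc ω ⟨hinj, hcZ, -⟩
    exact card_RR Λ c hinj (fun j => hZ (hcZ j))
  · rintro c hc ω ω' ⟨hinj, hcZ, β, hβ, hb⟩ ⟨-, -, β', hβ', hb'⟩ hagree
    by_contra hne
    obtain ⟨x0, hx0⟩ := Function.ne_iff.1 hne
    have hx0R : x0 ∈ RR Λ c := by
      by_contra h; exact hx0 (hagree x0 h)
    rw [mem_RR] at hx0R
    obtain ⟨j0, hj0⟩ := hx0R
    have hN0 : (2 : ℝ) ≤ N := by exact_mod_cast hN
    obtain ⟨T, x, hx, hT, hTpos, hmain, -⟩ := first_diff hγ hG.γ4 (potential N Λ ω)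
      (potential N Λ ω') Z {β} {β'} E E (γ ^ (8 * l)) (1 / (N : ℝ)) (γ ^ l) (by positivity)
      (by positivity) (by positivity) (by simpa using hβ) (by simpa using hβ') l c hinj hcZ hb hb'
      (by
        intro x hx hxc
        apply pot_congr
        intro hxΛ
        apply hagree
        rw [mem_RR]
        rintro ⟨j, hj⟩
        exact hxc j hj)
      (fun x _ => pot_diff Λ hN ω ω' x) (fun x _ => pot_sep Λ hN ω ω' x)
      ⟨x0, by rw [← hj0]; exact hcZ j0, pot_inj Λ hN ω ω' x0 hx0⟩
    rw [sub_self, abs_zero] at hmain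
    have hθ : γ ^ (8 * l) ≤ γ ^ 4 * T ^ 2 := by
      have h1 : (γ ^ l * γ ^ (2 * l)) ^ 2 ≤ T ^ 2 := pow_le_pow_left₀ (by positivity) hT 2
      have h2 : γ ^ (8 * l) ≤ γ ^ 4 * (γ ^ l * γ ^ (2 * l)) ^ 2 := by
        rw [← pow_add, ← pow_mul, ← pow_add]
        exact hG.powle (by omega)
      refine h2.trans (mul_le_mul_of_nonneg_left h1 (by positivity))
    have hT2 : 0 < γ ^ 2 * T ^ 2 := by positivity
    have h3 : (1 / (N : ℝ)) * (γ ^ 2 / 9 * T ^ 2) ≤ 4 * γ ^ 2 * (γ ^ 2 * T ^ 2) := by nlinarith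
    have h4 : (γ ^ 2 * T ^ 2) * (1 / (9 * (N : ℝ))) ≤ (γ ^ 2 * T ^ 2) * (4 * γ ^ 2) := by
      calc _ = (1 / (N : ℝ)) * (γ ^ 2 / 9 * T ^ 2) := by field_simp
        _ ≤ _ := h3
        _ = _ := by ring
    have h5 := le_of_mul_le_mul_left h4 hT2
    rw [div_le_iff₀ (by positivity)] at h5
    have := hG.small
    nlinarith

end MLS
namespace MLS

/-- standing assumptions on the integer parameters -/
structure HP (d s q N : ℕ) : Prop where
  hd : 1 ≤ d
  hs : 24 ≤ s
  hq : 12 * d ≤ q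
  hpow : ∀ n, 2 ^ s ≤ n → n ^ (2 * q + 6 * d) ≤ 2 ^ n
  hN1 : (3 * 2 ^ s) ^ d * (2 ^ s) ^ q ≤ N
  hN2 : 2 ^ 8 * (4 * d) ^ 40 ≤ N

/-- the full set of assumptions -/
structure HA (d s q N : ℕ) (γ κ : ℝ) : Prop where
  hG : HG d γ κ
  hP : HP d s q N
  hκ : 4 * N * κ ≤ 1
  hNγ : 100 * N * γ ≤ 1

lemma HP.N2 {d s q N : ℕ} (h : HP d s q N) : 2 ≤ N := by
  have := h.hN2
  have : 1 ≤ (4 * d) ^ 40 := Nat.one_le_pow _ _ (by have := h.hd; omega)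
  omega

lemma LL_ge (s k : ℕ) : 2 ^ (s + 12 * k) ≤ LL s k := by
  induction k with
  | zero => simp [LL]
  | succ k ih =>
    rw [LL_succ]
    calc 2 ^ (s + 12 * (k + 1)) = 2 ^ 12 * 2 ^ (s + 12 * k) := by rw [← pow_add]; congr 1; ring
      _ ≤ _ := Nat.mul_le_mul (Nat.pow_le_pow_right (by norm_num) (by omega)) ih

lemma LL_ge0 (s k : ℕ) : 2 ^ s ≤ LL s k :=
  (Nat.pow_le_pow_right (by norm_num) (by omega)).trans (LL_ge s k)

lemma gsq_le (s k : ℕ) (hs : 24 ≤ s) : (2 ^ (12 + k)) ^ 2 ≤ LL s k := by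
  refine le_trans ?_ (LL_ge s k)
  rw [← pow_mul]
  exact Nat.pow_le_pow_right (by norm_num) (by omega)

lemma LL_sq (s k : ℕ) (hs : 24 ≤ s) : (LL s (k + 1)) ^ 2 ≤ (LL s k) ^ 3 := by
  rw [LL_succ, mul_pow, pow_succ (LL s k) 2, mul_comm]
  exact Nat.mul_le_mul_left _ (gsq_le s k hs)

/-- single site estimate -/
lemma site_prob {d s q N : ℕ} {γ κ : ℝ} (h : HA d s q N γ κ) (Λ : Finset (Site d)) (y : Site d)
    (hy : y ∈ Λ) (E : ℝ) :
    prob (fun ω : Λ → Fin N => |2 * d * γ + potential N Λ ω y - E| ≤ κ) ≤ 1 / (N : ℝ) := by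
  have hN := h.hP.N2
  have := code_count N 1 (by omega) (fun ω : Λ → Fin N => |2 * d * γ + potential N Λ ω y - E| ≤ κ)
    ({()} : Finset Unit) (fun _ ω => |2 * d * γ + potential N Λ ω y - E| ≤ κ)
    (fun _ => {(⟨y, hy⟩ : Λ)}) (fun ω hω => ⟨(), by simp, hω⟩) (fun _ _ _ _ => by simp)
    (by
      intro _ _ ω ω' h1 h2 hag
      funext x
      by_cases hx : x = ⟨y, hy⟩
      · by_contra hne
        subst hx
        have h3 := pot_sep Λ hN ω ω' y (pot_inj Λ hN ω ω' ⟨y, hy⟩ hne)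
        have h4 : |potential N Λ ω y - potential N Λ ω' y| ≤ 2 * κ := by
          rw [abs_le] at h1 h2 ⊢
          constructor <;> linarith [h1.1, h1.2, h2.1, h2.2]
        have h5 := h3.trans h4
        have hN0 : (2 : ℝ) ≤ N := by exact_mod_cast hN
        rw [div_le_iff₀ (by linarith)] at h5
        nlinarith [h.hκ]
      · exact hag x (by simpa using hx))
  simpa using this

/-- intersection of a rectangle with a cube -/
lemma rect_inter {d : ℕ} (a b y : Site d) (r : ℕ) (hy : y ∈ Finset.Icc a b) (i : Fin d)
    (hside : (r : ℤ) ≤ b i - a i) :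
    ∃ a' b' : Site d, Finset.Icc a b ∩ cube y r = Finset.Icc a' b' ∧ (r : ℤ) ≤ b' i - a' i := by
  have : cube y r = Finset.Icc (fun i => y i - r) (fun i => y i + r) := by
    ext z
    rw [mem_cube, Finset.mem_Icc, Pi.le_def, Pi.le_def, ← forall_and]
    apply forall_congr'
    intro i
    rw [abs_le]
    constructor <;> rintro ⟨h1, h2⟩ <;> constructor <;> linarith
  refine ⟨a ⊔ (fun i => y i - r), b ⊓ (fun i => y i + r), ?_, ?_⟩
  · rw [this]
    ext z
    simp only [Finset.mem_inter, Finset.mem_Icc, sup_le_iff, le_inf_iff]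
    tauto
  · rw [Finset.mem_Icc, Pi.le_def, Pi.le_def] at hy
    have h1 := hy.1 i
    have h2 := hy.2 i
    simp only [Pi.sup_apply, Pi.inf_apply]
    omega

/-- independence of far bad sites -/
lemma pair_bad {d : ℕ} {γ κ : ℝ} (s k N : ℕ) (Λ X : Finset (Site d))
    (x1 x2 : Site d) (hfar : far s k x1 x2) (E : ℝ) :
    prob (fun ω : Λ → Fin N => bad γ κ s k X x1 E (potential N Λ ω) ∧
      bad γ κ s k X x2 E (potential N Λ ω)) ≤
    prob (fun ω : Λ → Fin N => bad γ κ s k X x1 E (potential N Λ ω)) *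
      prob (fun ω : Λ → Fin N => bad γ κ s k X x2 E (potential N Λ ω)) := by
  classical
  apply prob_indep (Finset.univ.filter fun x : Λ => (x : Site d) ∈ cube x1 (2 * LL s k))
  · intro ω ω' h
    apply bad_congr
    intro y hy
    apply pot_congr
    intro hyΛ
    apply h
    simp [(Finset.mem_inter.1 hy).2]
  · intro ω ω' h
    apply bad_congr
    intro y hy
    apply pot_congr
    intro hyΛ
    apply h
    simp only [Finset.mem_filter, Finset.mem_univ, true_and]
    intro hc
    apply hfar
    have := cube_trans hc (cube_comm.1 (Finset.mem_inter.1 hy).2)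
    have e : 2 * LL s k + 2 * LL s k = 4 * LL s k := by ring
    rwa [e] at this

/-- far bad pairs in a set -/
lemma two_bad {d : ℕ} {γ κ : ℝ} (s k N : ℕ) (Λ X Y : Finset (Site d)) (E p n : ℝ) (hp0 : 0 ≤ p)
    (hn0 : 0 ≤ n)
    (hp : ∀ x, prob (fun ω : Λ → Fin N => bad γ κ s k X x E (potential N Λ ω)) ≤ p)
    (hY : (Y.card : ℝ) ≤ n) :
    prob (fun ω : Λ → Fin N => ∃ x1 ∈ Y, ∃ x2 ∈ Y, far s k x1 x2 ∧
      bad γ κ s k X x1 E (potential N Λ ω) ∧ bad γ κ s k X x2 E (potential N Λ ω)) ≤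
    n ^ 2 * p ^ 2 := by
  have hcard0 : (0 : ℝ) ≤ Y.card := by positivity
  refine (prob_exists_le Y _ (n * p ^ 2) ?_).trans ?_
  · intro x1 _
    refine (prob_exists_le Y _ (p ^ 2) ?_).trans ?_
    · intro x2 _
      by_cases hf : far s k x1 x2
      · refine (prob_mono (fun ω h => h.2)).trans ((pair_bad s k N Λ X x1 x2 hf E).trans ?_)
        rw [pow_two]
        exact mul_le_mul (hp x1) (hp x2) (prob_nonneg _) hp0
      · have : prob (fun ω : Λ → Fin N => far s k x1 x2 ∧
            bad γ κ s k X x1 E (potential N Λ ω) ∧ bad γ κ s k X x2 E (potential N Λ ω)) = 0 := by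
          unfold prob; simp [hf]
        rw [this]; positivity
    · exact mul_le_mul_of_nonneg_right hY (by positivity)
  · calc _ ≤ n * (n * p ^ 2) := mul_le_mul_of_nonneg_right hY (by positivity)
      _ = _ := by ring

lemma cube_card_le {d : ℕ} (X : Finset (Site d)) (x : Site d) (l : ℕ) (hl : 1 ≤ l) :
    (X ∩ cube x l).card ≤ (3 * l) ^ d := by
  refine (Finset.card_le_card Finset.inter_subset_right).trans ?_
  rw [card_cube]
  exact Nat.pow_le_pow_left (by omega) d

/-- the Wegner bound, numerically -/
lemma weg_num {d s q N : ℕ} (h : HP d s q N) (k c : ℕ) (hc : c ≤ (257 * LL s k) ^ d) (i : Fin d)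
    (Z : Finset (Site d)) (hZ : Z.card = c) :
    ((codes i Z (LL s k) (32 * LL s k)).card : ℝ) / (N : ℝ) ^ LL s k ≤
      4 * (257 * (LL s k : ℝ)) ^ d / 2 ^ LL s k := by
  set l := LL s k
  have h1 := card_codes i Z l (32 * l)
  have hd := h.hd
  have hN := h.hN2
  have hN3 : 2 * (4 * d) ^ 32 ≤ N := by
    refine le_trans ?_ hN
    exact Nat.mul_le_mul (by norm_num) (Nat.pow_le_pow_right (by omega) (by norm_num))
  rw [div_le_div_iff₀ (by have := h.N2; positivity) (by positivity)]
  have key : (codes i Z l (32 * l)).card * 2 ^ l ≤ 4 * (257 * l) ^ d * N ^ l := by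
    calc _ ≤ ((257 * l) ^ d * (2 * ((2 * d) ^ (32 * l) * 2 ^ (32 * l + 1)))) * 2 ^ l := by
          apply Nat.mul_le_mul_right
          refine h1.trans (Nat.mul_le_mul_right _ ?_)
          rw [hZ]; exact hc
      _ = 4 * (257 * l) ^ d * (2 * (4 * d) ^ 32) ^ l := by
          have e : (2 * (4 * d) ^ 32) ^ l = 2 ^ l * (2 ^ (32 * l) * (2 * d) ^ (32 * l)) := by
            rw [mul_pow 2 ((4 * d) ^ 32) l, ← pow_mul (4 * d), ← mul_pow 2 (2 * d) (32 * l)]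
            congr 2; ring
          rw [e, pow_succ]
          ring
      _ ≤ _ := Nat.mul_le_mul_left _ (Nat.pow_le_pow_left hN3 l)
  exact_mod_cast key

lemma num1 {d s q N : ℕ} (h : HP d s q N) (k : ℕ) :
    4 * (3 * LL s (k + 1)) ^ (3 * d) * LL s (k + 1) ^ q ≤ (LL s k) ^ (2 * q) := by
  set R := LL s (k + 1)
  set l := LL s k
  have hs := h.hs
  have hd := h.hd
  have hq := h.hq
  have hR : 108 ≤ R := by
    refine le_trans ?_ (LL_ge0 s (k + 1))
    calc 108 ≤ 2 ^ 24 := by norm_num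
      _ ≤ _ := Nat.pow_le_pow_right (by norm_num) hs
  have hl1 : 1 ≤ l := LL_pos s k
  have h1 : 4 * (3 * R) ^ (3 * d) ≤ R ^ (4 * d) := by
    calc 4 * (3 * R) ^ (3 * d) ≤ 4 ^ d * (3 * R) ^ (3 * d) := by
          apply Nat.mul_le_mul_right
          calc 4 = 4 ^ 1 := by norm_num
            _ ≤ 4 ^ d := Nat.pow_le_pow_right (by norm_num) hd
      _ = (108 * R ^ 3) ^ d := by
          rw [pow_mul (3 * R), ← mul_pow 4]; congr 1; ring
      _ ≤ (R * R ^ 3) ^ d := Nat.pow_le_pow_left (Nat.mul_le_mul_right _ hR) d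
      _ = R ^ (4 * d) := by rw [pow_mul]; congr 1; ring
  have h2 : R ^ (4 * d) * R ^ q ≤ l ^ (2 * q) := by
    have h3 : (R ^ (4 * d) * R ^ q) ^ 2 ≤ (l ^ (2 * q)) ^ 2 := by
      calc (R ^ (4 * d) * R ^ q) ^ 2 = (R ^ 2) ^ (4 * d + q) := by rw [← pow_add]; ring
        _ ≤ (l ^ 3) ^ (4 * d + q) := Nat.pow_le_pow_left (LL_sq s k hs) _
        _ = l ^ (3 * (4 * d + q)) := by rw [← pow_mul]
        _ ≤ l ^ (2 * q * 2) := Nat.pow_le_pow_right hl1 (by omega)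
        _ = _ := by rw [pow_mul]
    exact (Nat.pow_le_pow_iff_left (by norm_num)).1 h3
  exact (Nat.mul_le_mul_right _ h1).trans h2

lemma num2 {d s q N : ℕ} (h : HP d s q N) (k : ℕ) :
    8 * (3 * LL s (k + 1)) ^ d * (257 * LL s k) ^ d * LL s (k + 1) ^ q ≤ 2 ^ (LL s k) := by
  set R := LL s (k + 1) with hR'
  set l := LL s k with hl'
  have hs := h.hs
  have hd := h.hd
  have hR : 24 ≤ R := by
    refine le_trans ?_ (LL_ge0 s (k + 1))
    calc 24 ≤ 2 ^ 24 := by norm_num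
      _ ≤ _ := Nat.pow_le_pow_right (by norm_num) hs
  have hl1 : 1 ≤ l := LL_pos s k
  have hRl : 257 * l ≤ R := by
    rw [hR', LL_succ]
    exact Nat.mul_le_mul_right _ (by have := g_ge k; omega)
  have hRl2 : R ≤ l ^ 2 := by
    have h1 := LL_sq s k hs
    rw [← hR', ← hl'] at h1
    have h2 : R ^ 2 ≤ (l ^ 2) ^ 2 := by
      refine h1.trans ?_
      rw [← pow_mul]
      exact Nat.pow_le_pow_right hl1 (by norm_num)
    exact (Nat.pow_le_pow_iff_left (by norm_num)).1 h2
  refine le_trans ?_ (h.hpow l (LL_ge0 s k))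
  have h1 : 8 * (3 * R) ^ d * (257 * l) ^ d ≤ R ^ (3 * d) := by
    calc _ ≤ 8 ^ d * (3 * R) ^ d * R ^ d := by
          apply Nat.mul_le_mul _ (Nat.pow_le_pow_left hRl d)
          apply Nat.mul_le_mul_right
          calc 8 = 8 ^ 1 := by norm_num
            _ ≤ 8 ^ d := Nat.pow_le_pow_right (by norm_num) hd
      _ = (24 * R ^ 2) ^ d := by rw [← mul_pow, ← mul_pow]; congr 1; ring
      _ ≤ (R * R ^ 2) ^ d := Nat.pow_le_pow_left (Nat.mul_le_mul_right _ hR) d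
      _ = _ := by rw [pow_mul]; congr 1; ring
  calc _ ≤ R ^ (3 * d) * R ^ q := Nat.mul_le_mul_right _ h1
    _ = R ^ (3 * d + q) := by rw [pow_add]
    _ ≤ (l ^ 2) ^ (3 * d + q) := Nat.pow_le_pow_left hRl2 _
    _ = l ^ (2 * q + 6 * d) := by rw [← pow_mul]; congr 1; ring

set_option maxHeartbeats 1000000 in
/-- the multiscale induction -/
theorem prob_bad {d s q N : ℕ} {γ κ : ℝ} (h : HA d s q N γ κ) (Λ : Finset (Site d)) (i : Fin d)
    (k : ℕ) : ∀ (a b : Site d), Finset.Icc a b ⊆ Λ → (128 * LL s k : ℤ) ≤ b i - a i →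
    ∀ (x : Site d) (E : ℝ),
    prob (fun ω : Λ → Fin N => bad γ κ s k (Finset.Icc a b) x E (potential N Λ ω)) ≤
      ((LL s k : ℝ) ^ q)⁻¹ := by
  have hN2 := h.hP.N2
  have hs := h.hP.hs
  induction k with
  | zero =>
    intro a b hab _ x E
    have h1 := prob_exists_le (Ω := Λ → Fin N) (Finset.Icc a b ∩ cube x (LL s 0))
      (fun y ω => |2 * d * γ + potential N Λ ω y - E| ≤ κ) (1 / (N : ℝ))
      (fun y hy => site_prob h Λ y (hab (Finset.mem_inter.1 hy).1) E)
    refine h1.trans ?_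
    have h2 := cube_card_le (Finset.Icc a b) x (LL s 0) (LL_pos s 0)
    have hN0 : (0 : ℝ) < N := by positivity
    have hLp : (0 : ℝ) < LL s 0 := by exact_mod_cast LL_pos s 0
    rw [mul_one_div, inv_eq_one_div, div_le_div_iff₀ hN0 (by positivity), one_mul]
    have h3 : (Finset.Icc a b ∩ cube x (LL s 0)).card * (LL s 0) ^ q ≤ N :=
      (Nat.mul_le_mul_right _ h2).trans h.hP.hN1
    exact_mod_cast h3
  | succ k ih =>
    intro a b hab hside x E
    set R := LL s (k + 1) with hR
    set l := LL s k with hl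
    set X := Finset.Icc a b with hX
    have hlpos : 1 ≤ l := LL_pos s k
    have hRpos : 1 ≤ R := LL_pos s (k + 1)
    have hRl : 4096 * l ≤ R := by
      rw [hR, LL_succ]; exact Nat.mul_le_mul_right _ (g_ge k)
    have hsideX : (128 * l : ℤ) ≤ b i - a i := by
      have : (l : ℤ) ≤ R := by exact_mod_cast (by omega : l ≤ R)
      linarith
    set p : ℝ := ((l : ℝ) ^ q)⁻¹ with hp
    have hp0 : 0 ≤ p := by positivity
    have hcardR : ((X ∩ cube x R).card : ℝ) ≤ (3 * (R : ℝ)) ^ d := by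
      exact_mod_cast cube_card_le X x R hRpos
    set W : ℝ := 4 * (257 * (l : ℝ)) ^ d / 2 ^ l with hW
    have hA := two_bad (γ := γ) (κ := κ) s k N Λ X (X ∩ cube x R) E p ((3 * (R : ℝ)) ^ d) hp0 (by positivity)
      (fun x' => ih a b hab hsideX x' E) hcardR
    have hB : ∀ y ∈ X ∩ cube x R, prob (fun ω : Λ → Fin N =>
        (∃ x1 ∈ X ∩ cube y (128 * l), ∃ x2 ∈ X ∩ cube y (128 * l),
        far s k x1 x2 ∧ bad γ κ s k (X ∩ cube y (128 * l)) x1 E (potential N Λ ω) ∧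
          bad γ κ s k (X ∩ cube y (128 * l)) x2 E (potential N Λ ω)) ∨
        ∃ β : ↥(X ∩ cube y (128 * l)),
        |eig γ (potential N Λ ω) (X ∩ cube y (128 * l)) β - E| ≤ γ ^ (8 * l)) ≤
        ((3 * (R : ℝ)) ^ d) ^ 2 * p ^ 2 + W := by
      intro y hy
      have hcZ : (X ∩ cube y (128 * l)).card ≤ (257 * l) ^ d := by
        refine (Finset.card_le_card Finset.inter_subset_right).trans ?_
        rw [card_cube]
        exact Nat.pow_le_pow_left (by omega) d
      obtain ⟨a', b', hZ, hsideZ⟩ := rect_inter a b y (128 * l) (Finset.mem_inter.1 hy).1 i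
        (by push_cast; exact hsideX)
      have hZsub : Finset.Icc a' b' ⊆ Λ := by
        rw [← hZ]; exact Finset.inter_subset_left.trans hab
      rw [← hX] at hZ
      rw [hZ] at hcZ ⊢
      push_cast at hsideZ
      have hb1 := two_bad (γ := γ) (κ := κ) s k N Λ (Finset.Icc a' b') (Finset.Icc a' b') E p ((3 * (R : ℝ)) ^ d) hp0
        (by positivity) (fun x' => ih a' b' hZsub hsideZ x' E) (by
          have : (Finset.Icc a' b').card ≤ (3 * R) ^ d :=
            hcZ.trans (Nat.pow_le_pow_left (by omega) d)
          exact_mod_cast this)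
      have hcardγ : ((Finset.Icc a' b').card : ℝ) * (γ ^ l) ^ 2 ≤ 1 := by
        have hv := h.hG.vol l hlpos
        have hγ := h.hG.pos
        have h1 : ((Finset.Icc a' b').card : ℝ) ≤ (((257 * l : ℕ) : ℝ)) ^ d := by exact_mod_cast hcZ
        have h2 : γ ^ l ≤ 1 := pow_le_one₀ hγ.le h.hG.lt1.le
        have h3 : 0 ≤ γ ^ l := by positivity
        calc _ = (((Finset.Icc a' b').card : ℝ) * γ ^ l) * γ ^ l := by ring
          _ ≤ 1 * 1 := by
            apply mul_le_mul _ h2 h3 (by norm_num)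
            exact (mul_le_mul_of_nonneg_right h1 h3).trans hv
          _ = 1 := by norm_num
      have hb2 := (wegner h.hG s k (by omega) N hN2 h.hNγ Λ a' b' hZsub i (by linarith) hcardγ E).trans
        (weg_num h.hP k _ hcZ i _ rfl)
      refine le_trans (prob_mono ?_) ((prob_or _ _).trans (add_le_add hb1 hb2))
      intro ω hω
      by_cases hf : ∃ x1 ∈ Finset.Icc a' b', ∃ x2 ∈ Finset.Icc a' b',
        far s k x1 x2 ∧ bad γ κ s k (Finset.Icc a' b') x1 E (potential N Λ ω) ∧
          bad γ κ s k (Finset.Icc a' b') x2 E (potential N Λ ω)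
      · exact Or.inl hf
      · right
        refine ⟨hω.resolve_left hf, ?_⟩
        intro x1 h1 x2 h2 hfar hb1 hb2
        exact hf ⟨x1, h1, x2, h2, hfar, hb1, hb2⟩
    have hB' := prob_exists_le (X ∩ cube x R) _ _ hB
    have hfin := (prob_or _ _).trans (add_le_add hA hB')
    refine le_trans hfin ?_
    have hW0 : 0 ≤ W := by positivity
    have hn1 : 4 * (3 * (R : ℝ)) ^ (3 * d) * (R : ℝ) ^ q ≤ (l : ℝ) ^ (2 * q) := by
      exact_mod_cast num1 h.hP k
    have hn2 : 8 * (3 * (R : ℝ)) ^ d * (257 * (l : ℝ)) ^ d * (R : ℝ) ^ q ≤ 2 ^ l := by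
      exact_mod_cast num2 h.hP k
    have hRr : (1 : ℝ) ≤ R := by exact_mod_cast hRpos
    have hlr : (0 : ℝ) < l := by exact_mod_cast hlpos
    have hRq : (0 : ℝ) < (R : ℝ) ^ q := by positivity
    have hp2 : p ^ 2 = ((l : ℝ) ^ (2 * q))⁻¹ := by
      rw [hp, inv_pow, ← pow_mul, mul_comm]
    have h3d : (1 : ℝ) ≤ (3 * (R : ℝ)) ^ d := one_le_pow₀ (by linarith)
    have e3 : (3 * (R : ℝ)) ^ (3 * d) = ((3 * (R : ℝ)) ^ d) ^ 3 := by
      rw [← pow_mul, mul_comm d 3]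
    set n := (3 * (R : ℝ)) ^ d with hn
    have s1 : 4 * n ^ 3 * p ^ 2 ≤ ((R : ℝ) ^ q)⁻¹ := by
      rw [hp2, ← div_eq_mul_inv, inv_eq_one_div, div_le_div_iff₀ (by positivity) hRq, one_mul, ← e3]
      exact hn1
    have s2 : 2 * (n * W) ≤ ((R : ℝ) ^ q)⁻¹ := by
      rw [inv_eq_one_div, le_div_iff₀ hRq, hW]
      rw [show 2 * (n * (4 * (257 * (l : ℝ)) ^ d / 2 ^ l)) * (R : ℝ) ^ q =
        (8 * n * (257 * (l : ℝ)) ^ d * (R : ℝ) ^ q) / 2 ^ l by ring]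
      rw [div_le_one (by positivity)]
      exact hn2
    have s3 : n ^ 2 * p ^ 2 ≤ n ^ 3 * p ^ 2 :=
      mul_le_mul_of_nonneg_right (pow_le_pow_right₀ h3d (by norm_num)) (by positivity)
    have s4 : ((X ∩ cube x R).card : ℝ) * (n ^ 2 * p ^ 2 + W) ≤ n * (n ^ 2 * p ^ 2 + W) :=
      mul_le_mul_of_nonneg_right hcardR (by positivity)
    nlinarith

end MLS
namespace MLS

lemma eig_singleton {d : ℕ} (γ : ℝ) (v : Site d → ℝ) (X : Finset (Site d)) (y : Site d)
    (hX : ∀ x ∈ X, x = y) (β : X) : eig γ v X β = 2 * d * γ + v y := by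
  obtain ⟨z, hz, hpos, -, -⟩ := ef_argmax γ v X β
  have hzy := hX z hz
  have h := ef_eig γ v X 0 β z hz
  have hnb : nb (ef γ v X β) z = 0 := by
    unfold nb
    apply Finset.sum_eq_zero
    intro i _
    have h1 : z + ev i ∉ X := by
      intro hc
      have h2 := hX _ hc
      rw [hzy] at h2
      have h3 := congrFun h2 i
      simp [ev] at h3
    have h1' : z - ev i ∉ X := by
      intro hc
      have h2 := hX _ hc
      rw [hzy] at h2
      have h3 := congrFun h2 i
      simp [ev] at h3
    rw [ef_off γ v X β _ h1, ef_off γ v X β _ h1', add_zero]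
  unfold Lop at h
  rw [hnb, mul_zero, sub_zero, sub_zero, sub_zero] at h
  have hne : ef γ v X β z ≠ 0 := abs_pos.1 hpos
  rw [← hzy]
  exact (mul_right_cancel₀ hne h).symm

/-- thresholds -/
def etas (γ κ : ℝ) (s k : ℕ) : Finset ℝ := insert κ ((Finset.range k).image fun j => γ ^ (8 * LL s j))

lemma etas_card (γ κ : ℝ) (s k : ℕ) : (etas γ κ s k).card ≤ k + 1 := by
  unfold etas
  refine (Finset.card_insert_le _ _).trans ?_
  have := Finset.card_image_le (s := Finset.range k) (f := fun j => γ ^ (8 * LL s j))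
  rw [Finset.card_range] at this
  omega

lemma etas_mono (γ κ : ℝ) (s k : ℕ) : etas γ κ s k ⊆ etas γ κ s (k + 1) := by
  unfold etas
  apply Finset.insert_subset_insert
  apply Finset.image_subset_image
  intro j hj
  rw [Finset.mem_range] at hj ⊢; omega

lemma etas_mem (γ κ : ℝ) (s k : ℕ) : γ ^ (8 * LL s k) ∈ etas γ κ s (k + 1) := by
  unfold etas
  apply Finset.mem_insert_of_mem
  rw [Finset.mem_image]
  exact ⟨k, by simp, rfl⟩

/-- intersection of a rectangle with a cube -/
lemma rect_inter_cube {d : ℕ} (a b y : Site d) (r : ℕ) :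
    ∃ a' b' : Site d, Finset.Icc a b ∩ cube y r = Finset.Icc a' b' := by
  have : cube y r = Finset.Icc (fun i => y i - r) (fun i => y i + r) := by
    ext z
    rw [mem_cube, Finset.mem_Icc, Pi.le_def, Pi.le_def, ← forall_and]
    apply forall_congr'
    intro i
    rw [abs_le]
    constructor <;> rintro ⟨h1, h2⟩ <;> constructor <;> linarith
  refine ⟨a ⊔ (fun i => y i - r), b ⊓ (fun i => y i + r), ?_⟩
  rw [this]
  ext z
  simp only [Finset.mem_inter, Finset.mem_Icc, sup_le_iff, le_inf_iff]
  tauto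

/-- badness is a monotone formula in spectral atoms -/
lemma bad_atoms {d : ℕ} (γ κ : ℝ) (s k : ℕ) : ∀ (a b x : Site d) (E E' : ℝ) (v : Site d → ℝ),
    (∀ c e : Site d, Finset.Icc c e ⊆ Finset.Icc a b ∩ cube x (2 * LL s k) → ∀ η ∈ etas γ κ s k,
      ∀ β, |eig γ v (Finset.Icc c e) β - E| ≤ η → |eig γ v (Finset.Icc c e) β - E'| ≤ η) →
    bad γ κ s k (Finset.Icc a b) x E v → bad γ κ s k (Finset.Icc a b) x E' v := by
  induction k with
  | zero =>
    rintro a b x E E' v h ⟨y, hy, hb⟩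
    refine ⟨y, hy, ?_⟩
    have hyy : y ∈ Finset.Icc y y := by simp
    have he := eig_singleton γ v (Finset.Icc y y) y (by intro z hz; simpa using hz) ⟨y, hyy⟩
    rw [← he]
    apply h y y _ κ (by simp [etas])
    · rw [he]; exact hb
    · intro z hz
      have : z = y := by simpa using hz
      rw [this]
      rw [Finset.mem_inter] at hy ⊢
      exact ⟨hy.1, cube_mono (by omega) hy.2⟩
  | succ k ih =>
    intro a b x E E' v h hb
    have hg := g_ge k
    have hL : 4096 * LL s k ≤ LL s (k + 1) := by
      rw [LL_succ]; exact Nat.mul_le_mul_right _ hg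
    rcases hb with ⟨x1, h1, x2, h2, hf, hb1, hb2⟩ | ⟨y, hy, hb⟩
    · have key : ∀ x' ∈ Finset.Icc a b ∩ cube x (LL s (k + 1)),
          Finset.Icc a b ∩ cube x' (2 * LL s k) ⊆ Finset.Icc a b ∩ cube x (2 * LL s (k + 1)) := by
        intro x' hx' y hy
        rw [Finset.mem_inter] at hx' hy ⊢
        exact ⟨hy.1, cube_mono (by omega) (cube_trans hx'.2 hy.2)⟩
      refine Or.inl ⟨x1, h1, x2, h2, hf, ih a b x1 E E' v ?_ hb1, ih a b x2 E E' v ?_ hb2⟩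
      · intro c e hce η hη β
        exact h c e (hce.trans (key x1 h1)) η (etas_mono _ _ _ _ hη) β
      · intro c e hce η hη β
        exact h c e (hce.trans (key x2 h2)) η (etas_mono _ _ _ _ hη) β
    · right
      refine ⟨y, hy, ?_⟩
      have key : Finset.Icc a b ∩ cube y (128 * LL s k) ⊆
          Finset.Icc a b ∩ cube x (2 * LL s (k + 1)) := by
        intro z hz
        rw [Finset.mem_inter] at hy hz ⊢
        exact ⟨hz.1, cube_mono (by omega) (cube_trans hy.2 hz.2)⟩
      obtain ⟨a', b', hZ⟩ := rect_inter_cube a b y (128 * LL s k)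
      rw [hZ] at hb key ⊢
      rcases hb with ⟨x1, h1, x2, h2, hf, hb1, hb2⟩ | ⟨β, hβ⟩
      · left
        refine ⟨x1, h1, x2, h2, hf, ih a' b' x1 E E' v ?_ hb1, ih a' b' x2 E E' v ?_ hb2⟩
        · intro c e hce η hη β
          exact h c e ((hce.trans Finset.inter_subset_left).trans key) η (etas_mono _ _ _ _ hη) β
        · intro c e hce η hη β
          exact h c e ((hce.trans Finset.inter_subset_left).trans key) η (etas_mono _ _ _ _ hη) β
      · right
        exact ⟨β, h a' b' key _ (etas_mem _ _ _ _) β hβ⟩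

/-- left endpoints of atoms -/
def ends {d : ℕ} (γ κ : ℝ) (s k : ℕ) (V : Finset (Site d)) (v : Site d → ℝ) : Finset ℝ :=
  insert 0 (((V ×ˢ V).filter fun p => Finset.Icc p.1 p.2 ⊆ V).biUnion fun p =>
    (Finset.univ : Finset ↥(Finset.Icc p.1 p.2)).biUnion fun β =>
      (etas γ κ s k).image fun η => eig γ v (Finset.Icc p.1 p.2) β - η)

lemma ends_congr {d : ℕ} (γ κ : ℝ) (s k : ℕ) (V : Finset (Site d)) (v v' : Site d → ℝ)
    (h : ∀ x ∈ V, v x = v' x) : ends γ κ s k V v = ends γ κ s k V v' := by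
  unfold ends
  refine congrArg (insert (0:ℝ)) (Finset.biUnion_congr rfl ?_)
  intro p hp
  have hp2 := (Finset.mem_filter.1 hp).2
  have he := eig_congr γ v (Finset.Icc p.1 p.2) (fun x hx => h x (hp2 hx))
  exact Finset.biUnion_congr rfl (fun β _ => by rw [he])

lemma ends_card {d : ℕ} (γ κ : ℝ) (s k : ℕ) (V : Finset (Site d)) (v : Site d → ℝ) :
    (ends γ κ s k V v).card ≤ V.card ^ 2 * (V.card * (k + 1)) + 1 := by
  unfold ends
  refine (Finset.card_insert_le _ _).trans (Nat.add_le_add_right ?_ 1)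
  refine (Finset.card_biUnion_le_card_mul _ _ (V.card * (k + 1)) ?_).trans ?_
  · intro p hp
    rw [Finset.mem_filter] at hp
    refine (Finset.card_biUnion_le_card_mul _ _ (k + 1) ?_).trans ?_
    · intro β _
      exact Finset.card_image_le.trans (etas_card γ κ s k)
    · apply Nat.mul_le_mul_right
      rw [Finset.card_univ, Fintype.card_coe]
      exact Finset.card_le_card hp.2
  · apply Nat.mul_le_mul_right
    refine (Finset.card_filter_le _ _).trans ?_
    rw [Finset.card_product, pow_two]

lemma ends_mem {d : ℕ} (γ κ : ℝ) (s k : ℕ) (V : Finset (Site d)) (v : Site d → ℝ) (c e : Site d)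
    (hce : Finset.Icc c e ⊆ V) (β : ↥(Finset.Icc c e)) (η : ℝ) (hη : η ∈ etas γ κ s k) :
    eig γ v (Finset.Icc c e) β - η ∈ ends γ κ s k V v := by
  unfold ends
  apply Finset.mem_insert_of_mem
  have hne : c ≤ e := by
    have := Finset.mem_Icc.1 β.2
    exact this.1.trans this.2
  rw [Finset.mem_biUnion]
  refine ⟨(c, e), ?_, ?_⟩
  · rw [Finset.mem_filter, Finset.mem_product]
    exact ⟨⟨hce (Finset.left_mem_Icc.2 hne), hce (Finset.right_mem_Icc.2 hne)⟩, hce⟩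
  · rw [Finset.mem_biUnion]
    exact ⟨β, Finset.mem_univ _, Finset.mem_image.2 ⟨η, hη, rfl⟩⟩

/-- reduction to finitely many energies -/
lemma energy_red {d : ℕ} (γ κ : ℝ) (s k : ℕ) (a b x1 x2 : Site d) (v : Site d → ℝ) (E : ℝ)
    (h1 : bad γ κ s k (Finset.Icc a b) x1 E v) (h2 : bad γ κ s k (Finset.Icc a b) x2 E v) :
    (∃ e ∈ ends γ κ s k (Finset.Icc a b ∩ cube x1 (2 * LL s k)) v,
      bad γ κ s k (Finset.Icc a b) x2 e v) ∨
    ∃ e ∈ ends γ κ s k (Finset.Icc a b ∩ cube x2 (2 * LL s k)) v,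
      bad γ κ s k (Finset.Icc a b) x1 e v := by
  classical
  set V1 := Finset.Icc a b ∩ cube x1 (2 * LL s k) with hV1
  set V2 := Finset.Icc a b ∩ cube x2 (2 * LL s k) with hV2
  set S := (ends γ κ s k V1 v ∪ ends γ κ s k V2 v).filter (fun t => ∃ c e : Site d,
    (Finset.Icc c e ⊆ V1 ∨ Finset.Icc c e ⊆ V2) ∧ ∃ η ∈ etas γ κ s k, ∃ β,
      t = eig γ v (Finset.Icc c e) β - η ∧ |eig γ v (Finset.Icc c e) β - E| ≤ η) with hS
  have hmem : ∀ c e : Site d, (Finset.Icc c e ⊆ V1 ∨ Finset.Icc c e ⊆ V2) → ∀ η ∈ etas γ κ s k,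
      ∀ β, |eig γ v (Finset.Icc c e) β - E| ≤ η → eig γ v (Finset.Icc c e) β - η ∈ S := by
    intro c e hce η hη β hβ
    rw [hS, Finset.mem_filter, Finset.mem_union]
    refine ⟨?_, c, e, hce, η, hη, β, rfl, hβ⟩
    rcases hce with h | h
    · exact Or.inl (ends_mem _ _ _ _ _ _ _ _ h β η hη)
    · exact Or.inr (ends_mem _ _ _ _ _ _ _ _ h β η hη)
  have key : ∃ E' ∈ ends γ κ s k V1 v ∪ ends γ κ s k V2 v, ∀ c e : Site d,
      (Finset.Icc c e ⊆ V1 ∨ Finset.Icc c e ⊆ V2) → ∀ η ∈ etas γ κ s k,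
      ∀ β, |eig γ v (Finset.Icc c e) β - E| ≤ η → |eig γ v (Finset.Icc c e) β - E'| ≤ η := by
    rcases S.eq_empty_or_nonempty with h0 | hne
    · refine ⟨0, ?_, ?_⟩
      · rw [Finset.mem_union]; left; unfold ends; simp
      · intro c e hce η hη β hβ
        have := hmem c e hce η hη β hβ
        rw [h0] at this
        simp at this
    · obtain ⟨E', hE', hmax⟩ := Finset.exists_max_image S id hne
      refine ⟨E', (Finset.mem_filter.1 hE').1, ?_⟩
      obtain ⟨c0, e0, -, η0, -, β0, ht, hb0⟩ := (Finset.mem_filter.1 hE').2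
      have hle : E' ≤ E := by
        rw [abs_le] at hb0; linarith [hb0.2]
      intro c e hce η hη β hβ
      have h3 := hmax _ (hmem c e hce η hη β hβ)
      simp only [id] at h3
      rw [abs_le] at hβ ⊢
      constructor <;> linarith [hβ.1, hβ.2]
  obtain ⟨E', hE', hat⟩ := key
  have hb1 := bad_atoms γ κ s k a b x1 E E' v (fun c e hce => hat c e (Or.inl hce)) h1
  have hb2 := bad_atoms γ κ s k a b x2 E E' v (fun c e hce => hat c e (Or.inr hce)) h2
  rw [Finset.mem_union] at hE'
  rcases hE' with h | h
  · exact Or.inl ⟨E', h, hb2⟩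
  · exact Or.inr ⟨E', h, hb1⟩

lemma k_le (s k : ℕ) (hs : 24 ≤ s) : k + 1 ≤ LL s k := by
  refine le_trans ?_ (LL_ge s k)
  have : k < 2 ^ k := Nat.lt_two_pow_self
  refine le_trans this ?_
  exact Nat.pow_le_pow_right (by norm_num) (by omega)

lemma ends_num {d : ℕ} (hd : 1 ≤ d) (γ κ : ℝ) (s k : ℕ) (hs : 24 ≤ s) (X : Finset (Site d)) (x : Site d)
    (v : Site d → ℝ) :
    2 * (ends γ κ s k (X ∩ cube x (2 * LL s k)) v).card ≤ LL s k ^ (9 * d) := by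
  have hL : 64 ≤ LL s k := by
    refine le_trans ?_ (LL_ge0 s k)
    calc 64 ≤ 2 ^ 24 := by norm_num
      _ ≤ _ := Nat.pow_le_pow_right (by norm_num) hs
  have hk := k_le s k hs
  have h1 := ends_card γ κ s k (X ∩ cube x (2 * LL s k)) v
  have hV : (X ∩ cube x (2 * LL s k)).card ≤ LL s k ^ (2 * d) := by
    refine (Finset.card_le_card Finset.inter_subset_right).trans ?_
    rw [card_cube, pow_mul]
    apply Nat.pow_le_pow_left
    nlinarith
  set V := (X ∩ cube x (2 * LL s k)).card
  set L := LL s k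
  have h2 : V ^ 2 * (V * (k + 1)) + 1 ≤ 2 * (L ^ (6 * d) * L) := by
    have e : V ^ 2 * (V * (k + 1)) = V ^ 3 * (k + 1) := by ring
    have h3 : V ^ 3 * (k + 1) ≤ L ^ (6 * d) * L := by
      apply Nat.mul_le_mul _ hk
      calc V ^ 3 ≤ (L ^ (2 * d)) ^ 3 := Nat.pow_le_pow_left hV 3
        _ = L ^ (6 * d) := by rw [← pow_mul]; congr 1; ring
    have h4 : 1 ≤ L ^ (6 * d) * L := Nat.mul_pos (Nat.pow_pos (by omega)) (by omega)
    omega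
  calc _ ≤ 2 * (2 * (L ^ (6 * d) * L)) := Nat.mul_le_mul_left _ (h1.trans h2)
    _ = L ^ (6 * d) * (4 * L) := by ring
    _ ≤ L ^ (6 * d) * (L * L) := Nat.mul_le_mul_left _ (Nat.mul_le_mul_right _ (by omega))
    _ = L ^ (6 * d + 2) := by ring
    _ ≤ _ := Nat.pow_le_pow_right (by omega) (by omega)

/-- half of the all-energy estimate -/
lemma half_E {d s q N : ℕ} {γ κ : ℝ} (h : HA d s q N γ κ) (Λ : Finset (Site d)) (i : Fin d)
    (k : ℕ) (a b : Site d) (hab : Finset.Icc a b ⊆ Λ) (hside : (128 * LL s k : ℤ) ≤ b i - a i)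
    (x1 x2 : Site d) (hfar : far s k x1 x2) :
    prob (fun ω : Λ → Fin N =>
      ∃ e ∈ ends γ κ s k (Finset.Icc a b ∩ cube x1 (2 * LL s k)) (potential N Λ ω),
      bad γ κ s k (Finset.Icc a b) x2 e (potential N Λ ω)) ≤
      ((LL s k : ℝ) ^ (9 * d) / 2) * ((LL s k : ℝ) ^ q)⁻¹ := by
  classical
  apply prob_swap_const (Finset.univ.filter fun x : Λ => (x : Site d) ∈ cube x1 (2 * LL s k))
    (fun ω => ends γ κ s k (Finset.Icc a b ∩ cube x1 (2 * LL s k)) (potential N Λ ω))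
    (fun e ω => bad γ κ s k (Finset.Icc a b) x2 e (potential N Λ ω))
  · positivity
  · positivity
  · intro ω ω' hh
    apply ends_congr
    intro y hy
    apply pot_congr
    intro hyΛ
    apply hh
    simp [(Finset.mem_inter.1 hy).2]
  · intro e ω ω' hh
    apply bad_congr
    intro y hy
    apply pot_congr
    intro hyΛ
    apply hh
    simp only [Finset.mem_filter, Finset.mem_univ, true_and]
    intro hc
    apply hfar
    have := cube_trans hc (cube_comm.1 (Finset.mem_inter.1 hy).2)
    have e : 2 * LL s k + 2 * LL s k = 4 * LL s k := by ring
    rwa [e] at this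
  · intro ω
    have := ends_num h.hP.hd γ κ s k h.hP.hs (Finset.Icc a b) x1 (potential N Λ ω)
    rw [le_div_iff₀ (by norm_num), mul_comm]
    exact_mod_cast this
  · intro e
    exact prob_bad h Λ i k a b hab hside x2 e

/-- uniform in energy estimate -/
theorem all_E {d s q N : ℕ} {γ κ : ℝ} (h : HA d s q N γ κ) (i : Fin d)
    (k : ℕ) (a b : Site d) (hside : (128 * LL s k : ℤ) ≤ b i - a i) :
    prob (fun ω : ↥(Finset.Icc a b) → Fin N => ∃ E, ∃ x1 ∈ Finset.Icc a b, ∃ x2 ∈ Finset.Icc a b,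
      far s k x1 x2 ∧ bad γ κ s k (Finset.Icc a b) x1 E (potential N (Finset.Icc a b) ω) ∧
      bad γ κ s k (Finset.Icc a b) x2 E (potential N (Finset.Icc a b) ω)) ≤
      ((Finset.Icc a b).card : ℝ) ^ 2 * ((LL s k : ℝ) ^ (9 * d) * ((LL s k : ℝ) ^ q)⁻¹) := by
  set Λ := Finset.Icc a b with hΛ
  set p := (LL s k : ℝ) ^ (9 * d) * ((LL s k : ℝ) ^ q)⁻¹ with hp
  have hp0 : 0 ≤ p := by positivity
  have h1 : ∀ x1 ∈ Λ, ∀ x2 ∈ Λ, prob (fun ω : Λ → Fin N => far s k x1 x2 ∧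
      ∃ E, bad γ κ s k Λ x1 E (potential N Λ ω) ∧ bad γ κ s k Λ x2 E (potential N Λ ω)) ≤ p := by
    intro x1 _ x2 _
    by_cases hf : far s k x1 x2
    · have hf' : far s k x2 x1 := fun hc => hf (cube_comm.1 hc)
      have hh := (prob_or _ _).trans (add_le_add
        (half_E h Λ i k a b (Finset.Subset.refl _) hside x1 x2 hf)
        (half_E h Λ i k a b (Finset.Subset.refl _) hside x2 x1 hf'))
      refine le_trans (prob_mono ?_) (hh.trans (le_of_eq (by rw [hp]; ring)))
      rintro ω ⟨-, E, hb1, hb2⟩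
      exact energy_red γ κ s k a b x1 x2 _ E hb1 hb2
    · have : prob (fun ω : Λ → Fin N => far s k x1 x2 ∧
        ∃ E, bad γ κ s k Λ x1 E (potential N Λ ω) ∧ bad γ κ s k Λ x2 E (potential N Λ ω)) = 0 := by
          unfold prob; simp [hf]
      rw [this]; exact hp0
  have h2 : ∀ x1 ∈ Λ, prob (fun ω : Λ → Fin N => ∃ x2 ∈ Λ, far s k x1 x2 ∧
      ∃ E, bad γ κ s k Λ x1 E (potential N Λ ω) ∧ bad γ κ s k Λ x2 E (potential N Λ ω)) ≤
      Λ.card * p := fun x1 hx1 => prob_exists_le Λ _ p (h1 x1 hx1)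
  have h3 := prob_exists_le Λ _ _ h2
  refine le_trans (prob_mono ?_) (h3.trans (le_of_eq (by ring)))
  rintro ω ⟨E, x1, hx1, x2, hx2, hf, hb1, hb2⟩
  exact ⟨x1, hx1, x2, hx2, hf, E, hb1, hb2⟩

end MLS
namespace MLS

/-- nontrivial solution of an underdetermined homogeneous system -/
lemma ker_exists {ι κ : Type*} (I : Finset ι) (J : Finset κ) (a : κ → ι → ℝ)
    (h : J.card < I.card) :
    ∃ c : ι → ℝ, (∀ j ∈ J, ∑ β ∈ I, c β * a j β = 0) ∧ 0 < nn I c := by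
  classical
  let f : (I → ℝ) →ₗ[ℝ] (J → ℝ) :=
    { toFun := fun c j => ∑ β : I, c β * a j β
      map_add' := by
        intro x y; funext j
        simp [add_mul, Finset.sum_add_distrib]
      map_smul' := by
        intro r x; funext j
        simp [Finset.mul_sum, mul_assoc] }
  have hk := LinearMap.ker_ne_bot_of_finrank_lt (f := f) (by simpa using h)
  obtain ⟨c, hc, hc0⟩ := (Submodule.ne_bot_iff _).1 hk
  obtain ⟨β0, hβ0⟩ := Function.ne_iff.1 hc0
  refine ⟨fun β => if hβ : β ∈ I then c ⟨β, hβ⟩ else 0, ?_, ?_⟩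
  · intro j hj
    have h1 := congrFun (LinearMap.mem_ker.1 hc) ⟨j, hj⟩
    rw [← Finset.sum_coe_sort I]
    simpa [f] using h1
  · unfold nn
    apply Real.sqrt_pos.2
    apply Finset.sum_pos'
    · intro i _; positivity
    · refine ⟨β0, β0.2, ?_⟩
      simp only [β0.2, dif_pos]
      have : c β0 ≠ 0 := hβ0
      positivity

/-- few eigenvalues near an energy without far bad pairs -/
lemma few_eig {d : ℕ} {γ κ : ℝ} (hG : HG d γ κ) (s k : ℕ) (hs : 3 ≤ s)
    (X : Finset (Site d)) (E : ℝ) (v : Site d → ℝ) (y0 : Site d)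
    (hcard : (X.card : ℝ) * (γ ^ LL s k) ^ 2 ≤ 1)
    (hbad : ∀ x ∈ X, bad γ κ s k X x E v → x ∈ cube y0 (4 * LL s k))
    (I : Finset X) (hI : ∀ β ∈ I, |eig γ v X β - E| ≤ γ ^ (8 * LL s k)) :
    I.card ≤ (9 * LL s k) ^ d := by
  have hγ := hG.pos
  set l := LL s k with hl
  have hlpos : 1 ≤ l := LL_pos s k
  have hcc : (cube y0 (4 * l)).card ≤ (9 * l) ^ d := by
    rw [card_cube]
    exact Nat.pow_le_pow_left (by omega) d
  by_contra hlt
  push Not at hlt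
  obtain ⟨c, hc0, hcpos⟩ := ker_exists I (cube y0 (4 * l)) (fun x β => ef γ v X β x)
    (lt_of_le_of_lt hcc hlt)
  set u := pk γ v X I c with hu
  have hu0 : ∀ x ∈ cube y0 (4 * l), u x = 0 := hc0
  have huoff : ∀ x, x ∉ X → u x = 0 := pk_off γ v X I c
  have hLu : ∀ x ∈ X, |Lop γ v E u x| ≤ γ ^ (8 * l) * nn I c := by
    intro x hx
    rw [hu, pk_Lop γ v X I E c x hx]
    have h1 := Finset.single_le_sum
      (f := fun x => pk γ v X I (fun β => (eig γ v X β - E) * c β) x ^ 2)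
      (fun x _ => sq_nonneg _) hx
    rw [pk_sq] at h1
    have h2 := nn_mul_le I c (fun β => eig γ v X β - E) (γ ^ (8 * l)) (by positivity) hI
    exact (abs_le_of_sq_le_sq h1 (nn_nonneg _ _)).trans h2
  have hXne : X.Nonempty := by
    by_contra hX
    rw [Finset.not_nonempty_iff_eq_empty] at hX
    have h1 := pk_sq γ v X I c
    have : ∑ x ∈ X, pk γ v X I c x ^ 2 = 0 := by
      apply Finset.sum_eq_zero
      intro x hx
      rw [hX] at hx; simp at hx
    rw [this] at h1
    have : 0 < nn I c ^ 2 := by positivity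
    linarith
  obtain ⟨z, hz, hmax⟩ := Finset.exists_max_image X (fun y => |u y|) hXne
  have hmax' : ∀ y, |u y| ≤ |u z| := by
    intro y
    by_cases hy : y ∈ X
    · exact hmax y hy
    · rw [huoff y hy, abs_zero]; exact abs_nonneg _
  have hsum : nn I c ^ 2 ≤ X.card * |u z| ^ 2 := by
    rw [← pk_sq γ v X I c]
    calc _ ≤ ∑ x ∈ X, |u z| ^ 2 := by
          apply Finset.sum_le_sum
          intro x hx
          rw [← sq_abs]
          exact pow_le_pow_left₀ (abs_nonneg _) (hmax x hx) 2
      _ = _ := by rw [Finset.sum_const, nsmul_eq_mul]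
  have hnsq : 0 < nn I c ^ 2 := by positivity
  have huz : u z ≠ 0 := by
    intro h0
    rw [h0] at hsum; simp at hsum; nlinarith
  have hzc : z ∉ cube y0 (4 * l) := fun h => huz (hu0 z h)
  have hnb : ¬ bad γ κ s k X z E v := fun h => hzc (hbad z hz h)
  have hm := mm_ge s k (by omega)
  have hAP := AP_all hG s (by omega) k X z E v u (γ ^ (8 * l) * nn I c) |u z|
    (mul_nonneg (by positivity) (nn_nonneg _ _)) (abs_nonneg _) hnb huoff (fun y _ => hmax' y) (by
      intro y hy
      exact hLu y (Finset.mem_inter.1 hy).1)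
  have hmm : 1 ≤ mm s k := by omega
  have h12 := hG.pow_half hmm
  have e1 : (γ ^ l)⁻¹ * (γ ^ (8 * l) * nn I c) = γ ^ (7 * l) * nn I c := by
    have : γ ^ (8 * l) = γ ^ l * γ ^ (7 * l) := by rw [← pow_add]; congr 1; ring
    rw [this]
    field_simp
  rw [← hl, e1] at hAP
  have hM0 := abs_nonneg (u z)
  have h3 : |u z| ≤ 2 * (γ ^ (7 * l) * nn I c) := by
    nlinarith
  have hγl : γ ^ (7 * l) ≤ γ ^ l * (1 / 514) := by
    have h7 : γ ^ (7 * l) = γ ^ l * γ ^ (6 * l) := by rw [← pow_add]; congr 1; ring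
    rw [h7]
    exact mul_le_mul_of_nonneg_left (hG.pow_half (by omega)) (by positivity)
  have h4 : |u z| ≤ γ ^ l * nn I c * (1 / 257) := by
    have := mul_le_mul_of_nonneg_right hγl (nn_nonneg I c)
    linarith
  have h5 : |u z| ^ 2 ≤ (γ ^ l * nn I c * (1 / 257)) ^ 2 := pow_le_pow_left₀ hM0 h4 2
  have h6 : nn I c ^ 2 ≤ (X.card * (γ ^ l) ^ 2) * nn I c ^ 2 * (1 / 257) ^ 2 := by
    refine hsum.trans ?_
    calc _ ≤ X.card * (γ ^ l * nn I c * (1 / 257)) ^ 2 :=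
          mul_le_mul_of_nonneg_left h5 (Nat.cast_nonneg _)
      _ = _ := by ring
  have h7 := mul_le_mul_of_nonneg_right hcard hnsq.le
  nlinarith

/-- pigeonhole on scales -/
lemma pigeon (n : ℕ → ℕ) (A : ℕ) (hA : n 0 ≤ 2 ^ A) (h2 : 2 ≤ n A) :
    ∃ a < A, n a + 2 ≤ 2 * n (a + 1) := by
  by_contra hc
  push Not at hc
  have : ∀ a, a ≤ A → 2 ^ a * n a + 1 ≤ n 0 + 2 ^ a := by
    intro a
    induction a with
    | zero => intro _; simp
    | succ a ih =>
      intro ha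
      have h1 := ih (by omega)
      have h3 := hc a (by omega)
      have h4 : 2 ^ a * (2 * n (a + 1)) ≤ 2 ^ a * (n a + 1) := Nat.mul_le_mul_left _ (by omega)
      rw [pow_succ]
      nlinarith
  have h3 := this A le_rfl
  have h4 : 2 ^ A * 2 ≤ 2 ^ A * n A := Nat.mul_le_mul_left _ h2
  omega

end MLS
namespace MLS

lemma sum_sq_records (J : ℕ) (T0 γ : ℝ) (hγ : 0 ≤ γ) (hγ4 : γ ^ 4 ≤ 1 / 2) :
    ∑ j : Fin J, (T0 * γ ^ (2 * (j : ℕ))) ^ 2 ≤ 2 * T0 ^ 2 := by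
  cases J with
  | zero => simp; positivity
  | succ J =>
    have h := tail_sum (J + 1) 0 T0 γ hγ hγ4
    rw [Fin.sum_univ_succ] at h ⊢
    simp only [Fin.val_zero, lt_irrefl, if_false, Fin.val_succ, Nat.succ_pos', if_true, mul_zero,
      pow_zero, mul_one, zero_add] at h ⊢
    have : ∑ x : Fin J, (if 0 < (x : ℕ) + 1 then (T0 * γ ^ (2 * ((x : ℕ) + 1))) ^ 2 else 0) =
        ∑ x : Fin J, (T0 * γ ^ (2 * ((x : ℕ) + 1))) ^ 2 := by
      apply Finset.sum_congr rfl
      intro x _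
      rw [if_pos (Nat.succ_pos _)]
    have h4 : 2 * γ ^ 4 * T0 ^ 2 ≤ T0 ^ 2 := by nlinarith [sq_nonneg T0]
    linarith

/-- l2 size of a function supported on records -/
lemma sum_on_records {d : ℕ} (X : Finset (Site d)) (J : ℕ) (y : Fin J → Site d)
    (hyinj : Function.Injective y) (f : Site d → ℝ) (hf : ∀ x ∈ X, (∀ j, y j ≠ x) → f x = 0)
    (T0 γ : ℝ) (hγ : 0 ≤ γ) (hγ4 : γ ^ 4 ≤ 1 / 2)
    (hb : ∀ j : Fin J, |f (y j)| ≤ T0 * γ ^ (2 * (j : ℕ))) :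
    ∑ x ∈ X, f x ^ 2 ≤ 2 * T0 ^ 2 := by
  classical
  have h1 : ∑ x ∈ X, f x ^ 2 ≤ ∑ x ∈ Finset.univ.image y, f x ^ 2 := by
    rw [← Finset.sum_filter_add_sum_filter_not X (fun x => ∃ j, y j = x)]
    have : ∑ x ∈ X with ¬ ∃ j, y j = x, f x ^ 2 = 0 := by
      apply Finset.sum_eq_zero
      intro x hx
      rw [Finset.mem_filter] at hx
      rw [hf x hx.1 (fun j hj => hx.2 ⟨j, hj⟩)]; simp
    rw [this, add_zero]
    apply Finset.sum_le_sum_of_subset_of_nonneg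
    · intro x hx
      rw [Finset.mem_filter] at hx
      obtain ⟨j, hj⟩ := hx.2
      exact Finset.mem_image.2 ⟨j, Finset.mem_univ _, hj⟩
    · intros; positivity
  rw [Finset.sum_image (fun a _ b _ h => hyinj h)] at h1
  refine h1.trans (le_trans ?_ (sum_sq_records J T0 γ hγ hγ4))
  apply Finset.sum_le_sum
  intro j _
  rw [← sq_abs]
  exact pow_le_pow_left₀ (abs_nonneg _) (hb j) 2

lemma l2_add3 {ι : Type*} (s : Finset ι) (f g h : ι → ℝ) (a b c : ℝ)
    (hf : ∑ x ∈ s, f x ^ 2 ≤ a ^ 2) (hg : ∑ x ∈ s, g x ^ 2 ≤ b ^ 2)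
    (hh : ∑ x ∈ s, h x ^ 2 ≤ c ^ 2) :
    ∑ x ∈ s, (f x + g x + h x) ^ 2 ≤ 3 * (a ^ 2 + b ^ 2 + c ^ 2) := by
  calc _ ≤ ∑ x ∈ s, 3 * (f x ^ 2 + g x ^ 2 + h x ^ 2) := by
        apply Finset.sum_le_sum
        intro x _
        nlinarith [sq_nonneg (f x - g x), sq_nonneg (f x - h x), sq_nonneg (g x - h x)]
    _ = 3 * (∑ x ∈ s, f x ^ 2 + ∑ x ∈ s, g x ^ 2 + ∑ x ∈ s, h x ^ 2) := by
        rw [← Finset.mul_sum, Finset.sum_add_distrib, Finset.sum_add_distrib]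
    _ ≤ _ := by linarith

set_option maxHeartbeats 1000000 in
/-- uniqueness of the record values, many eigenvalues version -/
lemma spac_uniq {d : ℕ} {γ : ℝ} (hγ : 0 < γ) (hsm : 514 * γ ≤ 1) (N : ℕ) (hN : 1 ≤ N)
    (hNγ : 100 * N * γ ≤ 1) (v v' : Site d → ℝ) (X : Finset (Site d)) (I I' Ip' : Finset X)
    (E E' : ℝ) (w r : ℕ) (hw : 1 ≤ w) (hr : 20 * w ≤ r)
    (hI : ∀ β ∈ I, |eig γ v X β - E| ≤ γ ^ r) (hI' : ∀ β ∈ I', |eig γ v' X β - E'| ≤ γ ^ r)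
    (hIp : ∀ β, β ∉ Ip' → γ ^ w ≤ |eig γ v' X β - E'|) (hsub : I' ⊆ Ip')
    (hdim : Ip'.card + 2 ≤ I.card + I'.card)
    (y : Fin w → Site d) (hyinj : Function.Injective y) (hyX : ∀ j, y j ∈ X)
    (hb : ∀ j : Fin w, γ / 3 * (γ ^ (2 * w) * γ ^ (2 * (j : ℕ))) ≤ bb γ v X I (y j) ∧
      bb γ v X I (y j) ≤ γ ^ (2 * w) * γ ^ (2 * (j : ℕ)))
    (hb' : ∀ j : Fin w, γ / 3 * (γ ^ (2 * w) * γ ^ (2 * (j : ℕ))) ≤ bb γ v' X I' (y j) ∧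
      bb γ v' X I' (y j) ≤ γ ^ (2 * w) * γ ^ (2 * (j : ℕ)))
    (hoff : ∀ x ∈ X, (∀ j, y j ≠ x) → v x = v' x)
    (hd1 : ∀ x ∈ X, |v x - v' x| ≤ 1)
    (hdν : ∀ x ∈ X, v x ≠ v' x → 1 / (N : ℝ) ≤ |v x - v' x|)
    (hEE : |E - E'| ≤ 4 * γ ^ (2 * w)) : ∀ x ∈ X, v x = v' x := by
  classical
  by_contra hne
  push Not at hne
  have hγ1 : γ ≤ 1 := by linarith
  have hγ4 : γ ^ 4 ≤ 1 / 2 := by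
    have : γ ^ 4 ≤ γ ^ 1 := pow_le_pow_of_le_one hγ.le hγ1 (by norm_num)
    linarith
  set θ := γ ^ r with hθ
  set T0 := γ ^ (2 * w) with hT0
  have hθ0 : 0 < θ := by positivity
  have hT00 : 0 < T0 := by positivity
  obtain ⟨T, x, hx, hT, hTpos, hmain, hpk⟩ := first_diff hγ hγ4 v v' X I I' E E' θ (1 / (N : ℝ)) T0
    hθ0.le (by positivity) hT00 hI hI' w y hyinj hyX hb hb' hoff hd1 hdν hne
  -- choice of the coefficients
  obtain ⟨c, hc0, hcpos⟩ := ker_exists I (insert none ((Ip' \ I').image some))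
    (fun o β => match o with
      | none => ef γ v X β x
      | some β' => ∑ z ∈ X, ef γ v X β z * ef γ v' X β' z) (by
      refine lt_of_le_of_lt (Finset.card_insert_le _ _) ?_
      have h1 := Finset.card_image_le (s := Ip' \ I') (f := some)
      have h2 := Finset.card_sdiff_add_card_eq_card hsub
      omega)
  have hcx : pk γ v X I c x = 0 := hc0 none (Finset.mem_insert_self _ _)
  set u := pk γ v X I c with hu
  have huoff : ∀ x, x ∉ X → u x = 0 := pk_off γ v X I c
  set n := nn I c with hn
  have hun : ∑ z ∈ X, u z ^ 2 = n ^ 2 := pk_sq γ v X I c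
  set p : X → ℝ := fun β' => ∑ z ∈ X, ef γ v' X β' z * u z with hp
  have hmid : ∀ β' ∈ Ip' \ I', p β' = 0 := by
    intro β' hβ'
    have h1 := hc0 (some β') (Finset.mem_insert_of_mem (Finset.mem_image_of_mem _ hβ'))
    simp only at h1
    simp only [hp, hu, pk]
    rw [← h1]
    simp_rw [Finset.mul_sum]
    rw [Finset.sum_comm]
    apply Finset.sum_congr rfl
    intro β _
    apply Finset.sum_congr rfl
    intro z _
    ring
  have hpars : ∑ β' : X, p β' ^ 2 = n ^ 2 := by rw [← hun]; exact parseval γ v' X u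
  -- residual in the primed problem
  have hres : ∑ z ∈ X, (Lop γ v' E' u z) ^ 2 ≤ 60 * T0 ^ 2 * n ^ 2 := by
    have h1 : ∀ z, Lop γ v' E' u z =
        Lop γ v E u z + (v' z - v z) * u z + (E - E') * u z := by
      intro z; unfold Lop; ring
    simp_rw [h1]
    have hn0 : 0 ≤ n := nn_nonneg _ _
    have a1 : ∑ z ∈ X, (Lop γ v E u z) ^ 2 ≤ (T0 * n) ^ 2 := by
      have : ∑ z ∈ X, Lop γ v E u z ^ 2 =
          ∑ z ∈ X, pk γ v X I (fun β => (eig γ v X β - E) * c β) z ^ 2 :=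
        Finset.sum_congr rfl fun z hz => by rw [hu, pk_Lop γ v X I E c z hz]
      rw [this, pk_sq]
      apply pow_le_pow_left₀ (nn_nonneg _ _)
      have h2 := nn_mul_le I c (fun β => eig γ v X β - E) θ hθ0.le hI
      refine h2.trans (mul_le_mul_of_nonneg_right ?_ hn0)
      rw [hθ, hT0]
      exact pow_le_pow_of_le_one hγ.le hγ1 (by omega)
    have a2 : ∑ z ∈ X, ((v' z - v z) * u z) ^ 2 ≤ (√2 * (T0 * n)) ^ 2 := by
      rw [mul_pow, Real.sq_sqrt (by norm_num)]
      apply sum_on_records X w y hyinj _ _ _ γ hγ.le hγ4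
      · intro j
        rw [abs_mul]
        have h2 := pk_abs γ v X I c (y j)
        have h3 := hd1 (y j) (hyX j)
        rw [abs_sub_comm] at h3
        have h4 : |u (y j)| ≤ n * (T0 * γ ^ (2 * (j : ℕ))) :=
          h2.trans (mul_le_mul_of_nonneg_left (hb j).2 (nn_nonneg _ _))
        calc _ ≤ 1 * (n * (T0 * γ ^ (2 * (j : ℕ)))) :=
              mul_le_mul h3 h4 (abs_nonneg _) zero_le_one
          _ = _ := by ring
      · intro z hz hzy
        rw [hoff z hz hzy]; simp
    have a3 : ∑ z ∈ X, ((E - E') * u z) ^ 2 ≤ (4 * (T0 * n)) ^ 2 := by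
      simp_rw [mul_pow]
      rw [← Finset.mul_sum, hun, ← sq_abs]
      have := pow_le_pow_left₀ (abs_nonneg _) hEE 2
      nlinarith [sq_nonneg n]
    have := l2_add3 X _ _ _ _ _ _ a1 a2 a3
    rw [mul_pow (√2), Real.sq_sqrt (by norm_num)] at this
    refine this.trans ?_
    nlinarith [sq_nonneg (T0 * n)]
  -- tail
  have hout : (γ ^ w) ^ 2 * ∑ β' ∈ Finset.univ \ Ip', p β' ^ 2 ≤ 60 * T0 ^ 2 * n ^ 2 := by
    refine le_trans ?_ hres
    rw [← parseval γ v' X (Lop γ v' E' u), Finset.mul_sum]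
    refine le_trans (Finset.sum_le_sum ?_) (Finset.sum_le_sum_of_subset_of_nonneg
      (Finset.subset_univ (Finset.univ \ Ip')) (fun _ _ _ => sq_nonneg _))
    intro β' hβ'
    rw [Finset.mem_sdiff] at hβ'
    rw [ef_inner_Lop γ v' X E' β' u huoff, mul_pow]
    apply mul_le_mul_of_nonneg_right _ (sq_nonneg _)
    rw [← sq_abs (eig γ v' X β' - E')]
    exact pow_le_pow_left₀ (by positivity) (hIp β' hβ'.2) 2
  have hout2 : ∑ β' ∈ Finset.univ \ Ip', p β' ^ 2 ≤ n ^ 2 / 4 := by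
    have e : T0 ^ 2 = (γ ^ w) ^ 2 * (γ ^ w) ^ 2 := by rw [hT0]; ring
    rw [e] at hout
    have hgw : 0 < (γ ^ w) ^ 2 := by positivity
    have h1 : ∑ β' ∈ Finset.univ \ Ip', p β' ^ 2 ≤ 60 * (γ ^ w) ^ 2 * n ^ 2 := by
      apply le_of_mul_le_mul_left _ hgw
      refine hout.trans (le_of_eq ?_)
      ring
    have h2 : (γ ^ w) ^ 2 ≤ 1 / 240 := by
      have : (γ ^ w) ^ 2 ≤ γ ^ 1 := by
        rw [← pow_mul]; exact pow_le_pow_of_le_one hγ.le hγ1 (by omega)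
      linarith
    nlinarith [sq_nonneg n]
  have hS : 3 / 4 * n ^ 2 ≤ ∑ β' ∈ I', p β' ^ 2 := by
    have h1 := Finset.sum_sdiff (f := fun β' => p β' ^ 2) (Finset.subset_univ Ip')
    have h2 := Finset.sum_sdiff (f := fun β' => p β' ^ 2) hsub
    have h3 : ∑ β' ∈ Ip' \ I', p β' ^ 2 = 0 := by
      apply Finset.sum_eq_zero
      intro β' hβ'
      rw [hmid β' hβ']; simp
    rw [hpars] at h1
    linarith
  have hfin := hpk c p hcx
  have hinner : ∑ z ∈ X, u z * pk γ v' X I' p z = nn I' p ^ 2 := by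
    rw [nn_sq]
    unfold pk
    simp_rw [Finset.mul_sum]
    rw [Finset.sum_comm]
    apply Finset.sum_congr rfl
    intro β' _
    rw [pow_two]
    nth_rewrite 3 [hp]
    simp only
    rw [Finset.mul_sum]
    apply Finset.sum_congr rfl
    intro z _
    ring
  rw [hinner] at hfin
  set m := nn I' p with hm
  have hm2 : 3 / 4 * n ^ 2 ≤ m ^ 2 := by rw [hm, nn_sq I' p]; exact hS
  have hm0 : 0 ≤ m := nn_nonneg _ _
  have hmpos : 0 < m := by
    rcases hm0.eq_or_lt with h | h
    · rw [← h] at hm2; nlinarith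
    · exact h
  have hnm : n ≤ 2 * m := by nlinarith
  rw [abs_of_nonneg (sq_nonneg m)] at hfin
  have hθT : θ ≤ γ ^ 4 * T ^ 2 := by
    have h1 : (T0 * γ ^ (2 * w)) ^ 2 ≤ T ^ 2 := pow_le_pow_left₀ (by positivity) hT 2
    have h2 : θ ≤ γ ^ 4 * (T0 * γ ^ (2 * w)) ^ 2 := by
      rw [hθ, hT0, ← pow_add, ← pow_mul, ← pow_add]
      exact pow_le_pow_of_le_one hγ.le hγ1 (by omega)
    exact h2.trans (mul_le_mul_of_nonneg_left h1 (by positivity))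
  have hEb : |E - E'| ≤ 8 * (γ ^ 4 * T ^ 2) := by
    have h1 : |E - E'| * m ≤ (2 * γ ^ 4 * T ^ 2 + 2 * θ) * n := by
      apply le_of_mul_le_mul_right _ hmpos
      calc _ = |E - E'| * m ^ 2 := by ring
        _ ≤ _ := hfin
        _ = _ := by ring
    have h2 : (2 * γ ^ 4 * T ^ 2 + 2 * θ) * n ≤ (4 * (γ ^ 4 * T ^ 2)) * (2 * m) := by
      apply mul_le_mul (by linarith) hnm hcpos.le (by positivity)
    have h3 : |E - E'| * m ≤ (8 * (γ ^ 4 * T ^ 2)) * m := by linarith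
    exact le_of_mul_le_mul_right h3 hmpos
  have hN0 : (1 : ℝ) ≤ N := by exact_mod_cast hN
  have hT2 : 0 < γ ^ 2 * T ^ 2 := by positivity
  have h4 : (γ ^ 2 * T ^ 2) * (1 / (9 * (N : ℝ))) ≤ (γ ^ 2 * T ^ 2) * (12 * γ ^ 2) := by
    calc _ = (1 / (N : ℝ)) * (γ ^ 2 / 9 * T ^ 2) := by field_simp
      _ ≤ |E - E'| + 2 * θ + 2 * γ ^ 4 * T ^ 2 := hmain
      _ ≤ 12 * (γ ^ 4 * T ^ 2) := by linarith
      _ = _ := by ring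
  have h5 := le_of_mul_le_mul_left h4 hT2
  rw [div_le_iff₀ (by positivity)] at h5
  nlinarith

end MLS
namespace MLS

open scoped Classical in
/-- eigenvalue labels near an energy -/
def near {d : ℕ} (γ : ℝ) (v : Site d → ℝ) (X : Finset (Site d)) (E : ℝ) (r : ℕ) : Finset X :=
  Finset.univ.filter fun β => |eig γ v X β - E| ≤ γ ^ r

lemma mem_near {d : ℕ} (γ : ℝ) (v : Site d → ℝ) (X : Finset (Site d)) (E : ℝ) (r : ℕ) (β : X) :
    β ∈ near γ v X E r ↔ |eig γ v X β - E| ≤ γ ^ r := by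
  unfold near; simp

lemma ef_le_one {d : ℕ} (γ : ℝ) (v : Site d → ℝ) (X : Finset (Site d)) (β : X) (x : Site d) :
    |ef γ v X β x| ≤ 1 := by
  by_cases hx : x ∈ X
  · have h1 := ef_orth γ v X β β
    rw [if_pos rfl] at h1
    have h2 : ef γ v X β x * ef γ v X β x ≤ 1 := by
      rw [← h1]
      exact Finset.single_le_sum (f := fun x => ef γ v X β x * ef γ v X β x)
        (fun x _ => mul_self_nonneg _) hx
    rw [← abs_mul_abs_self] at h2
    nlinarith [abs_nonneg (ef γ v X β x)]
  · rw [ef_off γ v X β x hx]; simp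

open scoped Classical in
/-- potential with the record values erased -/
def erase {d J : ℕ} (y : Fin J → Site d) (v : Site d → ℝ) (x : Site d) : ℝ :=
  if ∃ j, y j = x then 0 else v x

/-- approximate eigenvalue of the erased problem -/
lemma erase_eig {d : ℕ} {γ : ℝ} (hγ : 0 ≤ γ) (hγ4 : γ ^ 4 ≤ 1 / 2) (v : Site d → ℝ)
    (X : Finset (Site d)) (β0 : X) (J : ℕ) (y : Fin J → Site d)
    (hyinj : Function.Injective y) (T0 : ℝ) (hT0 : 0 < T0)
    (hv : ∀ x, 0 ≤ v x ∧ v x ≤ 1)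
    (hb : ∀ j : Fin J, |ef γ v X β0 (y j)| ≤ T0 * γ ^ (2 * (j : ℕ))) :
    ∃ jj : X, |eig γ (erase y v) X jj - eig γ v X β0| ≤ 2 * T0 := by
  by_contra hc
  push Not at hc
  have h1 := gap_bound γ (erase y v) X (eig γ v X β0) (2 * T0) (by positivity)
    (fun β => (hc β).le) (ef γ v X β0) (ef_off γ v X β0)
  have h2 : ∑ x ∈ X, ef γ v X β0 x ^ 2 = 1 := by
    have := ef_orth γ v X β0 β0
    rw [if_pos rfl] at this
    simp_rw [pow_two]; exact this
  rw [h2] at h1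
  have h3 : ∑ x ∈ X, (Lop γ (erase y v) (eig γ v X β0) (ef γ v X β0) x) ^ 2 ≤ 2 * T0 ^ 2 := by
    have e : ∀ x ∈ X, Lop γ (erase y v) (eig γ v X β0) (ef γ v X β0) x =
        (erase y v x - v x) * ef γ v X β0 x := by
      intro x hx
      have := ef_eig γ v X (eig γ v X β0) β0 x hx
      rw [sub_self, zero_mul] at this
      unfold Lop at this ⊢
      linarith
    rw [Finset.sum_congr rfl fun x hx => by rw [e x hx]]
    apply sum_on_records X J y hyinj _ _ T0 γ hγ hγ4
    · intro j
      rw [abs_mul]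
      have h4 : |erase y v (y j) - v (y j)| ≤ 1 := by
        unfold erase
        rw [if_pos ⟨j, rfl⟩, zero_sub, abs_neg, abs_of_nonneg (hv _).1]
        exact (hv _).2
      calc _ ≤ 1 * (T0 * γ ^ (2 * (j : ℕ))) := mul_le_mul h4 (hb j) (abs_nonneg _) zero_le_one
        _ = _ := by ring
    · intro x _ hx
      unfold erase
      rw [if_neg (by rintro ⟨j, hj⟩; exact hx j hj)]; simp
  nlinarith

/-- a cluster: many close eigenvalues in a localized situation -/
def cluster {d : ℕ} (γ κ : ℝ) (s k w r : ℕ) (X : Finset (Site d)) (v : Site d → ℝ) : Prop :=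
  ∃ β0 : X, (∀ x1 ∈ X, ∀ x2 ∈ X, far s k x1 x2 → bad γ κ s k X x1 (eig γ v X β0) v →
      bad γ κ s k X x2 (eig γ v X β0) v → False) ∧
    (near γ v X (eig γ v X β0) w).card + 2 ≤ 2 * (near γ v X (eig γ v X β0) r).card

/-- the property encoded by a code -/
def coded {d : ℕ} (γ : ℝ) (w r : ℕ) (X : Finset (Site d)) (y : Fin w → Site d) (jj : X)
    (v : Site d → ℝ) : Prop :=
  ∃ E, Function.Injective y ∧ (∀ j, y j ∈ X) ∧
    |eig γ (erase y v) X jj - E| ≤ 2 * γ ^ (2 * w) ∧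
    (near γ v X E w).card + 2 ≤ 2 * (near γ v X E r).card ∧
    ∀ j : Fin w, γ / 3 * (γ ^ (2 * w) * γ ^ (2 * (j : ℕ))) ≤ bb γ v X (near γ v X E r) (y j) ∧
      bb γ v X (near γ v X E r) (y j) ≤ γ ^ (2 * w) * γ ^ (2 * (j : ℕ))

set_option maxHeartbeats 1000000 in
lemma coded_uniq {d : ℕ} {γ κ : ℝ} (hG : HG d γ κ) (N : ℕ) (hN : 2 ≤ N) (hNγ : 100 * N * γ ≤ 1)
    (X : Finset (Site d)) (w r : ℕ) (hw : 1 ≤ w) (hr : 20 * w ≤ r) (y : Fin w → Site d) (jj : X)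
    (ω ω' : X → Fin N) (h : coded γ w r X y jj (potential N X ω))
    (h' : coded γ w r X y jj (potential N X ω'))
    (hag : ∀ x, x ∉ RR X y → ω x = ω' x) : ω = ω' := by
  have hγ := hG.pos
  obtain ⟨E, hinj, hyX, hE, hc, hb⟩ := h
  obtain ⟨E', -, -, hE', hc', hb'⟩ := h'
  set v := potential N X ω with hv
  set v' := potential N X ω' with hv'
  have hoff : ∀ x ∈ X, (∀ j, y j ≠ x) → v x = v' x := by
    intro x hx hxc
    apply pot_congr
    intro hxΛ
    apply hag
    rw [mem_RR]
    rintro ⟨j, hj⟩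
    exact hxc j hj
  have her : ∀ x ∈ X, erase y v x = erase y v' x := by
    intro x hx
    unfold erase
    split_ifs with hj
    · rfl
    · push Not at hj
      exact hoff x hx hj
  rw [eig_congr γ _ X her] at hE
  have hEE : |E - E'| ≤ 4 * γ ^ (2 * w) := by
    have e : E - E' = (eig γ (erase y v') X jj - E') - (eig γ (erase y v') X jj - E) := by ring
    rw [e]
    refine (abs_sub _ _).trans ?_
    linarith
  have hsub : ∀ (v : Site d → ℝ) (E : ℝ), near γ v X E r ⊆ near γ v X E w := by
    intro v E β hβ
    rw [mem_near] at hβ ⊢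
    exact hβ.trans (hG.powle (by omega))
  have hIp : ∀ (v : Site d → ℝ) (E : ℝ) β, β ∉ near γ v X E w → γ ^ w ≤ |eig γ v X β - E| := by
    intro v E β hβ
    rw [mem_near] at hβ
    push Not at hβ
    exact hβ.le
  have hI : ∀ (v : Site d → ℝ) (E : ℝ), ∀ β ∈ near γ v X E r, |eig γ v X β - E| ≤ γ ^ r := by
    intro v E β hβ
    rwa [mem_near] at hβ
  have hall : ∀ x ∈ X, v x = v' x := by
    rcases le_total (near γ v' X E' r).card (near γ v X E r).card with hle | hle
    · exact spac_uniq hγ hG.small N (by omega) hNγ v v' X (near γ v X E r) (near γ v' X E' r)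
        (near γ v' X E' w) E E' w r hw hr (hI v E) (hI v' E') (hIp v' E') (hsub v' E') (by omega)
        y hinj hyX hb hb' hoff (fun x _ => pot_diff X hN ω ω' x) (fun x _ => pot_sep X hN ω ω' x) hEE
    · intro x hx
      symm
      exact spac_uniq hγ hG.small N (by omega) hNγ v' v X (near γ v' X E' r) (near γ v X E r)
        (near γ v X E w) E' E w r hw hr (hI v' E') (hI v E) (hIp v E) (hsub v E) (by omega)
        y hinj hyX hb' hb (fun x hx h => (hoff x hx h).symm) (fun x _ => pot_diff X hN ω' ω x)
        (fun x _ => pot_sep X hN ω' ω x) (by rw [abs_sub_comm]; exact hEE) x hx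
  funext x
  by_contra hne
  exact pot_inj X hN ω ω' x hne (hall x x.2)

lemma arith1 (m t l : ℕ) (hm : 8 ≤ m) (ht : l = 8 * t) : 4 * (m * l) + 2 * l ≤ t * (35 * m - 4) := by
  obtain ⟨m', rfl⟩ : ∃ m', m = m' + 8 := ⟨m - 8, by omega⟩
  have : 35 * (m' + 8) - 4 = 35 * m' + 276 := by omega
  rw [this, ht]
  nlinarith [Nat.zero_le (m' * t)]

set_option maxHeartbeats 1000000 in
lemma coded_exists {d : ℕ} {γ κ : ℝ} (hG : HG d γ κ) (s k m r : ℕ) (hs : 3 ≤ s)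
    (hm : 8 ≤ m) (hr : 8 * LL s k ≤ r) (a b : Site d) (i : Fin d)
    (hside : (70 * (m * LL s k) : ℤ) ≤ b i - a i)
    (hcard : ((Finset.Icc a b).card : ℝ) * (γ ^ LL s k) ^ 2 ≤ 1)
    (v : Site d → ℝ) (hv : ∀ x, 0 ≤ v x ∧ v x ≤ 1)
    (h : cluster γ κ s k (m * LL s k) r (Finset.Icc a b) v) :
    ∃ y ∈ codes i (Finset.Icc a b) (m * LL s k) (35 * (m * LL s k)), ∃ jj,
      coded γ (m * LL s k) r (Finset.Icc a b) y jj v := by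
  have hγ := hG.pos
  set Z := Finset.Icc a b with hZ
  obtain ⟨β0, hfar, hcount⟩ := h
  obtain ⟨t, ht⟩ := LL_dvd s k hs
  have hlpos := LL_pos s k
  set l := LL s k with hl
  set E := eig γ v Z β0 with hE
  set w := m * l with hw
  have hw8 : 8 * l ≤ w := Nat.mul_le_mul_right _ hm
  set I := near γ v Z E r with hI
  obtain ⟨z, hz, hpos, hmax, hnorm⟩ := ef_argmax γ v Z β0
  have hLu : ∀ β ∈ I, ∀ x ∈ Z, |Lop γ v E (ef γ v Z β) x| ≤ γ ^ (8 * l) * |ef γ v Z β x| := by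
    intro β hβ x hx
    rw [ef_eig γ v Z E β x hx, abs_mul]
    rw [hI, mem_near] at hβ
    exact mul_le_mul_of_nonneg_right (hβ.trans (hG.powle hr)) (abs_nonneg _)
  have hβ0 : β0 ∈ I := by
    rw [hI, mem_near, hE, sub_self, abs_zero]; positivity
  have hzbad := max_bad hG s k hs Z E v _ z hpos (ef_off γ v Z β0) hmax (hLu β0 hβ0)
  have hcubebad : ∀ x ∈ Z, bad γ κ s k Z x E v → x ∈ cube z (4 * LL s k) := by
    intro x hx hb
    by_contra hc
    exact hfar z hz x hx hc hzbad hb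
  have hdec : ∀ β ∈ I, ∀ x, x ∉ cube z ((3 + (35 * m - 4)) * l) →
      |ef γ v Z β x| ≤ γ ^ (t * (35 * m - 4)) := by
    intro β hβ x hx
    have := decay hG s k t hs ht Z E v _ z 1 zero_le_one hcubebad (ef_off γ v Z β)
      (ef_le_one γ v Z β) (hLu β hβ) (35 * m - 4) x hx
    simpa using this
  have hgb : ∀ β ∈ I, ∀ x, |ef γ v Z β x| ≤ bb γ v Z I x := by
    intro β hβ x
    unfold bb nn
    apply Real.abs_le_sqrt
    exact Finset.single_le_sum (f := fun β => ef γ v Z β x ^ 2) (fun _ _ => sq_nonneg _) hβ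
  have hcp : (1 : ℝ) ≤ Z.card := by
    exact_mod_cast Finset.card_pos.2 ⟨z, hz⟩
  have hT0 : γ ^ (2 * w) ≤ bb γ v Z I z := by
    refine le_trans ?_ (hgb β0 hβ0 z)
    have h0 : γ ^ (2 * w) ≤ γ ^ l := hG.powle (by omega)
    refine h0.trans ?_
    by_contra hc
    push Not at hc
    have : |ef γ v Z β0 z| ^ 2 < (γ ^ l) ^ 2 := pow_lt_pow_left₀ hc (abs_nonneg _) (by norm_num)
    nlinarith
  obtain ⟨σ, hroom⟩ := room a b i (35 * w) (by rw [hw]; push_cast; linarith) z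
  have harith : 4 * w + 2 * l ≤ t * (35 * m - 4) := by
    exact arith1 m t l hm ht
  obtain ⟨y, hy, hinj, hrec⟩ := records hγ hG.γd hG.γ3 i σ (bb γ v Z I)
    (fun x => nn_nonneg _ _) Z (bb_off γ v Z _) w (35 * w) (γ ^ (2 * w)) (by positivity)
    (by
      intro x hx
      apply chain_bb hγ v Z I i σ x hx
      intro β' _
      exact eig_loc hG v Z (fun x _ => hv x) β' _ hx)
    z hz hT0 hroom (by
      intro y hy hd j hj
      have h1 : ∀ β ∈ I, |ef γ v Z β y| ≤ γ ^ (t * (35 * m - 4)) := by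
        intro β hβ
        apply hdec β hβ y
        apply disp_not_cube hd
        have : 3 + (35 * m - 4) < 35 * m := by omega
        calc (3 + (35 * m - 4)) * l < 35 * m * l := Nat.mul_lt_mul_of_pos_right this hlpos
          _ = 35 * w := by rw [hw]; ring
      have h2 : bb γ v Z I y ≤ Z.card * γ ^ (t * (35 * m - 4)) := by
        unfold bb nn
        apply Real.sqrt_le_iff.2
        refine ⟨by positivity, ?_⟩
        calc ∑ β ∈ I, ef γ v Z β y ^ 2 ≤ ∑ β ∈ I, (γ ^ (t * (35 * m - 4))) ^ 2 := by
              apply Finset.sum_le_sum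
              intro β hβ
              rw [← sq_abs]
              exact pow_le_pow_left₀ (abs_nonneg _) (h1 β hβ) 2
          _ = I.card * (γ ^ (t * (35 * m - 4))) ^ 2 := by rw [Finset.sum_const, nsmul_eq_mul]
          _ ≤ Z.card ^ 2 * (γ ^ (t * (35 * m - 4))) ^ 2 := by
              apply mul_le_mul_of_nonneg_right _ (by positivity)
              have : (I.card : ℝ) ≤ Z.card := by
                have := Finset.card_le_univ I
                rw [Fintype.card_coe] at this
                exact_mod_cast this
              nlinarith
          _ = _ := by ring
      refine lt_of_le_of_lt h2 ?_
      have h3 : γ ^ (t * (35 * m - 4)) ≤ γ ^ (4 * w) * (γ ^ l) ^ 2 := by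
        rw [← pow_mul, ← pow_add]
        exact hG.powle (by omega)
      have h4 : (Z.card : ℝ) * γ ^ (t * (35 * m - 4)) ≤ γ ^ (4 * w) := by
        calc _ ≤ (Z.card : ℝ) * (γ ^ (4 * w) * (γ ^ l) ^ 2) :=
              mul_le_mul_of_nonneg_left h3 (by positivity)
          _ = γ ^ (4 * w) * (Z.card * (γ ^ l) ^ 2) := by ring
          _ ≤ γ ^ (4 * w) * 1 := mul_le_mul_of_nonneg_left hcard (by positivity)
          _ = _ := mul_one _
      refine lt_of_le_of_lt h4 ?_
      rw [← pow_add]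
      exact pow_lt_pow_right_of_lt_one₀ hγ hG.lt1 (by omega))
  obtain ⟨jj, hjj⟩ := erase_eig hγ.le hG.γ4 v Z β0 w y hinj (γ ^ (2 * w)) (by positivity) hv
    (fun j => (hgb β0 hβ0 _).trans (hrec j).2.2.le)
  exact ⟨y, hy, jj, E, hinj, fun j => (hrec j).1, hjj, hcount,
    fun j => ⟨(hrec j).2.1, (hrec j).2.2.le⟩⟩

/-- probability of a cluster -/
theorem cluster_prob {d : ℕ} {γ κ : ℝ} (hG : HG d γ κ) (s k m r : ℕ) (hs : 3 ≤ s) (N : ℕ)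
    (hN : 2 ≤ N) (hNγ : 100 * N * γ ≤ 1)
    (hm : 8 ≤ m) (hr : 20 * (m * LL s k) ≤ r) (a b : Site d) (i : Fin d)
    (hside : (70 * (m * LL s k) : ℤ) ≤ b i - a i)
    (hcard : ((Finset.Icc a b).card : ℝ) * (γ ^ LL s k) ^ 2 ≤ 1) :
    prob (fun ω : ↥(Finset.Icc a b) → Fin N => cluster γ κ s k (m * LL s k) r (Finset.Icc a b)
      (potential N (Finset.Icc a b) ω)) ≤
      ((codes i (Finset.Icc a b) (m * LL s k) (35 * (m * LL s k))).card * (Finset.Icc a b).card : ℕ)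
        / (N : ℝ) ^ (m * LL s k) := by
  classical
  set Z := Finset.Icc a b with hZ
  set w := m * LL s k with hw
  have hlpos := LL_pos s k
  have hw8 : 8 * LL s k ≤ w := Nat.mul_le_mul_right _ hm
  have := code_count N w (by omega) (fun ω : Z → Fin N => cluster γ κ s k w r Z (potential N Z ω))
    (codes i Z w (35 * w) ×ˢ (Finset.univ : Finset Z))
    (fun c ω => coded γ w r Z c.1 c.2 (potential N Z ω)) (fun c => RR Z c.1)
    (by
      intro ω hω
      obtain ⟨y, hy, jj, hjj⟩ := coded_exists hG s k m r hs hm (by omega) a b i hside hcard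
        (potential N Z ω) (pot_range Z hN ω) hω
      exact ⟨(y, jj), Finset.mem_product.2 ⟨hy, Finset.mem_univ _⟩, hjj⟩)
    (by
      rintro c - ω ⟨E, hinj, hyX, -⟩
      exact card_RR Z c.1 hinj hyX)
    (by
      intro c _ ω ω' h h' hag
      exact coded_uniq hG N hN hNγ Z w r (by omega) hr c.1 c.2 ω ω' h h' hag)
  rwa [Finset.card_product, Finset.card_univ, Fintype.card_coe] at this

end MLS
namespace MLS

/-- coincidence of two potential values -/
lemma coin_prob {ι : Type*} [Fintype ι] [DecidableEq ι] (N : ℕ) (hN : 1 ≤ N) :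
    prob (fun ω : ι → Fin N => ∃ x y : ι, x ≠ y ∧ ω x = ω y) ≤
      (Fintype.card ι : ℝ) ^ 2 * (1 / (N : ℝ)) := by
  have h1 : prob (fun ω : ι → Fin N => ∃ x y : ι, x ≠ y ∧ ω x = ω y) ≤
      prob (fun ω : ι → Fin N => ∃ c ∈ (Finset.univ : Finset (ι × ι)), c.1 ≠ c.2 ∧ ω c.1 = ω c.2) := by
    apply prob_mono
    rintro ω ⟨x, y, hxy, h⟩
    exact ⟨(x, y), Finset.mem_univ _, hxy, h⟩
  refine h1.trans ((prob_exists_le _ _ (1 / (N : ℝ)) ?_).trans ?_)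
  · rintro ⟨x, y⟩ _
    have := code_count N 1 hN (fun ω : ι → Fin N => x ≠ y ∧ ω x = ω y) ({()} : Finset Unit)
      (fun _ ω => x ≠ y ∧ ω x = ω y) (fun _ => {x}) (fun ω h => ⟨(), by simp, h⟩)
      (fun _ _ _ _ => by simp) (by
        intro _ _ ω ω' h h' hag
        funext z
        by_cases hz : z = x
        · rw [hz, h.2, h'.2]
          exact hag y (by simpa using h.1.symm)
        · exact hag z (by simpa using hz))
    simpa using this
  · rw [Finset.card_univ, Fintype.card_prod, pow_two]
    push_cast
    exact le_rfl

/-- no close pair when all potential values are distinct -/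
lemma distinct_gap {d : ℕ} {γ : ℝ} (hγ : 0 < γ) (N : ℕ) (hN : 2 ≤ N)
    (hNγ : 4 * N * (N + 2 * d) * γ < 1) (X : Finset (Site d)) (hX : X.card ≤ N)
    (ω : X → Fin N) (hω : ∀ x y : X, x ≠ y → ω x ≠ ω y) (β β' : X) (hβ : β ≠ β')
    (h : |eig γ (potential N X ω) X β - eig γ (potential N X ω) X β'| ≤ γ) : False := by
  classical
  set v := potential N X ω with hv
  set E := eig γ v X β with hE
  have hN0 : (2 : ℝ) ≤ N := by exact_mod_cast hN
  have hone : ∃ z, ∀ y ∈ X, y ≠ z → 1 / (4 * (N : ℝ)) ≤ |2 * d * γ + v y - E| := by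
    by_cases hz : ∃ z ∈ X, |2 * d * γ + v z - E| < 1 / (4 * (N : ℝ))
    · obtain ⟨z, hzX, hz⟩ := hz
      refine ⟨z, ?_⟩
      intro y hy hyz
      by_contra hc
      push Not at hc
      have h1 : 1 / (N : ℝ) ≤ |v y - v z| := by
        have := pot_sep' hN (ω ⟨y, hy⟩) (ω ⟨z, hzX⟩) (hω _ _ (by simpa using hyz))
        rw [hv]
        unfold potential
        rw [dif_pos hy, dif_pos hzX]
        exact this
      have h2 : |v y - v z| < 2 * (1 / (4 * (N : ℝ))) := by
        have e : v y - v z = (2 * d * γ + v y - E) - (2 * d * γ + v z - E) := by ring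
        rw [e]
        refine lt_of_le_of_lt (abs_sub _ _) ?_
        linarith
      have h3 : 2 * (1 / (4 * (N : ℝ))) ≤ 1 / (N : ℝ) := by
        rw [mul_one_div, div_le_div_iff₀ (by positivity) (by positivity)]
        linarith
      linarith
    · push Not at hz
      exact ⟨0, fun y hy _ => hz y hy⟩
  obtain ⟨z, hz⟩ := hone
  set I : Finset X := {β, β'} with hI
  obtain ⟨c, hc0, hcpos⟩ := ker_exists I {()} (fun _ β => ef γ v X β z) (by
    rw [hI, Finset.card_pair hβ]; simp)
  have hcz : pk γ v X I c z = 0 := hc0 () (by simp)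
  set u := pk γ v X I c with hu
  have huoff : ∀ x, x ∉ X → u x = 0 := pk_off γ v X I c
  have hIE : ∀ b ∈ I, |eig γ v X b - E| ≤ γ := by
    intro b hb
    rw [hI, Finset.mem_insert, Finset.mem_singleton] at hb
    rcases hb with rfl | rfl
    · rw [← hE, sub_self, abs_zero]; exact hγ.le
    · rw [abs_sub_comm]; exact h
  have hLu : ∀ x ∈ X, |Lop γ v E u x| ≤ γ * nn I c := by
    intro x hx
    rw [hu, pk_Lop γ v X I E c x hx]
    have h1 := Finset.single_le_sum
      (f := fun x => pk γ v X I (fun β => (eig γ v X β - E) * c β) x ^ 2)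
      (fun x _ => sq_nonneg _) hx
    rw [pk_sq] at h1
    have h2 := nn_mul_le I c (fun β => eig γ v X β - E) γ hγ.le hIE
    exact (abs_le_of_sq_le_sq h1 (nn_nonneg _ _)).trans h2
  obtain ⟨x, hx, hmax⟩ := Finset.exists_max_image X (fun y => |u y|) ⟨β, β.2⟩
  have hmax' : ∀ y, |u y| ≤ |u x| := by
    intro y
    by_cases hy : y ∈ X
    · exact hmax y hy
    · rw [huoff y hy, abs_zero]; exact abs_nonneg _
  have hcX : (X.card : ℝ) ≤ N := by exact_mod_cast hX
  have hsum : nn I c ^ 2 ≤ N * |u x| ^ 2 := by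
    rw [← pk_sq γ v X I c]
    calc _ ≤ ∑ y ∈ X, |u x| ^ 2 := by
          apply Finset.sum_le_sum
          intro y hy
          rw [← sq_abs]
          exact pow_le_pow_left₀ (abs_nonneg _) (hmax y hy) 2
      _ = X.card * |u x| ^ 2 := by rw [Finset.sum_const, nsmul_eq_mul]
      _ ≤ _ := mul_le_mul_of_nonneg_right hcX (by positivity)
  have hnN : nn I c ≤ N * |u x| := by
    apply abs_le_of_sq_le_sq' _ (by positivity) |>.2
    have := sq_nonneg (|u x|)
    nlinarith
  have hux : 0 < |u x| := by
    by_contra hc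
    have : |u x| = 0 := le_antisymm (not_lt.1 hc) (abs_nonneg _)
    rw [this] at hnN
    linarith
  have hxz : x ≠ z := by
    intro hxz
    rw [hxz, hcz, abs_zero] at hux
    exact lt_irrefl _ hux
  have h1 := hz x hx hxz
  have h2 := hLu x hx
  have hnb := nb_le u x _ (fun y _ => hmax' y)
  have h3 : |2 * d * γ + v x - E| * |u x| ≤ γ * nn I c + γ * (2 * d * |u x|) := by
    rw [← abs_mul]
    have e : (2 * d * γ + v x - E) * u x = Lop γ v E u x + γ * nb u x := by unfold Lop; ring
    rw [e]
    refine (abs_add_le _ _).trans ?_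
    rw [abs_mul γ, abs_of_pos hγ]
    have := mul_le_mul_of_nonneg_left hnb hγ.le
    linarith
  have h4 : (1 / (4 * (N : ℝ))) * |u x| ≤ (γ * (N + 2 * d)) * |u x| := by
    have a1 := mul_le_mul_of_nonneg_right h1 hux.le
    have a2 := mul_le_mul_of_nonneg_left hnN hγ.le
    calc _ ≤ _ := a1
      _ ≤ _ := h3
      _ ≤ γ * (N * |u x|) + γ * (2 * d * |u x|) := by linarith
      _ = _ := by ring
  have h5 := le_of_mul_le_mul_right h4 hux
  rw [div_le_iff₀ (by positivity)] at h5
  nlinarith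

/-- crude bound -/
lemma crude {d : ℕ} {γ : ℝ} (hγ : 0 < γ) (N : ℕ) (hN : 2 ≤ N)
    (hNγ : 4 * N * (N + 2 * d) * γ < 1) (X : Finset (Site d)) (hX : X.card ≤ N)
    (δ : ℝ) (hδ : δ ≤ γ) :
    prob (fun ω : X → Fin N => ∃ β β' : X, β ≠ β' ∧
      |eig γ (potential N X ω) X β - eig γ (potential N X ω) X β'| < δ) ≤
      (X.card : ℝ) ^ 2 * (1 / (N : ℝ)) := by
  classical
  refine le_trans (prob_mono ?_) ((coin_prob (ι := X) N (by omega)).trans (by rw [Fintype.card_coe]))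
  rintro ω ⟨β, β', hne, h⟩
  by_contra hc
  push Not at hc
  exact distinct_gap hγ N hN hNγ X hX ω hc β β' hne (h.le.trans hδ)

end MLS
namespace MLS

/-- a close pair produces a cluster -/
lemma pair_cluster {d : ℕ} {γ κ : ℝ} (hG : HG d γ κ) (s k A : ℕ) (hs : 3 ≤ s)
    (X : Finset (Site d)) (v : Site d → ℝ) (ρ : ℕ)
    (hcard : (X.card : ℝ) * (γ ^ LL s k) ^ 2 ≤ 1)
    (hA : (9 * LL s k) ^ d ≤ 2 ^ A)
    (hgood : ∀ E, ∀ x1 ∈ X, ∀ x2 ∈ X, far s k x1 x2 → bad γ κ s k X x1 E v →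
      bad γ κ s k X x2 E v → False)
    (β β' : X) (hne : β ≠ β')
    (h : |eig γ v X β - eig γ v X β'| ≤ γ ^ (8 * ρ ^ A * LL s k)) :
    ∃ a < A, cluster γ κ s k (8 * ρ ^ a * LL s k) (8 * ρ ^ (a + 1) * LL s k) X v := by
  classical
  have hγ := hG.pos
  set E := eig γ v X β with hE
  obtain ⟨z, hz, hpos, hmax, -⟩ := ef_argmax γ v X β
  have hzbad := max_bad hG s k hs X E v _ z hpos (ef_off γ v X β) hmax (by
    intro x hx
    rw [ef_eig γ v X E β x hx, hE, sub_self, zero_mul, abs_zero]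
    positivity)
  have h0 := few_eig hG s k hs X E v z hcard (by
    intro x hx hb
    by_contra hc
    exact hgood E z hz x hx hc hzbad hb) (near γ v X E (8 * LL s k)) (by
    intro b hb
    rwa [mem_near] at hb)
  obtain ⟨a, ha, hcl⟩ := pigeon (fun a => (near γ v X E (8 * ρ ^ a * LL s k)).card) A
    (by simpa using h0.trans hA) (by
      have : ({β, β'} : Finset X) ⊆ near γ v X E (8 * ρ ^ A * LL s k) := by
        intro b hb
        rw [Finset.mem_insert, Finset.mem_singleton] at hb
        rw [mem_near]
        rcases hb with rfl | rfl
        · rw [← hE, sub_self, abs_zero]; positivity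
        · rw [abs_sub_comm]; exact h
      have h2 := Finset.card_le_card this
      rwa [Finset.card_pair hne] at h2)
  exact ⟨a, ha, β, hgood _, hcl⟩

/-- numerical bound for one cluster scale -/
lemma cluster_num {d s q N : ℕ} (h : HP d s q N) (Z : Finset (Site d)) (i : Fin d) (l w : ℕ)
    (hw : 8 * l ≤ w) :
    (((codes i Z w (35 * w)).card * Z.card : ℕ) : ℝ) / (N : ℝ) ^ w ≤
      4 * (Z.card : ℝ) ^ 2 / 2 ^ (8 * l) := by
  have h1 := card_codes i Z w (35 * w)
  have hd := h.hd
  have hN := h.hN2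
  have hN3 : 2 * (4 * d) ^ 35 ≤ N := by
    refine le_trans ?_ hN
    exact Nat.mul_le_mul (by norm_num) (Nat.pow_le_pow_right (by omega) (by norm_num))
  rw [div_le_div_iff₀ (by have := h.N2; positivity) (by positivity)]
  have key : ((codes i Z w (35 * w)).card * Z.card) * 2 ^ (8 * l) ≤ 4 * Z.card ^ 2 * N ^ w := by
    calc _ ≤ ((Z.card * (2 * ((2 * d) ^ (35 * w) * 2 ^ (35 * w + 1)))) * Z.card) * 2 ^ w :=
          Nat.mul_le_mul (Nat.mul_le_mul_right _ h1) (Nat.pow_le_pow_right (by norm_num) hw)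
      _ = 4 * Z.card ^ 2 * (2 * (4 * d) ^ 35) ^ w := by
          have e : (2 * (4 * d) ^ 35) ^ w = 2 ^ w * (2 ^ (35 * w) * (2 * d) ^ (35 * w)) := by
            rw [mul_pow 2 ((4 * d) ^ 35) w, ← pow_mul (4 * d), ← mul_pow 2 (2 * d) (35 * w)]
            congr 2; ring
          rw [e, pow_succ]
          ring
      _ ≤ _ := Nat.mul_le_mul_left _ (Nat.pow_le_pow_left hN3 w)
  exact_mod_cast key

/-- numerical bound for the number of scales -/
lemma A_num {d s q N : ℕ} (h : HP d s q N) (k A : ℕ) (hA : A ≤ (9 * LL s k) ^ d) :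
    (A : ℝ) * (4 / 2 ^ (8 * LL s k)) ≤ ((LL s k : ℝ) ^ q)⁻¹ := by
  set l := LL s k with hl
  have hl0 := LL_ge0 s k
  have h24 : 2 ^ 24 ≤ l := (Nat.pow_le_pow_right (by norm_num) h.hs).trans hl0
  have hp := h.hpow l hl0
  have h1 : 4 ≤ 2 ^ l := by
    calc 4 = 2 ^ 2 := by norm_num
      _ ≤ 2 ^ l := Nat.pow_le_pow_right (by norm_num) (by omega)
  have h2 : (9 * l) ^ d ≤ 2 ^ l := by
    refine le_trans ?_ hp
    calc (9 * l) ^ d ≤ (l * l) ^ d := Nat.pow_le_pow_left (Nat.mul_le_mul_right _ (by omega)) d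
      _ = l ^ (2 * d) := by rw [pow_mul]; congr 1; ring
      _ ≤ _ := Nat.pow_le_pow_right (by omega) (by omega)
  have h3 : l ^ q ≤ 2 ^ l := le_trans (Nat.pow_le_pow_right (by omega) (by omega)) hp
  have key : A * 4 * l ^ q ≤ 2 ^ (8 * l) := by
    calc A * 4 * l ^ q ≤ 2 ^ l * 2 ^ l * 2 ^ l :=
          Nat.mul_le_mul (Nat.mul_le_mul (hA.trans h2) h1) h3
      _ = 2 ^ (3 * l) := by ring
      _ ≤ _ := Nat.pow_le_pow_right (by norm_num) (by omega)
  have hlp : (0 : ℝ) < (l : ℝ) ^ q := by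
    have : (0 : ℝ) < l := by exact_mod_cast (by omega : 0 < l)
    positivity
  rw [← one_div, ← mul_div_assoc, div_le_div_iff₀ (by positivity) hlp, one_mul]
  exact_mod_cast key

/-- pair probability at a given scale -/
theorem pair_prob {d s q N : ℕ} {γ κ : ℝ} (h : HA d s q N γ κ) (i : Fin d) (k A : ℕ)
    (a b : Site d) (hA1 : 1 ≤ A)
    (hA : (9 * LL s k) ^ d ≤ 2 ^ A) (hA2 : A ≤ (9 * LL s k) ^ d)
    (hcard : (Finset.Icc a b).card ≤ 2 ^ LL s k)
    (hside : (8 * (100 * d) ^ A * LL s k : ℤ) ≤ d * (b i - a i)) (δ : ℝ)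
    (hδ : δ ≤ γ ^ (8 * (100 * d) ^ A * LL s k)) :
    prob (fun ω : ↥(Finset.Icc a b) → Fin N => ∃ β β' : ↥(Finset.Icc a b), β ≠ β' ∧
      |eig γ (potential N (Finset.Icc a b) ω) (Finset.Icc a b) β -
        eig γ (potential N (Finset.Icc a b) ω) (Finset.Icc a b) β'| < δ) ≤
      ((Finset.Icc a b).card : ℝ) ^ 2 * ((LL s k : ℝ) ^ (10 * d) * ((LL s k : ℝ) ^ q)⁻¹) := by
  set Z := Finset.Icc a b with hZ
  have hG := h.hG
  have hγ := hG.pos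
  have hs : 3 ≤ s := by have := h.hP.hs; omega
  have hd := h.hP.hd
  have hl1 := LL_pos s k
  have hcard2 : (Z.card : ℝ) * (γ ^ LL s k) ^ 2 ≤ 1 := by
    have h1 : (Z.card : ℝ) ≤ 2 ^ LL s k := by exact_mod_cast hcard
    have h2 : (2 * γ ^ 2) ^ LL s k ≤ 1 := by
      apply pow_le_one₀ (by positivity)
      have := hG.small
      nlinarith
    calc _ ≤ (2 : ℝ) ^ LL s k * (γ ^ LL s k) ^ 2 := mul_le_mul_of_nonneg_right h1 (by positivity)
      _ = (2 * γ ^ 2) ^ LL s k := by rw [mul_pow, ← pow_mul, ← pow_mul, mul_comm 2 (LL s k)]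
      _ ≤ 1 := h2
  have hdZ : (0 : ℤ) < d := by exact_mod_cast hd
  have hsa : ∀ c < A, (800 * ((100 * d) ^ c * LL s k) : ℤ) ≤ b i - a i := by
    intro c hc
    have h1 : ((100 * d : ℤ)) ^ (c + 1) ≤ (100 * d) ^ A := by
      apply pow_le_pow_right₀ _ (by omega)
      omega
    have hlZ : (0 : ℤ) ≤ LL s k := by positivity
    have h2 : (8 * (100 * d) ^ (c + 1) * LL s k : ℤ) ≤ d * (b i - a i) := by
      refine le_trans ?_ hside
      apply mul_le_mul_of_nonneg_right _ hlZ
      linarith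
    apply le_of_mul_le_mul_left _ hdZ
    refine le_trans (le_of_eq ?_) h2
    rw [pow_succ]; ring
  have hside0 : (128 * LL s k : ℤ) ≤ b i - a i := by
    have := hsa 0 (by omega)
    simp only [pow_zero, one_mul] at this
    have hlZ : (0 : ℤ) ≤ LL s k := by positivity
    linarith
  have hall := all_E h i k a b hside0
  have hcl : ∀ c ∈ Finset.range A, prob (fun ω : Z → Fin N =>
      cluster γ κ s k (8 * (100 * d) ^ c * LL s k) (8 * (100 * d) ^ (c + 1) * LL s k) Z
        (potential N Z ω)) ≤ 4 * (Z.card : ℝ) ^ 2 / 2 ^ (8 * LL s k) := by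
    intro c hc
    rw [Finset.mem_range] at hc
    have hp1 : 1 ≤ (100 * d) ^ c := Nat.one_le_pow _ _ (by omega)
    refine (cluster_prob hG s k (8 * (100 * d) ^ c) (8 * (100 * d) ^ (c + 1) * LL s k) hs N h.hP.N2
      h.hNγ (by omega) ?_ a b i ?_ hcard2).trans
      (cluster_num h.hP Z i (LL s k) _ (Nat.mul_le_mul_right _ (by omega)))
    · rw [← mul_assoc]
      apply Nat.mul_le_mul_right
      rw [pow_succ]
      nlinarith
    · have := hsa c hc
      push_cast
      have hlZ : (0 : ℤ) ≤ (100 * d) ^ c * LL s k := by positivity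
      linarith
  have hmain : prob (fun ω : Z → Fin N => ∃ β β' : Z, β ≠ β' ∧
      |eig γ (potential N Z ω) Z β - eig γ (potential N Z ω) Z β'| < δ) ≤
      (Z.card : ℝ) ^ 2 * ((LL s k : ℝ) ^ (9 * d) * ((LL s k : ℝ) ^ q)⁻¹) +
      ((Finset.range A).card : ℝ) * (4 * (Z.card : ℝ) ^ 2 / 2 ^ (8 * LL s k)) := by
    refine le_trans (prob_mono ?_) ((prob_or _ _).trans
      (add_le_add hall (prob_exists_le (Finset.range A) _ _ hcl)))
    rintro ω ⟨β, β', hne, hβ⟩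
    by_cases hgood : ∃ E, ∃ x1 ∈ Z, ∃ x2 ∈ Z,
      far s k x1 x2 ∧ bad γ κ s k Z x1 E (potential N Z ω) ∧ bad γ κ s k Z x2 E (potential N Z ω)
    · exact Or.inl hgood
    · right
      obtain ⟨c, hc, hcc⟩ := pair_cluster hG s k A hs Z (potential N Z ω) (100 * d) hcard2 hA
        (fun E x1 h1 x2 h2 hf hb1 hb2 => hgood ⟨E, x1, h1, x2, h2, hf, hb1, hb2⟩) β β' hne
        (hβ.le.trans hδ)
      exact ⟨c, Finset.mem_range.2 hc, hcc⟩
  refine hmain.trans ?_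
  rw [Finset.card_range]
  have hAn := A_num h.hP k A hA2
  have hl2 : (2 : ℝ) ≤ LL s k := by
    have := LL_ge0 s k
    have h24 : 2 ^ 24 ≤ LL s k := (Nat.pow_le_pow_right (by norm_num) h.hP.hs).trans this
    exact_mod_cast (by omega : 2 ≤ LL s k)
  set l : ℝ := ((LL s k : ℕ) : ℝ)
  have hq0 : 0 ≤ (l ^ q)⁻¹ := by positivity
  have hl9 : 1 ≤ l ^ (9 * d) := one_le_pow₀ (by linarith)
  have hl10 : l ^ (9 * d) * 2 ≤ l ^ (10 * d) := by
    have e : l ^ (10 * d) = l ^ (9 * d) * l ^ d := by rw [← pow_add]; congr 1; ring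
    rw [e]
    apply mul_le_mul_of_nonneg_left _ (by positivity)
    exact hl2.trans (le_self_pow₀ (by linarith) (by omega))
  have hZ0 : 0 ≤ (Z.card : ℝ) ^ 2 := by positivity
  calc _ = (Z.card : ℝ) ^ 2 * (l ^ (9 * d) * (l ^ q)⁻¹ + A * (4 / 2 ^ (8 * LL s k))) := by ring
    _ ≤ (Z.card : ℝ) ^ 2 * (l ^ (9 * d) * (l ^ q)⁻¹ + (l ^ q)⁻¹) := by
        apply mul_le_mul_of_nonneg_left _ hZ0; linarith
    _ ≤ _ := by
        apply mul_le_mul_of_nonneg_left _ hZ0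
        nlinarith

end MLS
namespace MLS

lemma exists_pow_le (c : ℕ) : ∃ s : ℕ, 24 ≤ s ∧ ∀ n : ℕ, 2 ^ s ≤ n → n ^ c ≤ 2 ^ n := by
  have h := tendsto_pow_const_div_const_pow_of_one_lt c (r := 2) (by norm_num)
  have h2 := h.eventually (gt_mem_nhds (show (0 : ℝ) < 1 by norm_num))
  obtain ⟨M, hM⟩ := Filter.eventually_atTop.1 h2
  refine ⟨max 24 M, le_max_left _ _, fun n hn => ?_⟩
  have hMn : M ≤ n :=
    ((le_max_right 24 M).trans (Nat.lt_two_pow_self).le).trans hn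
  have := hM n hMn
  rw [div_lt_one (by positivity)] at this
  exact_mod_cast this.le

lemma LL_succ_le_sq (s k : ℕ) (hs : 24 ≤ s) : LL s (k + 1) ≤ LL s k ^ 2 := by
  have h := LL_sq s k hs
  have h1 := LL_pos s k
  have h2 : LL s (k + 1) ^ 2 ≤ (LL s k ^ 2) ^ 2 := by
    refine h.trans ?_
    rw [← pow_mul]
    exact Nat.pow_le_pow_right h1 (by norm_num)
  exact (Nat.pow_le_pow_iff_left (by norm_num)).1 h2

/-- choice of the scale -/
lemma exists_scale (s e : ℕ) (he : 1 ≤ e) (L : ℝ) (hL : ((LL s 0 : ℝ)) ^ e ≤ L) :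
    ∃ k, (LL s k : ℝ) ^ e ≤ L ∧ L < (LL s (k + 1) : ℝ) ^ e := by
  classical
  have hex : ∃ k, L < (LL s k : ℝ) ^ e := by
    obtain ⟨n, hn⟩ := exists_nat_gt L
    refine ⟨n, hn.trans_le ?_⟩
    have h1 : n ≤ LL s n :=
      (Nat.lt_two_pow_self.le.trans (Nat.pow_le_pow_right (by norm_num) (by omega))).trans (LL_ge s n)
    have h2 : LL s n ≤ LL s n ^ e := Nat.le_self_pow (by omega) _
    exact_mod_cast h1.trans h2
  have hspec := Nat.find_spec hex
  have hmin := fun m hm => Nat.find_min hex (m := m) hm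
  cases hk : Nat.find hex with
  | zero => rw [hk] at hspec; exact absurd hspec (not_lt.2 hL)
  | succ k =>
    rw [hk] at hspec
    exact ⟨k, not_lt.1 (hmin k (by omega)), hspec⟩

/-- choice of the number of annuli -/
lemma exists_A (d l : ℕ) (hd : 1 ≤ d) (hl : 2 ^ 24 ≤ l) :
    ∃ A, 1 ≤ A ∧ (9 * l) ^ d ≤ 2 ^ A ∧ A ≤ (9 * l) ^ d ∧
      8 * (100 * d) ^ A * l ≤ l ^ (14 * d ^ 2 + 2) := by
  have hl1 : 1 ≤ l := by omega
  have hone : 1 < (9 * l) ^ d := Nat.one_lt_pow (by omega) (by omega)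
  have hA1 : 0 < Nat.clog 2 ((9 * l) ^ d) := Nat.clog_pos (by norm_num) hone
  have hlt := Nat.pow_pred_clog_lt_self (b := 2) (by norm_num) hone
  set A := Nat.clog 2 ((9 * l) ^ d) with hA
  rw [Nat.pred_eq_sub_one] at hlt
  have h2A : 2 ^ A ≤ l ^ (2 * d) := by
    have e1 : 2 ^ A = 2 ^ (A - 1) * 2 := by
      rw [← pow_succ]; congr 1; omega
    calc 2 ^ A = 2 ^ (A - 1) * 2 := e1
      _ ≤ (9 * l) ^ d * 2 ^ d := Nat.mul_le_mul hlt.le (Nat.le_self_pow (by omega) _)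
      _ = (9 * l * 2) ^ d := (mul_pow _ _ _).symm
      _ ≤ (l ^ 2) ^ d := Nat.pow_le_pow_left (by nlinarith) _
      _ = l ^ (2 * d) := (pow_mul _ _ _).symm
  have h100 : 100 * d ≤ 2 ^ (7 * d) := by
    rw [pow_mul]
    have h0 : d < 2 ^ d := Nat.lt_two_pow_self
    have h64 : 64 * 2 ≤ 64 * 2 ^ d := Nat.mul_le_mul_left _ (Nat.le_self_pow (by omega) _)
    have h3 : (2 ^ 7) ^ d = 64 ^ d * 2 ^ d := by rw [← mul_pow]; norm_num
    have h4 : 64 ≤ 64 ^ d := Nat.le_self_pow (by omega) _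
    rcases Nat.lt_or_ge d 2 with h | h
    · have : d = 1 := by omega
      subst this; norm_num
    · have h5 : 64 ^ 2 ≤ 64 ^ d := Nat.pow_le_pow_right (by norm_num) h
      rw [h3]
      nlinarith
  refine ⟨A, hA1, Nat.le_pow_clog (by norm_num) _, ?_, ?_⟩
  · have : A - 1 < 2 ^ (A - 1) := Nat.lt_two_pow_self
    omega
  · have h5 : (100 * d) ^ A ≤ l ^ (14 * d ^ 2) := by
      calc (100 * d) ^ A ≤ (2 ^ (7 * d)) ^ A := Nat.pow_le_pow_left h100 _
        _ = (2 ^ A) ^ (7 * d) := by rw [← pow_mul, ← pow_mul, mul_comm]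
        _ ≤ (l ^ (2 * d)) ^ (7 * d) := Nat.pow_le_pow_left h2A _
        _ = l ^ (14 * d ^ 2) := by rw [← pow_mul]; congr 1; ring
    calc 8 * (100 * d) ^ A * l = (100 * d) ^ A * (8 * l) := by ring
      _ ≤ l ^ (14 * d ^ 2) * l ^ 2 := Nat.mul_le_mul h5 (by nlinarith)
      _ = _ := (pow_add _ _ _).symm

/-- the longest side controls the diameter -/
lemma exists_side {d : ℕ} (hd : 1 ≤ d) (a b : Fin d → ℤ) (hab : a ≤ b) :
    ∃ i, (diam1 (Finset.Icc a b) : ℤ) ≤ d * (b i - a i) := by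
  have : Nonempty (Fin d) := ⟨⟨0, hd⟩⟩
  obtain ⟨i, hi⟩ := Finite.exists_max (fun i => b i - a i)
  refine ⟨i, ?_⟩
  have hi0 : 0 ≤ b i - a i := sub_nonneg.2 (hab i)
  have : diam1 (Finset.Icc a b) ≤ d * (b i - a i).toNat := by
    unfold diam1
    apply Finset.sup_le
    rintro ⟨x, y⟩ hxy
    rw [Finset.mem_product, Finset.mem_Icc, Finset.mem_Icc] at hxy
    obtain ⟨⟨hx1, hx2⟩, hy1, hy2⟩ := hxy
    unfold dist1
    calc ∑ j, (x j - y j).natAbs ≤ ∑ _j : Fin d, (b i - a i).toNat := by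
          apply Finset.sum_le_sum
          intro j _
          have h1 := hx1 j; have h2 := hx2 j; have h3 := hy1 j; have h4 := hy2 j
          have h5 := hi j
          simp only at h1 h2 h3 h4 h5
          omega
      _ = _ := by simp
  calc (diam1 (Finset.Icc a b) : ℤ) ≤ ((d * (b i - a i).toNat : ℕ) : ℤ) := by exact_mod_cast this
    _ = _ := by rw [Nat.cast_mul, Int.toNat_of_nonneg hi0]

lemma final_bound {d s q N P : ℕ} {γ κ : ℝ} (h : HA d s q N γ κ)
    (hq : 10 * d + 2 * (14 * d ^ 2 + 2) * P ≤ q)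
    (hNP : ((2 ^ s) ^ (14 * d ^ 2 + 2)) ^ P ≤ N)
    (hNγ : 4 * N * (N + 2 * d) * γ < 1) (hγ1 : γ < 1)
    (r : ℝ) (hr0 : 0 ≤ r) (hrP : r ≤ P)
    (a b : Fin d → ℤ) (hc : 2 ≤ (Finset.Icc a b).card) (δ : ℝ)
    (hδ0 : γ ^ ((diam1 (Finset.Icc a b) : ℝ)) ≤ δ) (hδ1 : δ < 1) :
    prob (fun ω : (Finset.Icc a b) → Fin N => ∃ β β' : (Finset.Icc a b), β ≠ β' ∧
      |eig γ (potential N (Finset.Icc a b) ω) (Finset.Icc a b) β -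
        eig γ (potential N (Finset.Icc a b) ω) (Finset.Icc a b) β'| < δ) ≤
      ((Finset.Icc a b).card : ℝ) ^ 2 * (Real.log δ / Real.log γ) ^ (-r) := by
  have hγ := h.hG.pos
  have hd := h.hG.hd
  have hs := h.hP.hs
  have hlogγ : Real.log γ < 0 := Real.log_neg hγ hγ1
  have hδpos : 0 < δ := (Real.rpow_pos_of_pos hγ _).trans_le hδ0
  have hlogδ : Real.log δ < 0 := Real.log_neg hδpos hδ1
  have hLpos : 0 < Real.log δ / Real.log γ := div_pos_of_neg_of_neg hlogδ hlogγ
  have hδL : δ = γ ^ (Real.log δ / Real.log γ) := by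
    rw [Real.rpow_def_of_pos hγ, mul_div_cancel₀ _ hlogγ.ne, Real.exp_log hδpos]
  have hLdiam : Real.log δ / Real.log γ ≤ diam1 (Finset.Icc a b) := by
    rw [div_le_iff_of_neg hlogγ, ← Real.log_rpow hγ]
    exact Real.log_le_log (Real.rpow_pos_of_pos hγ _) hδ0
  set L := Real.log δ / Real.log γ with hLdef
  have hpr := prob_le_one (fun ω : (Finset.Icc a b) → Fin N => ∃ β β' : (Finset.Icc a b), β ≠ β' ∧
      |eig γ (potential N (Finset.Icc a b) ω) (Finset.Icc a b) β -
        eig γ (potential N (Finset.Icc a b) ω) (Finset.Icc a b) β'| < δ)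
  have hcR : (2 : ℝ) ≤ ((Finset.Icc a b).card : ℝ) := by exact_mod_cast hc
  have hne : (Finset.Icc a b).Nonempty := Finset.card_pos.1 (by omega)
  have hab : a ≤ b := Finset.nonempty_Icc.1 hne
  obtain ⟨i, hi⟩ := exists_side hd a b hab
  generalize hZ : Finset.Icc a b = Z at *
  have hcc : (Z.card : ℝ) ≤ (Z.card : ℝ) ^ 2 := by nlinarith
  rcases le_or_gt L 1 with hL1 | hL1
  · refine hpr.trans ?_
    have h1 : 1 ≤ L ^ (-r) := Real.one_le_rpow_of_pos_of_le_one_of_nonpos hLpos hL1 (by linarith)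
    nlinarith
  have hrneg : L ^ (-r) = (L ^ r)⁻¹ := Real.rpow_neg hLpos.le _
  have hLr0 : 0 < L ^ r := Real.rpow_pos_of_pos hLpos _
  have hLrP : L ^ r ≤ L ^ P := by
    rw [← Real.rpow_natCast]; exact Real.rpow_le_rpow_of_exponent_le hL1.le hrP
  rw [hrneg]
  rcases le_or_gt (L ^ r) ((Z.card : ℝ) ^ 2) with hbig | hsmall
  · refine hpr.trans ?_
    rw [← div_eq_mul_inv, le_div_iff₀ hLr0]; linarith
  have hcardL : (Z.card : ℝ) ≤ L ^ P := by linarith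
  have hZ0 : 0 ≤ (Z.card : ℝ) ^ 2 := sq_nonneg _
  rcases lt_or_ge L ((LL s 0 : ℝ) ^ (14 * d ^ 2 + 2)) with hLs | hLs
  · have hLN : L ^ P ≤ N := by
      have h1 : L ^ P ≤ ((LL s 0 : ℝ) ^ (14 * d ^ 2 + 2)) ^ P := pow_le_pow_left₀ hLpos.le hLs.le _
      refine h1.trans ?_
      have : LL s 0 = 2 ^ s := rfl
      rw [this]
      exact_mod_cast hNP
    have hZN : Z.card ≤ N := by exact_mod_cast hcardL.trans hLN
    refine (crude hγ N h.hP.N2 hNγ Z hZN δ ?_).trans ?_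
    · rw [hδL]
      calc γ ^ L ≤ γ ^ (1 : ℝ) := Real.rpow_le_rpow_of_exponent_ge hγ hγ1.le hL1.le
        _ = γ := Real.rpow_one _
    · apply mul_le_mul_of_nonneg_left _ hZ0
      rw [one_div]
      exact inv_anti₀ hLr0 (hLrP.trans hLN)
  · obtain ⟨k, hk1, hk2⟩ := exists_scale s (14 * d ^ 2 + 2) (by omega) L hLs
    have hl24 : 2 ^ 24 ≤ LL s k := (Nat.pow_le_pow_right (by norm_num) hs).trans (LL_ge0 s k)
    obtain ⟨A, hA1, hA2, hA3, hA4⟩ := exists_A d (LL s k) hd hl24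
    have hl1 : (1 : ℝ) ≤ LL s k := by exact_mod_cast LL_pos s k
    have hLl : L ^ P ≤ (LL s k : ℝ) ^ (2 * (14 * d ^ 2 + 2) * P) := by
      rw [pow_mul _ _ P]
      apply pow_le_pow_left₀ hLpos.le
      rw [pow_mul]
      refine hk2.le.trans (pow_le_pow_left₀ (by positivity) ?_ _)
      exact_mod_cast LL_succ_le_sq s k hs
    have hcard : Z.card ≤ 2 ^ LL s k := by
      have h1 : Z.card ≤ LL s k ^ (2 * (14 * d ^ 2 + 2) * P) := by
        exact_mod_cast hcardL.trans hLl
      refine h1.trans (le_trans ?_ (h.hP.hpow (LL s k) (LL_ge0 s k)))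
      exact Nat.pow_le_pow_right (LL_pos s k) (by omega)
    have hwL : ((8 * (100 * d) ^ A * LL s k : ℕ) : ℝ) ≤ L := by
      refine le_trans ?_ hk1
      exact_mod_cast hA4
    have hside : (8 * (100 * d) ^ A * LL s k : ℤ) ≤ d * (b i - a i) := by
      refine le_trans ?_ hi
      have : 8 * (100 * d) ^ A * LL s k ≤ diam1 Z := by exact_mod_cast hwL.trans hLdiam
      exact_mod_cast this
    have hδw : δ ≤ γ ^ (8 * (100 * d) ^ A * LL s k) := by
      rw [hδL, ← Real.rpow_natCast]
      exact Real.rpow_le_rpow_of_exponent_ge hγ hγ1.le hwL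
    subst hZ
    refine (pair_prob h i k A a b hA1 hA2 hA3 hcard hside δ hδw).trans ?_
    apply mul_le_mul_of_nonneg_left _ hZ0
    have hq' : (LL s k : ℝ) ^ (10 * d) * (LL s k : ℝ) ^ (2 * (14 * d ^ 2 + 2) * P) ≤
        (LL s k : ℝ) ^ q := by
      rw [← pow_add]; exact pow_le_pow_right₀ hl1 hq
    have hlq : 0 < (LL s k : ℝ) ^ q := by positivity
    rw [← div_eq_mul_inv, ← one_div, div_le_div_iff₀ hlq hLr0, one_mul]
    refine le_trans ?_ hq'
    exact mul_le_mul_of_nonneg_left (hLrP.trans hLl) (by positivity)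

end MLS

/-- **Theorem 1.3** (minimum level spacing).
For `p` large, `N` large (depending on `p`), `γ` small (depending on `N`), every finite
rectangle `Λ ⊂ ℤ^d` with `|Λ| ≥ 2` and every `δ` with `γ^{diam Λ} ≤ δ < 1`, the
probability that two eigenvalues of `H` (listed with multiplicity) are within `δ` of
each other is at most `|Λ|² (log_γ δ)^{-(p/2-1)}`. -/
theorem minimum_level_spacing :
    ∀ d : ℕ, 1 ≤ d →
    ∃ p₀ : ℝ, ∀ p : ℝ, p₀ ≤ p →
    ∃ N₀ : ℕ, ∀ N : ℕ, N₀ ≤ N →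
    ∃ γ₀ : ℝ, 0 < γ₀ ∧ γ₀ < 1 ∧
    ∀ γ : ℝ, 0 < γ → γ ≤ γ₀ →
    ∀ Λ : Finset (Fin d → ℤ), IsRect Λ → 2 ≤ Λ.card →
    ∀ δ : ℝ, γ ^ ((diam1 Λ : ℝ)) ≤ δ → δ < 1 →
    prob (fun ω : ↥Λ → Fin N =>
        ∃ β β' : ↥Λ, β ≠ β' ∧
          |(hamOn_isHermitian d γ (potential N Λ ω) Λ).eigenvalues β -
            (hamOn_isHermitian d γ (potential N Λ ω) Λ).eigenvalues β'| < δ)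
      ≤ ((Λ.card : ℝ))^2 * (Real.log δ / Real.log γ) ^ (-(p/2 - 1)) := by
  intro d hd
  refine ⟨2, fun p hp => ?_⟩
  obtain ⟨P, hP⟩ := exists_nat_ge p
  set q := 10 * d + 2 * (14 * d ^ 2 + 2) * P + 12 * d with hq
  obtain ⟨s, hs, hpow⟩ := MLS.exists_pow_le (2 * q + 6 * d)
  refine ⟨(3 * 2 ^ s) ^ d * (2 ^ s) ^ q + 2 ^ 8 * (4 * d) ^ 40 +
    ((2 ^ s) ^ (14 * d ^ 2 + 2)) ^ P, fun N hN => ?_⟩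
  have hHP : MLS.HP d s q N := ⟨hd, hs, by omega, hpow, by omega, by omega⟩
  have hN2 : 2 ≤ N := hHP.N2
  have hNR : (2 : ℝ) ≤ N := by exact_mod_cast hN2
  have hdR : (1 : ℝ) ≤ d := by exact_mod_cast hd
  have h514 : (1 : ℝ) ≤ 514 ^ d := one_le_pow₀ (by norm_num)
  set D : ℝ := 514 ^ d + (2 * (d : ℝ)) ^ 2 * (16 * N ^ 2) + 100 * N + 4 * N * (N + 2 * d) + 1 with hD
  have hp1 : 0 < (2 * (d : ℝ)) ^ 2 * (16 * N ^ 2) := by positivity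
  have hp2 : 0 < 4 * (N : ℝ) * (N + 2 * d) := by positivity
  have hD1 : 1 < D := by linarith
  have hD0 : 0 < D := by linarith
  refine ⟨1 / D, by positivity, by rw [div_lt_one hD0]; exact hD1, ?_⟩
  intro γ hγ hγ0 Λ hΛ hc δ hδ0 hδ1
  have hDγ : D * γ ≤ 1 := by
    rw [le_div_iff₀ hD0] at hγ0; linarith
  have key : ∀ x : ℝ, x ≤ D → x * γ ≤ 1 := fun x hx =>
    (mul_le_mul_of_nonneg_right hx hγ.le).trans hDγ
  have keylt : ∀ x : ℝ, x < D → x * γ < 1 := fun x hx =>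
    (mul_lt_mul_of_pos_right hx hγ).trans_le hDγ
  have hHG : MLS.HG d γ (1 / (4 * N)) := by
    refine ⟨hd, hγ, by positivity, ?_, key _ (by linarith), ?_⟩
    · rw [div_le_one (by positivity)]; linarith
    · have := key _ (show (2 * (d : ℝ)) ^ 2 * (16 * N ^ 2) ≤ D by linarith)
      rw [div_pow, one_pow, le_div_iff₀ (by positivity)]
      linarith
  have hHA : MLS.HA d s q N γ (1 / (4 * N)) := by
    refine ⟨hHG, hHP, ?_, key _ (by linarith)⟩
    rw [mul_one_div, div_self (by positivity)]
  have hγ1 : γ < 1 := by simpa using keylt 1 hD1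
  obtain ⟨a, b, rfl⟩ := hΛ
  exact MLS.final_bound (P := P) hHA (by omega) (by omega) (keylt _ (by linarith)) hγ1 (p / 2 - 1)
    (by linarith) (by linarith) a b hc δ hδ0 hδ1
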